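/- For every first-order formula φ in the language of rings with m free variables there exist a real constant C > 0, an integer r ≥ 1, exponents d_1, …, d_r ∈ {0, 1, …, m} and positive rationals μ_1, …, μ_r with the following property: for every prime p and k ≥ 1, writing Q = p^k and N for the number of m-tuples over GaloisField p k at which φ is satisfied, either N = 0, or there exists i ∈ {1, …, r} with |N − μ_i·Q^{d_i}| ≤ C·Q^{d_i}/√Q. -/

import Mathlib

open FirstOrder

/-- The number of `k`-tuples of a (finite) ring `K` satisfying the ring-language formula `φ`,
where `K` is viewed as a structure for the language of rings via `compatibleRingOfRing`. -/
noncomputable def ringFormulaCount {k : ℕ} (φ : Language.ring.Formula (Fin k))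
    (K : Type*) [Add K] [Mul K] [Neg K] [One K] [Zero K] : ℕ :=
  letI := Ring.compatibleRingOfRing K
  Nat.card {x : Fin k → K // φ.Realize x}


set_option linter.all false
section
namespace CDM
open Polynomial

section Resultants
variable {F : Type*} [Field F]

lemma natDegree_det_le {n : ℕ} (M : Matrix (Fin n) (Fin n) F[X]) (D : Fin n → ℕ)
    (h : ∀ i j, (M i j).natDegree ≤ D j) : M.det.natDegree ≤ ∑ j, D j := by
  rw [Matrix.det_apply]
  refine natDegree_sum_le_of_forall_le _ _ fun σ _ => ?_
  refine (natDegree_smul_le _ _).trans ?_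
  refine (natDegree_prod_le _ _).trans ?_
  exact Finset.sum_le_sum fun i _ => h _ _

lemma natDegree_resultant_le (f g : F[X][X]) (m n df dg : ℕ) (hf : ∀ i, (f.coeff i).natDegree ≤ df)
    (hg : ∀ i, (g.coeff i).natDegree ≤ dg) :
    (resultant f g m n).natDegree ≤ m * dg + n * df := by
  have := natDegree_det_le (sylvester f g m n) (fun j => j.addCases (fun _ => dg) (fun _ => df)) (by
    intro i j
    induction j using Fin.addCases with
    | left j => simp only [sylvester, Matrix.of_apply, Fin.addCases_left]; split_ifs <;> simp [hg]
    | right j => simp only [sylvester, Matrix.of_apply, Fin.addCases_right]; split_ifs <;> simp [hf])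
  refine this.trans ?_
  rw [Fin.sum_univ_add]
  simp

lemma resultant_ne_zero_of_not_dvd (f g : F[X][X]) (hm : f.Monic) (hi : Irreducible f)
    (hg : ¬ f ∣ g) (n : ℕ) (hn : g.natDegree ≤ n) : resultant f g f.natDegree n ≠ 0 := by
  have h1 : resultant f g f.natDegree g.natDegree ≠ 0 := by
    intro h0
    have hinj : Function.Injective (algebraMap F[X] (RatFunc F)) :=
      IsFractionRing.injective _ _
    have h2 : resultant (f.map (algebraMap F[X] (RatFunc F))) (g.map (algebraMap F[X] (RatFunc F))) = 0 := by
      rw [natDegree_map_eq_of_injective hinj, natDegree_map_eq_of_injective hinj, resultant_map_map,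
        h0, map_zero]
    rw [resultant_eq_zero_iff] at h2
    apply h2.2
    have hirr := (hm.irreducible_iff_irreducible_map_fraction_map (K := RatFunc F)).1 hi
    rw [hirr.coprime_iff_not_dvd]
    exact fun h => hg ((map_dvd_map _ hinj hm).1 h)
  obtain ⟨k, rfl⟩ := Nat.exists_eq_add_of_le hn
  rw [resultant_add_right_deg _ _ _ _ _ le_rfl]
  refine mul_ne_zero ?_ h1
  simp [hm.coeff_natDegree]

/-- Taylor expansion hom `F[X] → F⟦τ⟧`, `X ↦ x + τ`. -/
noncomputable def evS (x : F) : F[X] →+* PowerSeries F :=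
  (Polynomial.coeToPowerSeries.ringHom).comp (taylorAlgHom x).toRingHom

lemma evS_apply (x : F) (p : F[X]) : evS x p = ((taylor x p : F[X]) : PowerSeries F) := rfl

lemma evS_X (x : F) : evS x X = PowerSeries.C x + PowerSeries.X := by
  rw [evS_apply]; simp [add_comm]

lemma evS_C (x a : F) : evS x (C a) = PowerSeries.C a := by
  rw [evS_apply]; simp

lemma evS_dvd (x : F) (p : F[X]) (k : ℕ) (h : PowerSeries.X ^ k ∣ evS x p) : (X - C x) ^ k ∣ p := by
  rw [evS_apply, PowerSeries.X_pow_dvd_iff] at h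
  simp only [Polynomial.coeff_coe] at h
  have h3 : X ^ k ∣ taylor x p := X_pow_dvd_iff.2 h
  have := map_dvd (taylorEquiv x).symm h3
  have h4 : (taylorEquiv x).symm (taylor x p) = p := (taylorEquiv x).symm_apply_apply p
  rw [h4, map_pow] at this
  convert this using 2
  rw [← (taylorEquiv x).symm_apply_apply (X - C x)]
  congr 1
  change taylor x (X - C x) = X
  simp

/-- lemma Z -/
theorem lemmaZ (f g : F[X][X]) (hm : f.Monic) (hi : Irreducible f) (hg : ¬ f ∣ g)
    (d A B M : ℕ) (hfd : ∀ i, (f.coeff i).natDegree ≤ d) (hgA : ∀ i, (g.coeff i).natDegree ≤ A)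
    (hgB : g.natDegree ≤ B) [DecidableEq F] (T : Finset (F × F)) (U : F × F → PowerSeries F)
    (hU : ∀ P ∈ T, PowerSeries.constantCoeff (U P) = P.2)
    (hroot : ∀ P ∈ T, (f.map (evS P.1)).eval (U P) = 0)
    (hord : ∀ P ∈ T, PowerSeries.X ^ M ∣ (g.map (evS P.1)).eval (U P)) :
    T.card * M ≤ f.natDegree * A + B * d := by
  set R := resultant f g f.natDegree B with hR
  have hR0 : R ≠ 0 := resultant_ne_zero_of_not_dvd f g hm hi hg B hgB
  refine le_trans ?_ (natDegree_resultant_le f g f.natDegree B d A hfd hgA)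
  rw [← hR]
  have key : ∀ x : F, (T.filter (fun P => P.1 = x)).card * M ≤ R.rootMultiplicity x := by
    intro x
    rw [le_rootMultiplicity_iff hR0]
    apply evS_dvd
    set Tx := T.filter (fun P => P.1 = x)
    have hTx : ∀ P ∈ Tx, P ∈ T ∧ P.1 = x := fun P hP => by simpa [Tx] using hP
    have hinjU : Set.InjOn U Tx := by
      intro P hP Q hQ h
      have h1 := hTx P hP; have h2 := hTx Q hQ
      ext
      · rw [h1.2, h2.2]
      · rw [← hU P h1.1, ← hU Q h2.1, h]
    have hfm : (f.map (evS x)).Monic := hm.map _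
    obtain ⟨h, hh⟩ : (∏ P ∈ Tx, (X - C (U P))) ∣ f.map (evS x) := by
      have : (∏ P ∈ Tx, (X - C (U P))) = ((Tx.val.map U).map (fun a => X - C a)).prod := by
        rw [Multiset.map_map]; rfl
      rw [this, Multiset.prod_X_sub_C_dvd_iff_le_roots hfm.ne_zero]
      rw [Multiset.le_iff_subset]
      · intro u hu
        simp only [Multiset.mem_map, Finset.mem_val] at hu
        obtain ⟨P, hP, rfl⟩ := hu
        rw [mem_roots hfm.ne_zero, IsRoot.def]
        obtain ⟨h1, rfl⟩ := hTx P hP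
        exact hroot P h1
      · exact (Multiset.nodup_map_iff_inj_on Tx.nodup).2 (fun a ha b hb hab => hinjU ha hb hab)
    have hPm : (∏ P ∈ Tx, (X - C (U P))).Monic := monic_prod_of_monic _ _ fun P _ => monic_X_sub_C _
    have hgd : (g.map (evS x)).natDegree ≤ B := natDegree_map_le.trans hgB
    have hnd : f.natDegree = (∏ P ∈ Tx, (X - C (U P))).natDegree + h.natDegree := by
      rw [← hPm.natDegree_mul' (by rintro rfl; simp at hh; exact hfm.ne_zero hh), ← hh, hm.natDegree_map]
    rw [hR, ← resultant_map_map, hh, hnd, resultant_mul_left _ _ _ _ hgd,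
      resultant_prod_left _ _ _ _ (by simp) hgd]
    apply Dvd.dvd.mul_right
    rw [mul_comm, pow_mul, ← Finset.prod_const]
    refine Finset.prod_dvd_prod_of_dvd _ _ fun P hP => ?_
    rw [natDegree_X_sub_C, resultant_X_sub_C_left _ _ _ hgd]
    obtain ⟨h1, rfl⟩ := hTx P hP
    exact hord P h1
  calc T.card * M = ∑ x ∈ T.image Prod.fst, (T.filter (fun P => P.1 = x)).card * M := by
        rw [← Finset.sum_mul, ← Finset.card_eq_sum_card_image]
    _ ≤ ∑ x ∈ T.image Prod.fst, R.rootMultiplicity x := Finset.sum_le_sum fun x _ => key x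
    _ = ∑ x ∈ T.image Prod.fst, R.roots.count x := by simp [count_roots]
    _ ≤ ∑ x ∈ (T.image Prod.fst ∪ R.roots.toFinset), R.roots.count x := 
        Finset.sum_le_sum_of_subset Finset.subset_union_left
    _ = R.roots.card := Multiset.sum_count_eq_card (fun x hx => by simp at *; tauto)
    _ ≤ _ := card_roots' _

lemma hensel_lift (f : F[X][X]) (hm : f.Monic) (x u : F) (h0 : f.evalEval x u = 0)
    (h1 : (derivative f).evalEval x u ≠ 0) :
    ∃ U : PowerSeries F, PowerSeries.constantCoeff U = u ∧ (f.map (evS x)).eval U = 0 := by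
  have hcc : ∀ g : F[X][X], PowerSeries.constantCoeff ((g.map (evS x)).eval (PowerSeries.C u)) = g.evalEval x u := by
    intro g
    have : (PowerSeries.constantCoeff (R := F)).comp (evS x) = evalRingHom x := by
      ext <;> simp [evS_X, evS_C]
    rw [eval_map, hom_eval₂, this]
    simp [eval₂_evalRingHom]
  obtain ⟨a, ha, hb⟩ := HenselianRing.is_henselian (I := Ideal.span {(PowerSeries.X : PowerSeries F)})
    (f.map (evS x)) (hm.map _) (PowerSeries.C u) (by
      rw [Ideal.mem_span_singleton, PowerSeries.X_dvd_iff, hcc, h0]) (by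
      apply IsUnit.map
      rw [PowerSeries.isUnit_iff_constantCoeff, derivative_map, hcc]
      exact h1.isUnit)
  refine ⟨a, ?_, ha⟩
  rw [Ideal.mem_span_singleton, PowerSeries.X_dvd_iff, map_sub] at hb
  simpa [sub_eq_zero] using hb

end Resultants
end CDM
end

section
namespace CDM
open Polynomial

section Psi
variable {F : Type*} [Field F]

abbrev W4 (F : Type*) [Field F] := MvPolynomial (Fin 4) F

noncomputable def mon4 (a b c d : ℕ) : W4 F :=
  MvPolynomial.X 0 ^ a * MvPolynomial.X 1 ^ b * MvPolynomial.X 2 ^ c * MvPolynomial.X 3 ^ d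

lemma mon4_mul (a b c d a' b' c' d' : ℕ) : (mon4 a b c d : W4 F) * mon4 a' b' c' d' =
    mon4 (a+a') (b+b') (c+c') (d+d') := by
  unfold mon4; ring

lemma monomial_eq_mon4 (e : Fin 4 →₀ ℕ) : (MvPolynomial.monomial e 1 : W4 F) = mon4 (e 0) (e 1) (e 2) (e 3) := by
  rw [MvPolynomial.monomial_eq, Finsupp.prod_fintype _ _ (by simp)]
  simp [Fin.prod_univ_four, mon4]

lemma mon4_eq_monomial (a b c d : ℕ) : (mon4 a b c d : W4 F) =
    MvPolynomial.monomial (Finsupp.equivFunOnFinite.symm ![a,b,c,d]) 1 := by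
  rw [monomial_eq_mon4]; simp

/-- extension of a function on exponents to a linear map -/
noncomputable def lin4 (φ : ℕ → ℕ → ℕ → ℕ → W4 F) : W4 F →ₗ[F] W4 F :=
  (MvPolynomial.basisMonomials (Fin 4) F).constr F (fun e => φ (e 0) (e 1) (e 2) (e 3))

lemma lin4_mon4 (φ : ℕ → ℕ → ℕ → ℕ → W4 F) (a b c d : ℕ) : lin4 φ (mon4 a b c d) = φ a b c d := by
  rw [mon4_eq_monomial]
  have := (MvPolynomial.basisMonomials (Fin 4) F).constr_basis F (fun e => φ (e 0) (e 1) (e 2) (e 3))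
    (Finsupp.equivFunOnFinite.symm ![a, b, c, d])
  simpa [lin4] using this

/-- linear maps agreeing on monomials -/
lemma ext4 {M : Type*} [AddCommGroup M] [Module F M] (φ ψ : W4 F →ₗ[F] M)
    (h : ∀ a b c d, φ (mon4 a b c d) = ψ (mon4 a b c d)) : φ = ψ := by
  apply (MvPolynomial.basisMonomials (Fin 4) F).ext
  intro e
  simp only [MvPolynomial.coe_basisMonomials, monomial_eq_mon4, h]

noncomputable def D1 : W4 F →ₗ[F] W4 F :=
  lin4 (fun a b c d => ∑ j ∈ Finset.range b, mon4 (a + (b - 1 - j)) j c d)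
noncomputable def D2 : W4 F →ₗ[F] W4 F :=
  lin4 (fun a b c d => ∑ j ∈ Finset.range d, mon4 (a + b) 0 (c + (d - 1 - j)) j)

section ev
variable {S : Type*} [CommRing S] [Algebra F S]

noncomputable def ev4 (x x' y y' : S) : W4 F →ₐ[F] S := MvPolynomial.aeval ![x, x', y, y']

lemma ev4_mon4 (x x' y y' : S) (a b c d : ℕ) :
    ev4 (F := F) x x' y y' (mon4 a b c d) = x ^ a * x' ^ b * y ^ c * y' ^ d := by
  simp [ev4, mon4]

lemma ev4_D1 (x x' y y' : S) (Φ : W4 F) :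
    (x' - x) * ev4 x x' y y' (D1 Φ) = ev4 x x' y y' Φ - ev4 x x y y' Φ := by
  have := ext4 ((LinearMap.mulLeft F (x' - x)) ∘ₗ (ev4 (F := F) x x' y y').toLinearMap ∘ₗ D1)
    ((ev4 (F := F) x x' y y').toLinearMap - (ev4 (F := F) x x y y').toLinearMap) (by
    intro a b c d
    simp only [LinearMap.comp_apply, LinearMap.sub_apply, AlgHom.toLinearMap_apply, ev4_mon4, D1,
      lin4_mon4, map_sum, LinearMap.mulLeft_apply]
    have h := (Commute.all x' x).mul_geom_sum₂ b
    have e : ∑ j ∈ Finset.range b, x ^ (a + (b - 1 - j)) * x' ^ j * y ^ c * y' ^ d =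
      x ^ a * y ^ c * y' ^ d * ∑ i ∈ Finset.range b, x' ^ i * x ^ (b - 1 - i) := by
      rw [Finset.mul_sum]; refine Finset.sum_congr rfl fun j _ => by ring
    rw [← Finset.mul_sum, e]
    linear_combination x ^ a * y ^ c * y' ^ d * h)
  exact congrArg (fun l => l Φ) this

lemma ev4_D2 (x x' y y' : S) (Φ : W4 F) :
    (y' - y) * ev4 x x' y y' (D2 Φ) = ev4 x x y y' Φ - ev4 x x y y Φ := by
  have := ext4 ((LinearMap.mulLeft F (y' - y)) ∘ₗ (ev4 (F := F) x x' y y').toLinearMap ∘ₗ D2)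
    ((ev4 (F := F) x x y y').toLinearMap - (ev4 (F := F) x x y y).toLinearMap) (by
    intro a b c d
    simp only [LinearMap.comp_apply, LinearMap.sub_apply, AlgHom.toLinearMap_apply, ev4_mon4, D2,
      lin4_mon4, map_sum, LinearMap.mulLeft_apply]
    have h := (Commute.all y' y).mul_geom_sum₂ d
    have e : ∑ j ∈ Finset.range d, x ^ (a + b) * x' ^ 0 * y ^ (c + (d - 1 - j)) * y' ^ j =
      x ^ (a + b) * y ^ c * ∑ i ∈ Finset.range d, y' ^ i * y ^ (d - 1 - i) := by
      rw [Finset.mul_sum]; refine Finset.sum_congr rfl fun j _ => by ring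
    rw [← Finset.mul_sum, e]
    linear_combination x ^ (a+b) * y ^ c * h)
  exact congrArg (fun l => l Φ) this

lemma map_ev4 {S' : Type*} [CommRing S'] [Algebra F S'] (h : S →ₐ[F] S') (x x' y y' : S) (Φ : W4 F) :
    h (ev4 x x' y y' Φ) = ev4 (h x) (h x') (h y) (h y') Φ := by
  have : h.comp (ev4 x x' y y') = ev4 (h x) (h x') (h y) (h y') := by
    apply MvPolynomial.algHom_ext
    intro i
    fin_cases i <;> simp [ev4]
  exact congrArg (fun l => l Φ) this

end ev

/-- degree classes -/
noncomputable def Wd (A B : ℕ) : Submodule F (W4 F) :=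
  Submodule.span F {m | ∃ a b c d, a + b ≤ A ∧ c + d ≤ B ∧ m = mon4 a b c d}

lemma mon4_mem (A B a b c d : ℕ) (h : a + b ≤ A) (h' : c + d ≤ B) : (mon4 a b c d : W4 F) ∈ Wd (F := F) A B :=
  Submodule.subset_span ⟨a, b, c, d, h, h', rfl⟩

lemma Wd_le {A B : ℕ} {N : Submodule F (W4 F)} (h : ∀ a b c d, a + b ≤ A → c + d ≤ B → mon4 a b c d ∈ N) :
    Wd A B ≤ N := by
  apply Submodule.span_le.2
  rintro m ⟨a, b, c, d, h1, h2, rfl⟩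
  exact h a b c d h1 h2

lemma Wd_mono {A B A' B' : ℕ} (h : A ≤ A') (h' : B ≤ B') : Wd (F := F) A B ≤ Wd A' B' :=
  Wd_le fun a b c d h1 h2 => mon4_mem _ _ _ _ _ _ (h1.trans h) (h2.trans h')

lemma Wd_mul {A B A' B' : ℕ} {x y : W4 F} (hx : x ∈ Wd A B) (hy : y ∈ Wd A' B') :
    x * y ∈ Wd (A + A') (B + B') := by
  have := Submodule.mul_mem_mul hx hy
  rw [Wd, Wd, Submodule.span_mul_span] at this
  refine Submodule.span_le.2 ?_ this
  rintro _ ⟨_, ⟨a, b, c, d, h1, h2, rfl⟩, _, ⟨a', b', c', d', h1', h2', rfl⟩, rfl⟩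
  simp only [mon4_mul]
  exact mon4_mem _ _ _ _ _ _ (by omega) (by omega)

lemma D1_mem {A B : ℕ} {x : W4 F} (hx : x ∈ Wd A B) : D1 x ∈ Wd A B := by
  refine (Wd_le (N := (Wd A B).comap D1) ?_) hx
  intro a b c d h1 h2
  simp only [Submodule.mem_comap, D1, lin4_mon4]
  refine Submodule.sum_mem _ fun j hj => mon4_mem _ _ _ _ _ _ ?_ (by omega)
  have := Finset.mem_range.1 hj
  omega

lemma D2_mem {A B : ℕ} {x : W4 F} (hx : x ∈ Wd A B) : D2 x ∈ Wd A B := by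
  refine (Wd_le (N := (Wd A B).comap D2) ?_) hx
  intro a b c d h1 h2
  simp only [Submodule.mem_comap, D2, lin4_mon4]
  refine Submodule.sum_mem _ fun j hj => mon4_mem _ _ _ _ _ _ (by omega) ?_
  have := Finset.mem_range.1 hj
  omega

/-- the polynomial in the second pair of variables -/
noncomputable def fhat (f : F[X][X]) : W4 F := aevalAeval (MvPolynomial.X 1) (MvPolynomial.X 3) f

lemma ev4_fhat {S : Type*} [CommRing S] [Algebra F S] (x x' y y' : S) (f : F[X][X]) :
    ev4 x x' y y' (fhat f) = aevalAeval x' y' f := by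
  have : (ev4 (F := F) x x' y y').comp (aevalAeval (MvPolynomial.X 1) (MvPolynomial.X 3)) = aevalAeval x' y' := by
    ext <;> simp [ev4]
  exact congrArg (fun l => l f) this

lemma fhat_mem (f : F[X][X]) (d n : ℕ) (hd : ∀ i, (f.coeff i).natDegree ≤ d) (hn : f.natDegree ≤ n) :
    fhat f ∈ Wd d n := by
  rw [fhat, f.as_sum_range_C_mul_X_pow, map_sum]
  refine Submodule.sum_mem _ fun i hi => ?_
  rw [(f.coeff i).as_sum_range_C_mul_X_pow, map_sum, Finset.sum_mul, map_sum]
  refine Submodule.sum_mem _ fun j hj => ?_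
  have h1 := Finset.mem_range.1 hi
  have h2 := Finset.mem_range.1 hj
  have h3 := hd i
  have : (aevalAeval (MvPolynomial.X 1) (MvPolynomial.X 3)) (C (C ((f.coeff i).coeff j) * X ^ j) * X ^ i)
     = ((f.coeff i).coeff j) • (mon4 0 j 0 i : W4 F) := by
    simp [mon4, MvPolynomial.smul_eq_C_mul, MvPolynomial.algebraMap_eq]
    ring
  rw [this]
  exact Submodule.smul_mem _ _ (mon4_mem _ _ _ _ _ _ (by omega) (by omega))

noncomputable def St (f : F[X][X]) : W4 F →ₗ[F] W4 F :=
  LinearMap.mulLeft F (D2 (fhat f)) ∘ₗ D1 - LinearMap.mulLeft F (D1 (fhat f)) ∘ₗ D2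

lemma St_mem (f : F[X][X]) (d n : ℕ) (hd : ∀ i, (f.coeff i).natDegree ≤ d) (hn : f.natDegree ≤ n)
    {A B : ℕ} {x : W4 F} (hx : x ∈ Wd A B) : St f x ∈ Wd (d + A) (n + B) := by
  have := fhat_mem f d n hd hn
  exact Submodule.sub_mem _ (Wd_mul (D2_mem this) (D1_mem hx)) (Wd_mul (D1_mem this) (D2_mem hx))

lemma St_iter_mem (f : F[X][X]) (d n : ℕ) (hd : ∀ i, (f.coeff i).natDegree ≤ d) (hn : f.natDegree ≤ n)
    {A B : ℕ} {x : W4 F} (hx : x ∈ Wd A B) (k : ℕ) : (St f ^ k) x ∈ Wd (d * k + A) (n * k + B) := by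
  induction k with
  | zero => simpa using hx
  | succ k ih =>
    rw [pow_succ', Module.End.mul_apply]
    have := St_mem f d n hd hn ih
    convert this using 2 <;> ring

lemma ev4_St {S : Type*} [CommRing S] [Algebra F S] (f : F[X][X]) (x x' y y' : S)
    (h : aevalAeval x y f = 0) (h' : aevalAeval x' y' f = 0) (Ψ : W4 F) (hd : ev4 x x y y Ψ = 0) :
    (x' - x) * ev4 x x' y y' (St f Ψ) = ev4 x x' y y' (D2 (fhat f)) * ev4 x x' y y' Ψ := by
  have e1 := ev4_D1 x x' y y' (fhat f)
  have e2 := ev4_D2 x x' y y' (fhat f)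
  have e3 := ev4_D1 x x' y y' Ψ
  have e4 := ev4_D2 x x' y y' Ψ
  rw [ev4_fhat, ev4_fhat, h'] at e1
  rw [ev4_fhat, ev4_fhat, h] at e2
  have : ev4 x x' y y' (St f Ψ) = ev4 x x' y y' (D2 (fhat f)) * ev4 x x' y y' (D1 Ψ) -
     ev4 x x' y y' (D1 (fhat f)) * ev4 x x' y y' (D2 Ψ) := by
    simp [St]
  rw [this]
  rw [hd] at e4
  linear_combination (ev4 x x' y y' (D2 (fhat f))) * e3 - ev4 x x' y y' (D2 Ψ) * (e1 + e2) + (ev4 x x' y y' (D2 (fhat f))) * e4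

lemma ev4_St_pow {S : Type*} [CommRing S] [Algebra F S] (f : F[X][X]) (x x' y y' : S)
    (h : aevalAeval x y f = 0) (h' : aevalAeval x' y' f = 0) (Φ : W4 F) (M : ℕ)
    (hd : ∀ k < M, ev4 x x y y ((St f ^ k) Φ) = 0) :
    (x' - x) ^ M * ev4 x x' y y' ((St f ^ M) Φ) = ev4 x x' y y' (D2 (fhat f)) ^ M * ev4 x x' y y' Φ := by
  induction M with
  | zero => simp
  | succ M ih =>
    have h1 := ih (fun k hk => hd k (by omega))
    have h2 := ev4_St f x x' y y' h h' _ (hd M (by omega))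
    rw [pow_succ' (St f), Module.End.mul_apply, pow_succ, mul_assoc, h2, pow_succ]
    linear_combination ev4 x x' y y' (D2 (fhat f)) * h1

/-- `f1` on the diagonal is the derivative. -/
lemma ev4_D2_fhat_diag {S : Type*} [CommRing S] [Algebra F S] (x y x' : S) (f : F[X][X]) :
    ev4 x x y y (D2 (fhat f)) = aevalAeval x y (derivative f) := by
  have : (ev4 (F := F) x x y y).toLinearMap ∘ₗ D2 ∘ₗ (aevalAeval (R := F) (MvPolynomial.X 1 : W4 F) (MvPolynomial.X 3)).toLinearMap
     = (aevalAeval (R := F) x y).toLinearMap ∘ₗ (derivative (R := F[X])).restrictScalars F := by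
    apply LinearMap.ext
    intro g
    induction g using Polynomial.induction_on' with
    | add p q hp hq => rw [map_add, map_add, hp, hq]
    | monomial i c =>
      induction c using Polynomial.induction_on' with
      | add p q hp hq => rw [(monomial i).map_add, map_add, map_add, hp, hq]
      | monomial j c =>
        have e : (aevalAeval (R := F) (MvPolynomial.X 1 : W4 F) (MvPolynomial.X 3)) (monomial i (monomial j c)) = c • mon4 0 j 0 i := by
          rw [← C_mul_X_pow_eq_monomial, ← C_mul_X_pow_eq_monomial]
          simp [mon4, MvPolynomial.smul_eq_C_mul, MvPolynomial.algebraMap_eq]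
          ring
        simp only [LinearMap.comp_apply, AlgHom.toLinearMap_apply, e, map_smul, D2, lin4_mon4, map_sum, ev4_mon4,
          LinearMap.restrictScalars_apply, derivative_monomial]
        have e2 : ∀ k ∈ Finset.range i, x ^ (0 + j) * x ^ 0 * y ^ (0 + (i - 1 - k)) * y ^ k = x ^ j * y ^ (i - 1) := by
          intro k hk
          have := Finset.mem_range.1 hk
          have e5 : i - 1 = (i - 1 - k) + k := by omega
          rw [e5, pow_add]
          simp; ring
        rw [Finset.sum_congr rfl e2]
        simp only [← C_mul_X_pow_eq_monomial]
        simp [Algebra.smul_def]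
        ring
  exact congrArg (fun l => l f) this

end Psi
end CDM
end

section
namespace CDM
open Polynomial

section Core
variable {F : Type*} [Field F]

/-- submodule of bivariate polynomials with coefficients of degree ≤ D -/
def Vd (F : Type*) [Field F] (D : ℕ) : Submodule F (F[X][X]) where
  carrier := {g | ∀ i, (g.coeff i).natDegree ≤ D}
  add_mem' := fun {a b} ha hb i => by
    rw [coeff_add]; exact (natDegree_add_le _ _).trans (max_le (ha i) (hb i))
  zero_mem' := by simp
  smul_mem' := fun c x hx i => by
    rw [coeff_smul]; exact (natDegree_smul_le _ _).trans (hx i)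

lemma mem_Vd {D : ℕ} {g : F[X][X]} : g ∈ Vd F D ↔ ∀ i, (g.coeff i).natDegree ≤ D := Iff.rfl

lemma Vd_C_mul {D E : ℕ} {g : F[X][X]} (hg : g ∈ Vd F D) (c : F[X]) (hc : c.natDegree ≤ E) :
    C c * g ∈ Vd F (E + D) := by
  intro i
  rw [coeff_C_mul]
  exact natDegree_mul_le.trans (add_le_add hc (hg i))

lemma Vd_mono {D E : ℕ} (h : D ≤ E) {g : F[X][X]} (hg : g ∈ Vd F D) : g ∈ Vd F E :=
  fun i => (hg i).trans h

lemma Vd_modX {d D : ℕ} (f g : F[X][X]) (hm : f.Monic) (hf : f ∈ Vd F d) (hg : g ∈ Vd F D)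
    (hgn : g.natDegree < f.natDegree) : (X * g) %ₘ f ∈ Vd F (D + d) := by
  have hX : X * g ∈ Vd F D := by
    intro i
    cases i with
    | zero => simp
    | succ i => rw [coeff_X_mul]; exact hg i
  have key : (X * g) %ₘ f = X * g - C ((X * g).coeff f.natDegree) * f := by
    have h1 : (X * g - C ((X * g).coeff f.natDegree) * f) %ₘ f = X * g - C ((X * g).coeff f.natDegree) * f := by
      rw [modByMonic_eq_self_iff hm, degree_eq_natDegree hm.ne_zero, degree_lt_iff_coeff_zero]
      intro m hmm
      rw [coeff_sub, coeff_C_mul]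
      rcases eq_or_lt_of_le hmm with rfl | hlt
      · rw [hm.coeff_natDegree]; ring
      · rw [coeff_eq_zero_of_natDegree_lt hlt, coeff_eq_zero_of_natDegree_lt
          (lt_of_le_of_lt natDegree_mul_le (by rw [natDegree_X]; omega))]
        ring
    rw [← h1, sub_modByMonic, mul_self_modByMonic hm, sub_zero]
  rw [key]
  refine Submodule.sub_mem _ (Vd_mono (by omega) hX) (Vd_C_mul hf _ (hX _))

lemma Vd_X_pow_mod {d : ℕ} (f : F[X][X]) (hm : f.Monic) (hn : 0 < f.natDegree) (hf : f ∈ Vd F d) (B : ℕ) :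
    (X ^ B) %ₘ f ∈ Vd F (d * B) := by
  have h1 : f ≠ 1 := by rintro rfl; simp at hn
  induction B with
  | zero =>
    rw [pow_zero, (modByMonic_eq_self_iff hm).2]
    · intro i; rw [coeff_one]; split_ifs <;> simp
    · rw [degree_one]; exact natDegree_pos_iff_degree_pos.1 hn
  | succ B ih =>
    have := Vd_modX f _ hm hf ih (natDegree_modByMonic_lt _ hm h1)
    rw [mul_add, mul_one]
    convert this using 1
    have h5 : X ^ (B + 1) = X * (X ^ B %ₘ f) + f * (X * (X ^ B /ₘ f)) := by
      rw [pow_succ']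
      nth_rewrite 1 [← modByMonic_add_div (X ^ B) f]
      ring
    rw [h5, add_modByMonic, (modByMonic_eq_zero_iff_dvd hm).2 (dvd_mul_right f _), add_zero]


/-- diagonal reduction -/
noncomputable def diagMod (f : F[X][X]) : W4 F →ₗ[F] F[X][X] :=
  ((modByMonicHom f).restrictScalars F) ∘ₗ (ev4 (F := F) (S := F[X][X]) (C X) (C X) X X).toLinearMap

lemma diagMod_mem {d A B : ℕ} (f : F[X][X]) (hm : f.Monic) (hn : 0 < f.natDegree) (hf : f ∈ Vd F d)
    {Ψ : W4 F} (hΨ : Ψ ∈ Wd A B) : diagMod f Ψ ∈ Vd F (A + d * B) := by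
  refine (Wd_le (N := (Vd F (A + d * B)).comap (diagMod f)) ?_) hΨ
  intro a b c e h1 h2
  have : diagMod f (mon4 a b c e) = C (X ^ (a + b)) * (X ^ (c + e) %ₘ f) := by
    have e0 : C (X : F[X]) ^ a * C X ^ b * X ^ c * X ^ e = (X ^ (a + b) : F[X]) • (X ^ (c + e) : F[X][X]) := by
      rw [smul_eq_C_mul, C_pow]; ring
    simp only [diagMod, LinearMap.comp_apply, LinearMap.restrictScalars_apply, AlgHom.toLinearMap_apply,
      ev4_mon4, e0, map_smul]
    rw [smul_eq_C_mul]; rfl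
  rw [Submodule.mem_comap, this]
  refine Vd_mono ?_ (Vd_C_mul (Vd_X_pow_mod f hm hn hf (c + e)) _ (natDegree_X_pow_le _))
  have := Nat.mul_le_mul_left d h2
  omega

/-- coefficient form -/
noncomputable def toΦ (a b n : ℕ) : (Fin (a+1) × Fin (b+1) × Fin n × Fin n → F) →ₗ[F] W4 F :=
  Fintype.linearCombination F (fun e => mon4 e.1 e.2.1 e.2.2.1 e.2.2.2)

lemma toΦ_apply (a b n : ℕ) (c : Fin (a+1) × Fin (b+1) × Fin n × Fin n → F) :
    toΦ a b n c = ∑ e, c e • mon4 e.1 e.2.1 e.2.2.1 e.2.2.2 := by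
  simp [toΦ, Fintype.linearCombination_apply]

lemma toΦ_mem (a b n : ℕ) (c : Fin (a+1) × Fin (b+1) × Fin n × Fin n → F) :
    toΦ a b n c ∈ Wd (F := F) (a + b) (2 * n) := by
  rw [toΦ_apply]
  exact Submodule.sum_mem _ fun e _ => Submodule.smul_mem _ _ (mon4_mem _ _ _ _ _ _ (by omega) (by omega))

lemma exists_Φ (f : F[X][X]) (hm : f.Monic) (hn : 0 < f.natDegree) {d : ℕ} (hf : f ∈ Vd F d) (a b M n: ℕ)
    (hnn : f.natDegree = n)
    (hlt : n * M * (a + b + d * M + d * (2 * n + n * M) + 1) < n * n * (a + 1) * (b + 1)) :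
    ∃ c : Fin (a+1) × Fin (b+1) × Fin n × Fin n → F, c ≠ 0 ∧
      ∀ k < M, f ∣ ev4 (S := F[X][X]) (C X) (C X) X X ((St f ^ k) (toΦ a b n c)) := by
  set D := a + b + d * M + d * (2 * n + n * M)
  let L : (Fin (a+1) × Fin (b+1) × Fin n × Fin n → F) →ₗ[F] (Fin M → Fin n → Fin (D + 1) → F) :=
    LinearMap.pi fun k => LinearMap.pi fun i => LinearMap.pi fun j =>
      (lcoeff F j) ∘ₗ ((lcoeff F[X] i).restrictScalars F) ∘ₗ diagMod f ∘ₗ (St f ^ (k : ℕ)) ∘ₗ toΦ a b n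
  have hker : LinearMap.ker L ≠ ⊥ := by
    apply LinearMap.ker_ne_bot_of_finrank_lt
    simp only [Module.finrank_fintype_fun_eq_card, Module.finrank_pi_fintype, Fintype.card_prod,
      Fintype.card_fin, Finset.sum_const, Finset.card_univ, smul_eq_mul]
    nlinarith
  obtain ⟨c, hc, hc0⟩ := (Submodule.ne_bot_iff _).1 hker
  refine ⟨c, hc0, fun k hk => ?_⟩
  rw [← modByMonic_eq_zero_iff_dvd hm]
  have hmem := diagMod_mem f hm hn hf (St_iter_mem f d n hf hnn.le (toΦ_mem a b n c) k)
  have hlt : (diagMod f ((St f ^ k) (toΦ a b n c))).natDegree < n := by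
    exact lt_of_lt_of_eq (natDegree_modByMonic_lt _ hm (by rintro rfl; simp at hn)) hnn
  change diagMod f ((St f ^ k) (toΦ a b n c)) = 0
  ext i j
  rw [coeff_zero, coeff_zero]
  by_cases hi : i < n
  · by_cases hj : j < D + 1
    · have := congrFun (congrFun (congrFun (LinearMap.mem_ker.1 hc) ⟨k, hk⟩) ⟨i, hi⟩) ⟨j, hj⟩
      simpa [L] using this
    · apply coeff_eq_zero_of_natDegree_lt
      refine lt_of_le_of_lt (hmem i) ?_
      have h1 : d * k ≤ d * M := Nat.mul_le_mul_left _ hk.le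
      have h2 : d * (n * k + 2 * n) ≤ d * (2 * n + n * M) := Nat.mul_le_mul_left _ (by
        have := Nat.mul_le_mul_left n hk.le
        omega)
      omega
  · rw [coeff_eq_zero_of_natDegree_lt (p := diagMod f _) (by omega)]; simp

end Core
end CDM
end

section
namespace CDM
open Polynomial

section Core2
variable {F : Type*} [Field F]

/-- point evaluation -/
noncomputable def ptEv (x : F) (U : PowerSeries F) : F[X][X] →ₐ[F] PowerSeries F :=
  aevalAeval (PowerSeries.C x + PowerSeries.X) U

lemma ptEv_eq (x : F) (U : PowerSeries F) (g : F[X][X]) : ptEv x U g = (g.map (evS x)).eval U := by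
  have : (ptEv x U).toRingHom = eval₂RingHom (evS x) U := by
    apply Polynomial.ringHom_ext
    · intro p
      simp only [ptEv, AlgHom.toRingHom_eq_coe, RingHom.coe_coe, aevalAeval_C, coe_eval₂RingHom, eval₂_C]
      have : (aeval (R := F) (PowerSeries.C x + PowerSeries.X)).toRingHom = evS x := by
        ext n <;> simp [evS_X, evS_C, PowerSeries.algebraMap_apply]
      exact congrArg (fun l => l p) this
    · simp [ptEv]
  rw [eval_map]
  exact congrArg (fun l => l g) this

lemma ptEv_ne_zero (f g : F[X][X]) (hm : f.Monic) (hi : Irreducible f) (hg : ¬ f ∣ g) (x : F) (U : PowerSeries F)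
    (hroot : ptEv x U f = 0) : ptEv x U g ≠ 0 := by
  classical
  intro h0
  obtain ⟨d, hd⟩ : ∃ d, ∀ i, (f.coeff i).natDegree ≤ d := by
    refine ⟨∑ i ∈ f.support, (f.coeff i).natDegree, fun i => ?_⟩
    by_cases h : i ∈ f.support
    · exact Finset.single_le_sum (f := fun i => (f.coeff i).natDegree) (by simp) h
    · simp [notMem_support_iff.1 h]
  obtain ⟨A, hA⟩ : ∃ d, ∀ i, (g.coeff i).natDegree ≤ d := by
    refine ⟨∑ i ∈ g.support, (g.coeff i).natDegree, fun i => ?_⟩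
    by_cases h : i ∈ g.support
    · exact Finset.single_le_sum (f := fun i => (g.coeff i).natDegree) (by simp) h
    · simp [notMem_support_iff.1 h]
  have := lemmaZ f g hm hi hg d A g.natDegree (f.natDegree * A + g.natDegree * d + 1) hd hA le_rfl
    {(x, PowerSeries.constantCoeff U)} (fun _ => U) (by simp) (by simpa [ptEv_eq] using hroot) (by
      simp only [Finset.mem_singleton, forall_eq]
      rw [← ptEv_eq, h0]; exact dvd_zero _)
  simp at this

lemma exists_leading {ι : Type*} [Finite ι] (w : ι → PowerSeries F) (h : ∃ k, w k ≠ 0) :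
    ∃ (m : ℕ) (w' : ι → PowerSeries F), (∀ k, w k = PowerSeries.X ^ m * w' k) ∧
      ∃ k, PowerSeries.constantCoeff (w' k) ≠ 0 := by
  classical
  have hex : ∃ m, ∃ k, PowerSeries.coeff m (w k) ≠ 0 := by
    obtain ⟨k, hk⟩ := h
    by_contra hcon
    push Not at hcon
    exact hk (PowerSeries.ext fun m => by simpa using hcon m k)
  have hdvd : ∀ k, PowerSeries.X ^ (Nat.find hex) ∣ w k := by
    intro k
    rw [PowerSeries.X_pow_dvd_iff]
    intro m hm
    by_contra hne
    exact Nat.find_min hex hm ⟨k, hne⟩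
  choose w' hw' using hdvd
  refine ⟨Nat.find hex, w', hw', ?_⟩
  obtain ⟨k, hk⟩ := Nat.find_spec hex
  refine ⟨k, ?_⟩
  rw [hw' k] at hk
  have := PowerSeries.coeff_X_pow_mul (w' k) (Nat.find hex) 0
  rw [zero_add] at this
  rwa [this, PowerSeries.coeff_zero_eq_constantCoeff_apply] at hk

/-- small polynomials are not divisible by `f` -/
lemma not_dvd_small (f g : F[X][X]) (hm : f.Monic) (hg : g ≠ 0) (hlt : g.natDegree < f.natDegree) : ¬ f ∣ g := by
  intro h
  exact hm.not_dvd_of_natDegree_lt hg hlt h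

/-- polynomial from a coefficient table -/
noncomputable def tab (a n : ℕ) (c : Fin (a+1) → Fin n → F) : F[X][X] :=
  ∑ i : Fin n, ∑ r : Fin (a+1), C (C (c r i) * X ^ (r : ℕ)) * X ^ (i : ℕ)

lemma tab_coeff (a n : ℕ) (c : Fin (a+1) → Fin n → F) (r : Fin (a+1)) (i : Fin n) :
    ((tab a n c).coeff i).coeff r = c r i := by
  simp only [tab, finset_sum_coeff, coeff_C_mul, coeff_X_pow, mul_ite, mul_one, mul_zero]
  rw [Finset.sum_eq_single i (by
    intro b _ hb
    refine Finset.sum_eq_zero fun s _ => ?_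
    rw [if_neg]; simp
    intro h; exact hb (Fin.ext h.symm)) (by simp)]
  simp only [if_true, finset_sum_coeff, coeff_C_mul, coeff_X_pow, mul_ite, mul_one, mul_zero]
  rw [Finset.sum_eq_single r (by
    intro b _ hb
    rw [if_neg]
    intro h; exact hb (Fin.ext h.symm)) (by simp)]
  simp

lemma tab_natDegree (a n : ℕ) (hn : 0 < n) (c : Fin (a+1) → Fin n → F) : (tab a n c).natDegree < n := by
  refine lt_of_le_of_lt (natDegree_sum_le_of_forall_le (n := n - 1) _ _ fun i _ =>
    natDegree_sum_le_of_forall_le _ _ fun r _ => ?_) (by omega)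
  exact (natDegree_C_mul_X_pow_le _ _).trans (by omega)

lemma tab_mem (a n : ℕ) (c : Fin (a+1) → Fin n → F) : tab a n c ∈ Vd F a := by
  refine Submodule.sum_mem _ fun i _ => Submodule.sum_mem _ fun r _ => ?_
  intro j
  rw [coeff_C_mul, coeff_X_pow]
  split_ifs
  · rw [mul_one]; exact (natDegree_C_mul_X_pow_le _ _).trans (by omega)
  · simp

lemma ptEv_tab (x : F) (U : PowerSeries F) (a n : ℕ) (c : Fin (a+1) → Fin n → F) :
    ptEv x U (tab a n c) = ∑ i : Fin n, ∑ r : Fin (a+1), PowerSeries.C (c r i) * (PowerSeries.C x + PowerSeries.X) ^ (r : ℕ) * U ^ (i : ℕ) := by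
  simp only [tab, map_sum, map_mul, map_pow, ptEv]
  refine Finset.sum_congr rfl fun i _ => Finset.sum_congr rfl fun r _ => ?_
  simp [PowerSeries.algebraMap_apply]

section Fin
variable [Fintype F]

lemma pow_card_add (z w : PowerSeries F) : (z + w) ^ Fintype.card F = z ^ Fintype.card F + w ^ Fintype.card F := by
  have := map_add (FiniteField.frobeniusAlgHom F (PowerSeries F)) z w
  simpa using this

lemma pow_card_sum {ι : Type*} (s : Finset ι) (z : ι → PowerSeries F) :
    (∑ i ∈ s, z i) ^ Fintype.card F = ∑ i ∈ s, z i ^ Fintype.card F := by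
  exact map_sum (FiniteField.frobeniusAlgHom F (PowerSeries F)) z s

lemma C_pow_card (c : F) : (PowerSeries.C c : PowerSeries F) ^ Fintype.card F = PowerSeries.C c := by
  rw [← map_pow, FiniteField.pow_card]

lemma ev4_toΦ_ne_zero (f : F[X][X]) (hm : f.Monic) (hi : Irreducible f) {d : ℕ} (hf : f ∈ Vd F d) (a b n : ℕ)
    (hnn : f.natDegree = n) (hn : 0 < n) (hq : n * (a + d) < Fintype.card F)
    (c : Fin (a+1) × Fin (b+1) × Fin n × Fin n → F) (hc : c ≠ 0) (x : F) (U : PowerSeries F) (hroot : ptEv x U f = 0) :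
    ev4 (PowerSeries.C x + PowerSeries.X) ((PowerSeries.C x + PowerSeries.X) ^ Fintype.card F) U (U ^ Fintype.card F)
      (toΦ a b n c) ≠ 0 := by
  classical
  set q := Fintype.card F
  set xx := (PowerSeries.C x + PowerSeries.X : PowerSeries F)
  let V : Fin (a+1) × Fin n → F[X][X] := fun k => tab b n (fun s j => c (k.1, s, k.2, j))
  let w : Fin (a+1) × Fin n → PowerSeries F := fun k => ptEv x U (V k)
  have hev : ev4 xx (xx ^ q) U (U ^ q) (toΦ a b n c) = ∑ k : Fin (a+1) × Fin n, xx ^ (k.1 : ℕ) * U ^ (k.2 : ℕ) * w k ^ q := by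
    rw [toΦ_apply, map_sum]
    simp only [w, V, ptEv_tab, pow_card_sum, map_smul, ev4_mon4, mul_pow, C_pow_card, q]
    simp only [Fintype.sum_prod_type, Finset.mul_sum]
    refine Finset.sum_congr rfl fun r _ => ?_
    rw [Finset.sum_comm]
    refine Finset.sum_congr rfl fun i _ => ?_
    rw [Finset.sum_comm]
    refine Finset.sum_congr rfl fun j _ => Finset.sum_congr rfl fun s _ => ?_
    rw [PowerSeries.smul_eq_C_mul]
    simp only [xx]
    ring
  have hw : ∃ k, w k ≠ 0 := by
    obtain ⟨⟨r, s, i, j⟩, he⟩ := Function.ne_iff.1 hc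
    refine ⟨(r, i), ptEv_ne_zero f _ hm hi (not_dvd_small f _ hm ?_ (hnn.symm ▸ tab_natDegree b n hn _)) x U hroot⟩
    intro h0
    apply he
    have := tab_coeff b n (fun s j => c (r, s, i, j)) s j
    simp only [V] at h0
    rw [h0] at this
    simpa using this.symm
  obtain ⟨m, w', hw', k0, hk0⟩ := exists_leading w hw
  rw [hev]
  intro h0
  have h1 : ∑ k : Fin (a+1) × Fin n, xx ^ (k.1 : ℕ) * U ^ (k.2 : ℕ) * w' k ^ q = 0 := by
    have : (PowerSeries.X ^ m : PowerSeries F) ^ q * ∑ k : Fin (a+1) × Fin n, xx ^ (k.1 : ℕ) * U ^ (k.2 : ℕ) * w' k ^ q = 0 := by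
      rw [← h0, Finset.mul_sum]
      refine Finset.sum_congr rfl fun k _ => ?_
      rw [hw' k, mul_pow]; ring
    exact (mul_eq_zero.1 this).resolve_left (pow_ne_zero _ (pow_ne_zero _ PowerSeries.X_ne_zero))
  let c0 : Fin (a+1) → Fin n → F := fun r i => PowerSeries.constantCoeff (w' (r, i))
  have h2 : PowerSeries.X ^ q ∣ ptEv x U (tab a n c0) := by
    have : ptEv x U (tab a n c0) = ∑ k : Fin (a+1) × Fin n, xx ^ (k.1 : ℕ) * U ^ (k.2 : ℕ) * (PowerSeries.C (c0 k.1 k.2) - w' k ^ q) := by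
      simp only [mul_sub, Finset.sum_sub_distrib, h1, sub_zero]
      rw [ptEv_tab, Finset.sum_comm, Fintype.sum_prod_type]
      refine Finset.sum_congr rfl fun r _ => Finset.sum_congr rfl fun i _ => ?_
      simp only [xx]; ring
    rw [this]
    refine Finset.dvd_sum fun k _ => Dvd.dvd.mul_left ?_ _
    have h3 : PowerSeries.X ∣ (w' k - PowerSeries.C (c0 k.1 k.2)) := by
      rw [PowerSeries.X_dvd_iff]; simp [c0]
    obtain ⟨z, hz⟩ := h3
    have h4 : w' k = PowerSeries.C (c0 k.1 k.2) + PowerSeries.X * z := by rw [← hz]; ring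
    rw [h4, pow_card_add, C_pow_card, mul_pow]
    refine ⟨-z ^ q, by ring⟩
  have h3 := lemmaZ f (tab a n c0) hm hi (not_dvd_small f _ hm (by
      intro h
      apply hk0
      have := tab_coeff a n c0 k0.1 k0.2
      rw [h] at this
      simpa using this.symm) (hnn.symm ▸ tab_natDegree a n hn _)) d a n q hf (tab_mem a n c0) (tab_natDegree a n hn _).le
    {(x, PowerSeries.constantCoeff U)} (fun _ => U) (by simp) (by simpa [ptEv_eq] using hroot) (by
      simp only [Finset.mem_singleton, forall_eq]
      rw [← ptEv_eq]; exact h2)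
  rw [hnn] at h3
  simp only [Finset.card_singleton, one_mul] at h3
  rw [mul_add] at hq
  omega

theorem stepanov_core (f : F[X][X]) (hm : f.Monic) (hi : Irreducible f) {d : ℕ} (hf : f ∈ Vd F d) (a b M n : ℕ)
    (hnn : f.natDegree = n) (hn : 0 < n) (hq : n * (a + d) < Fintype.card F)
    (hlt : n * M * (a + b + d * M + d * (2 * n + n * M) + 1) < n * n * (a + 1) * (b + 1))
    (T : Finset (F × F)) (hT : ∀ P ∈ T, f.evalEval P.1 P.2 = 0 ∧ (derivative f).evalEval P.1 P.2 ≠ 0) :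
    T.card * M ≤ n * (a + Fintype.card F * b) + (n + n * Fintype.card F) * d := by
  classical
  rcases T.eq_empty_or_nonempty with rfl | ⟨P0, hP0⟩
  · simp
  set q := Fintype.card F
  obtain ⟨c, hc, hcd⟩ := exists_Φ f hm (hnn ▸ hn) hf a b M n hnn hlt
  have hU : ∀ P : F × F, ∃ U : PowerSeries F, P ∈ T → PowerSeries.constantCoeff U = P.2 ∧ (f.map (evS P.1)).eval U = 0 := by
    intro P
    by_cases h : P ∈ T
    · obtain ⟨U, hU⟩ := hensel_lift f hm P.1 P.2 (hT P h).1 (hT P h).2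
      exact ⟨U, fun _ => hU⟩
    · exact ⟨0, fun h' => absurd h' h⟩
  choose U hU using hU
  let G : F[X][X] := ev4 (S := F[X][X]) (C X) ((C X) ^ q) X (X ^ q) (toΦ a b n c)
  have hG : ∀ x u, ptEv x u G = ev4 (PowerSeries.C x + PowerSeries.X) ((PowerSeries.C x + PowerSeries.X) ^ q) u (u ^ q) (toΦ a b n c) := by
    intro x u
    simp only [G]
    rw [map_ev4]
    simp [ptEv]
  have hGmon : ∀ e : Fin (a+1) × Fin (b+1) × Fin n × Fin n,
      ev4 (F := F) (S := F[X][X]) (C X) ((C X) ^ q) X (X ^ q) (mon4 e.1 e.2.1 e.2.2.1 e.2.2.2) =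
      C (X ^ (e.1 + q * e.2.1 : ℕ)) * X ^ (e.2.2.1 + q * e.2.2.2 : ℕ) := by
    intro e
    rw [ev4_mon4]
    simp only [C_pow]
    ring
  have hGB : G.natDegree ≤ n + n * q := by
    simp only [G, toΦ_apply, map_sum, map_smul]
    refine natDegree_sum_le_of_forall_le _ _ fun e _ => (natDegree_smul_le _ _).trans ?_
    rw [hGmon]
    refine (natDegree_C_mul_X_pow_le _ _).trans ?_
    have := Nat.mul_le_mul_left q e.2.2.2.2.le
    rw [mul_comm n q]
    omega
  have hGA : G ∈ Vd F (a + q * b) := by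
    simp only [G, toΦ_apply, map_sum, map_smul]
    refine Submodule.sum_mem _ fun e _ => Submodule.smul_mem _ _ ?_
    rw [hGmon]
    intro j
    rw [coeff_C_mul, coeff_X_pow]
    split_ifs
    · rw [mul_one]; refine (natDegree_X_pow_le _).trans ?_
      have := Nat.mul_le_mul_left q (Nat.lt_succ_iff.1 e.2.1.2)
      omega
    · simp
  have hnd : ¬ f ∣ G := by
    intro hdvd
    have h1 : ptEv P0.1 (U P0) f = 0 := by rw [ptEv_eq]; exact (hU P0 hP0).2
    have := map_dvd (ptEv P0.1 (U P0)) hdvd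
    rw [h1, hG, zero_dvd_iff] at this
    exact ev4_toΦ_ne_zero f hm hi hf a b n hnn hn hq c hc _ _ h1 this
  have := lemmaZ f G hm hi hnd d (a + q * b) (n + n * q) M hf hGA hGB T U (fun P hP => (hU P hP).1)
    (fun P hP => (hU P hP).2) (by
    intro P hP
    rw [← ptEv_eq, hG]
    set xx : PowerSeries F := PowerSeries.C P.1 + PowerSeries.X with hxx
    have h1 : aevalAeval xx (U P) f = 0 := by
      have := ptEv_eq P.1 (U P) f
      rw [(hU P hP).2] at this; exact this
    have h2 : aevalAeval (xx ^ q) (U P ^ q) f = 0 := by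
      have e : (FiniteField.frobeniusAlgHom F (PowerSeries F)).comp (aevalAeval xx (U P)) = aevalAeval (xx ^ q) (U P ^ q) := by
        ext <;> simp [q]
      rw [← e, AlgHom.comp_apply, h1, map_zero]
    have h3 := ev4_St_pow f xx (xx ^ q) (U P) (U P ^ q) h1 h2 (toΦ a b n c) M (by
      intro k hk
      have h4 := map_dvd (ptEv P.1 (U P)) (hcd k hk)
      have h5 : ptEv P.1 (U P) f = 0 := h1
      rw [h5, zero_dvd_iff, map_ev4] at h4
      simpa [ptEv] using h4)
    have hX : PowerSeries.X ∣ xx ^ q - xx := by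
      rw [PowerSeries.X_dvd_iff]
      simp [hxx, q, FiniteField.pow_card]
    have hunit : IsUnit (ev4 xx (xx ^ q) (U P) (U P ^ q) (D2 (fhat f))) := by
      rw [PowerSeries.isUnit_iff_constantCoeff]
      let ccA : PowerSeries F →ₐ[F] F := { PowerSeries.constantCoeff (R := F) with commutes' := fun r => by simp [PowerSeries.algebraMap_apply] }
      have e1 : PowerSeries.constantCoeff (ev4 xx (xx ^ q) (U P) (U P ^ q) (D2 (fhat f))) = ccA (ev4 xx (xx ^ q) (U P) (U P ^ q) (D2 (fhat f))) := rfl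
      rw [e1, map_ev4]
      have e2 : ccA xx = P.1 := by change PowerSeries.constantCoeff xx = _; simp [hxx]
      have e3 : ccA (U P) = P.2 := (hU P hP).1
      rw [map_pow, map_pow, e2, e3, FiniteField.pow_card, FiniteField.pow_card, ev4_D2_fhat_diag _ _ P.1]
      rw [coe_aevalAeval_eq_evalEval]
      exact (hT P hP).2.isUnit
    have h6 : PowerSeries.X ^ M ∣ ev4 xx (xx ^ q) (U P) (U P ^ q) (D2 (fhat f)) ^ M * ev4 xx (xx ^ q) (U P) (U P ^ q) (toΦ a b n c) := by
      rw [← h3]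
      exact Dvd.dvd.mul_right (pow_dvd_pow_of_dvd hX M) _
    exact ((hunit.pow M).dvd_mul_left).1 h6)
  rw [hnn] at this
  exact this

end Fin
end Core2
end CDM
end

section
namespace CDM
open Polynomial

lemma numA (n d μ c1 q a E : ℕ) (hn : 0 < n) (hE : E = 3 + (n + n^2) * d) (hc1 : c1 = 2 * n * E + 1)
    (hμc : c1 ≤ μ) (hμn : 2 * n * d ≤ μ) (hle1 : μ * μ ≤ q) (hqa : q ≤ 2 * n * (a + 1)) :
    n * (n * μ) * (a + (μ + c1 - 1) + d * (n * μ) + d * (2 * n + n * (n * μ)) + 1) <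
      n * n * (a + 1) * (μ + c1 - 1 + 1) := by
  obtain ⟨b, hb⟩ : ∃ b, b + 1 = μ + c1 := ⟨μ + c1 - 1, by omega⟩
  have hb' : μ + c1 - 1 = b := by omega
  rw [hb', hb]
  have h1 : μ * (b + 2 * n * d + (n + n^2) * d * μ) ≤ q * E := by
    calc μ * (b + 2 * n * d + (n + n^2) * d * μ) ≤ μ * (2 * μ + μ + (n + n^2) * d * μ) := by
          apply Nat.mul_le_mul_left; omega
      _ = μ * μ * E := by rw [hE]; ring
      _ ≤ q * E := Nat.mul_le_mul_right _ hle1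
  have h2 : q * E < (a + 1) * c1 := by
    calc q * E ≤ (2 * n * (a + 1)) * E := Nat.mul_le_mul_right _ hqa
      _ = (a + 1) * (2 * n * E) := by ring
      _ < (a + 1) * c1 := by apply Nat.mul_lt_mul_of_pos_left; omega; omega
  have h3 : μ * (a + 1) + μ * (b + 2 * n * d + (n + n^2) * d * μ) < (a + 1) * (μ + c1) := by
    have e : (a + 1) * (μ + c1) = μ * (a + 1) + (a + 1) * c1 := by ring
    rw [e]
    exact Nat.add_lt_add_left (h1.trans_lt h2) _
  have h4 : 0 < n * n := Nat.mul_pos hn hn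
  calc n * (n * μ) * (a + b + d * (n * μ) + d * (2 * n + n * (n * μ)) + 1) = 
      n * n * (μ * (a + 1) + μ * (b + 2 * n * d + (n + n^2) * d * μ)) := by ring
    _ < n * n * ((a + 1) * (μ + c1)) := Nat.mul_lt_mul_of_pos_left h3 h4
    _ = _ := by ring

lemma numB (t q μ c1 d a b : ℕ) (hq1 : 1 ≤ q) (hb : b + 1 = μ + c1) (h3 : a ≤ q)
    (h2 : t * μ ≤ a + q * b + (1 + q) * d) : t * μ ≤ q * μ + q * (c1 + 2 * d) := by
  have h4 : q * b + q = q * μ + q * c1 := by rw [← mul_add, ← hb]; ring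
  have h5 : 1 * d ≤ q * d := Nat.mul_le_mul_right _ hq1
  have h6 : (1 + q) * d = 1 * d + q * d := by ring
  have h7 : q * (c1 + 2 * d) = q * c1 + 2 * (q * d) := by ring
  omega

lemma stepanov_exact (n d : ℕ) (hn : 0 < n) : ∃ C : ℝ, 0 ≤ C ∧ ∀ (F : Type) [Field F] [Fintype F] (f : F[X][X]),
    f.Monic → Irreducible f → (∀ i, (f.coeff i).natDegree ≤ d) → f.natDegree = n →
    ∀ T : Finset (F × F), (∀ P ∈ T, f.evalEval P.1 P.2 = 0 ∧ (derivative f).evalEval P.1 P.2 ≠ 0) →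
    (T.card : ℝ) ≤ Fintype.card F + C * Real.sqrt (Fintype.card F) := by
  set E := 3 + (n + n^2) * d with hE
  set c1 := 2 * n * E + 1 with hc1
  set K := c1 + 2 * n * d + 1 with hK
  clear_value K c1 E
  refine ⟨2 * (c1 + 2 * d) + K ^ 4, by positivity, ?_⟩
  intro F _ _ f hm hi hf hnn T hT
  set q := Fintype.card F with hq
  have hq1 : 1 ≤ q := Fintype.card_pos
  set μ := Nat.sqrt q with hμ
  have hsq1 : (1:ℝ) ≤ Real.sqrt q := by
    rw [Real.one_le_sqrt]; exact_mod_cast hq1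
  have hsqq : Real.sqrt q * Real.sqrt q = q := Real.mul_self_sqrt (by positivity)
  have hle1 : μ * μ ≤ q := Nat.sqrt_le q
  have hle2 : q < (μ + 1) * (μ + 1) := Nat.lt_succ_sqrt q
  clear_value μ
  by_cases hbig : μ < K
  · have h1 : q ≤ K * K := by nlinarith
    have h2 : T.card ≤ q * q := by
      have := Finset.card_le_univ T
      rwa [Fintype.card_prod] at this
    have h3 : T.card ≤ K ^ 4 := by
      calc T.card ≤ q * q := h2
        _ ≤ (K * K) * (K * K) := Nat.mul_le_mul h1 h1
        _ = K ^ 4 := by ring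
    have h4 : (T.card : ℝ) ≤ (K : ℝ) ^ 4 := by exact_mod_cast h3
    have h5 : (0:ℝ) ≤ 2 * (c1 + 2 * d) := by positivity
    have h6 : (0:ℝ) ≤ (K:ℝ) ^ 4 := by positivity
    have h7 : (0:ℝ) ≤ q := by positivity
    nlinarith
  · push Not at hbig
    set a := (q - 1) / n - d with ha
    have hdiv : n * ((q - 1) / n) ≤ q - 1 := Nat.mul_div_le _ _
    have hdiv2 : q - 1 < n * ((q - 1) / n + 1) := Nat.lt_mul_div_succ _ hn
    have e2 : 2 * n * d = 2 * (n * d) := by ring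
    have hμq : μ ≤ q := (Nat.le_mul_self μ).trans hle1
    have hnd : n * d ≤ q - 1 := by omega
    have hd : d ≤ (q - 1) / n := by
      rw [Nat.le_div_iff_mul_le hn]; linarith
    have had : a + d = (q - 1) / n := by omega
    have hqa : q ≤ 2 * n * (a + 1) := by
      have h1 : q ≤ n * (a + d + 1) := by rw [had]; omega
      have e3 : n * (a + d + 1) = n * a + n * d + n := by ring
      have e4 : 2 * n * (a + 1) = 2 * (n * a) + 2 * n := by ring
      omega
    have hμc : c1 ≤ μ := by omega
    have hμn : 2 * n * d ≤ μ := by omega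
    have key := stepanov_core f hm hi (d := d) hf a (μ + c1 - 1) (n * μ) n hnn hn (by rw [had, ← hq]; omega) (by
      exact numA n d μ c1 q a E hn hE hc1 hμc hμn hle1 hqa) T hT
    have hk2 : T.card * μ ≤ q * μ + q * (c1 + 2 * d) := by
      have h1 : n * (T.card * μ) ≤ n * (a + q * (μ + c1 - 1) + (1 + q) * d) := by
        calc n * (T.card * μ) = T.card * (n * μ) := by ring
          _ ≤ _ := key
          _ = _ := by ring
      have h2 := Nat.le_of_mul_le_mul_left h1 hn
      have h3 : a ≤ q := by
        have : (q - 1) / n ≤ q - 1 := Nat.div_le_self _ _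
        omega
      obtain ⟨b, hb⟩ : ∃ b, b + 1 = μ + c1 := ⟨μ + c1 - 1, by omega⟩
      have hb' : μ + c1 - 1 = b := by omega
      rw [hb'] at h2
      exact numB _ q μ c1 d a b hq1 hb h3 h2
    have hμ0 : (0:ℝ) < μ := by
      have : 0 < μ := by omega
      exact_mod_cast this
    have hk3 : (T.card : ℝ) * μ ≤ q * μ + q * (c1 + 2 * d) := by exact_mod_cast hk2
    have hs : Real.sqrt q ≤ 2 * μ := by
      rw [Real.sqrt_le_left (by positivity)]
      have : q ≤ (2 * μ) ^ 2 := by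
        have : 1 ≤ μ := by omega
        nlinarith
      exact_mod_cast this
    have hk4 : (q:ℝ) ≤ 2 * μ * Real.sqrt q := by
      nlinarith
    have hc0 : (0:ℝ) ≤ c1 + 2 * d := by positivity
    have hk5 : (T.card : ℝ) * μ ≤ (q + 2 * (c1 + 2 * d) * Real.sqrt q) * μ := by
      nlinarith [mul_le_mul_of_nonneg_right hk4 hc0]
    have hk6 := le_of_mul_le_mul_right hk5 hμ0
    have : (0:ℝ) ≤ (K:ℝ)^4 * Real.sqrt q := by positivity
    linarith

theorem stepanov (n d : ℕ) : ∃ C : ℝ, 0 ≤ C ∧ ∀ (F : Type) [Field F] [Fintype F] (f : F[X][X]),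
    f.Monic → Irreducible f → (∀ i, (f.coeff i).natDegree ≤ d) → f.natDegree ≤ n →
    ∀ T : Finset (F × F), (∀ P ∈ T, f.evalEval P.1 P.2 = 0 ∧ (derivative f).evalEval P.1 P.2 ≠ 0) →
    (T.card : ℝ) ≤ Fintype.card F + C * Real.sqrt (Fintype.card F) := by
  choose! C hC0 hC using fun n (h : 0 < n) => stepanov_exact n d h
  refine ⟨∑ i ∈ Finset.Icc 1 n, C i, Finset.sum_nonneg fun i hi => hC0 i (Finset.mem_Icc.1 hi).1, ?_⟩
  intro F _ _ f hm hi hf hn T hT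
  have hpos : 0 < f.natDegree := by
    by_contra h
    have := hm.natDegree_eq_zero.1 (by omega)
    rw [this] at hi
    exact not_irreducible_one hi
  refine (hC _ hpos F f hm hi hf rfl T hT).trans ?_
  have : C f.natDegree ≤ ∑ i ∈ Finset.Icc 1 n, C i :=
    Finset.single_le_sum (f := C) (fun i hi => hC0 i (Finset.mem_Icc.1 hi).1) (Finset.mem_Icc.2 ⟨hpos, hn⟩)
  gcongr

end CDM
end

section
namespace CDM
open Polynomial

class Cov (K O : Type) [Field K] [CommRing O] [IsDomain O] [Algebra K[X] O]
    [Module.IsTorsionFree K[X] O] [Algebra.IsIntegral K[X] O] : Prop where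
  splits : ∀ f : K[X][X], f.Monic → ∃ m : Multiset O,
    f.map (algebraMap K[X] O) = (m.map (fun r => X - C r)).prod
  conj : ∀ z z' : O, aeval z' (minpoly K[X] z) = 0 → ∃ γ : O ≃ₐ[K[X]] O, γ z = z'

abbrev Om (K : Type) [Field K] := AlgebraicClosure (RatFunc K)
noncomputable abbrev OO (K : Type) [Field K] := integralClosure K[X] (Om K)

instance OO_tf (K : Type) [Field K] : Module.IsTorsionFree K[X] (OO K) := by
  have h : Function.Injective (algebraMap K[X] (Om K)) := by
    rw [IsScalarTower.algebraMap_eq K[X] (RatFunc K) (Om K)]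
    exact (algebraMap (RatFunc K) (Om K)).injective.comp (IsFractionRing.injective K[X] (RatFunc K))
  have h2 : Function.Injective (algebraMap K[X] (OO K)) := by
    intro a b hab
    apply h
    have := congrArg (algebraMap (OO K) (Om K)) hab
    simpa [← IsScalarTower.algebraMap_apply] using this
  have : FaithfulSMul K[X] (OO K) := (faithfulSMul_iff_algebraMap_injective _ _).2 h2
  infer_instance

instance OO_cov (K : Type) [Field K] : Cov K (OO K) where
  splits := by
    intro f hf
    have hs : (f.map (algebraMap K[X] (Om K))).Splits := IsAlgClosed.splits _
    have hmap : f.map (algebraMap K[X] (Om K)) = (f.map (algebraMap K[X] (OO K))).map (algebraMap (OO K) (Om K)) := by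
      rw [Polynomial.map_map]; rfl
    have hm : (f.map (algebraMap K[X] (Om K))).Monic := hf.map _
    have h1 := hs.eq_prod_roots
    rw [hm.leadingCoeff, C_1, one_mul] at h1
    have hInteg : ∀ r ∈ (f.map (algebraMap K[X] (Om K))).roots, r ∈ OO K := by
      intro r hr
      show IsIntegral K[X] r
      refine ⟨f, hf, ?_⟩
      have := (mem_roots'.1 hr).2
      simpa [IsRoot.def, eval_map] using this
    refine ⟨(f.map (algebraMap K[X] (Om K))).roots.pmap (fun r hr => (⟨r, hr⟩ : OO K)) hInteg, ?_⟩
    apply Polynomial.map_injective (algebraMap (OO K) (Om K)) (Subtype.val_injective)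
    rw [← hmap]
    conv_lhs => rw [h1]
    rw [Polynomial.map_multiset_prod, Multiset.map_map, Multiset.map_pmap]
    congr 1
    symm
    rw [Multiset.pmap_congr (g := fun r _ => X - C r) (H₂ := fun r _ => trivial)] 
    · rw [Multiset.pmap_eq_map]
    · intros; simp
  conj := by
    intro z z' h
    have hz : IsIntegral K[X] (z : Om K) := z.2
    have h1 : aeval (z' : Om K) (minpoly (RatFunc K) (z : Om K)) = 0 := by
      rw [minpoly.isIntegrallyClosed_eq_field_fractions' (R := K[X]) (RatFunc K) hz]
      rw [aeval_map_algebraMap]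
      have e : minpoly K[X] (z : Om K) = minpoly K[X] z :=
        minpoly.algebraMap_eq (B := OO K) (B' := Om K) Subtype.val_injective z
      rw [e]
      have := congrArg (algebraMap (OO K) (Om K)) h
      rw [map_zero, ← aeval_algebraMap_apply] at this
      exact this
    obtain ⟨σ, hσ⟩ := minpoly.exists_algEquiv_of_root'
      (Algebra.IsAlgebraic.isAlgebraic (R := RatFunc K) (z : Om K)) h1
    refine ⟨(σ.restrictScalars K[X]).mapIntegralClosure, ?_⟩
    apply Subtype.ext
    exact hσ

section
variable {K O : Type} [Field K] [CommRing O] [IsDomain O] [Algebra K[X] O]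
    [Module.IsTorsionFree K[X] O] [Algebra.IsIntegral K[X] O]

def Over (E : O →+* K) (x : K) : Prop := ∀ p : K[X], E (algebraMap K[X] O p) = p.eval x

theorem exists_over [IsAlgClosed K] (x : K) : ∃ E : O →+* K, Over E x := by
  let P : Ideal K[X] := RingHom.ker (evalRingHom x)
  have hPm : P.IsMaximal := RingHom.ker_isMaximal_of_surjective _ (fun y => ⟨C y, by simp⟩)
  obtain ⟨Q, hQ, hQP⟩ := Ideal.exists_ideal_over_maximal_of_isIntegral (S := O) P (by
    rw [(RingHom.injective_iff_ker_eq_bot _).1 (FaithfulSMul.algebraMap_injective K[X] O)]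
    exact bot_le)
  letI : Field (O ⧸ Q) := Ideal.Quotient.field Q
  let φ : K →+* O ⧸ Q := (Ideal.Quotient.mk Q).comp ((algebraMap K[X] O).comp C)
  letI : Algebra K (O ⧸ Q) := φ.toAlgebra
  have hev : ∀ p : K[X], Ideal.Quotient.mk Q (algebraMap K[X] O p) = φ (p.eval x) := by
    intro p
    rw [show φ (p.eval x) = Ideal.Quotient.mk Q (algebraMap K[X] O (C (p.eval x))) from rfl]
    rw [Ideal.Quotient.eq, ← map_sub, ← Ideal.mem_comap, hQP, RingHom.mem_ker]
    simp
  have hInteg : Algebra.IsIntegral K (O ⧸ Q) := by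
    refine ⟨fun y => ?_⟩
    obtain ⟨z, rfl⟩ := Ideal.Quotient.mk_surjective y
    obtain ⟨f, hf, hf0⟩ := Algebra.IsIntegral.isIntegral (R := K[X]) z
    refine ⟨f.map (evalRingHom x), hf.map _, ?_⟩
    rw [eval₂_map]
    have : (algebraMap K (O ⧸ Q)).comp (evalRingHom x) = (Ideal.Quotient.mk Q).comp (algebraMap K[X] O) := by
      ext p
      · exact (hev _).symm
      · exact (hev _).symm
    rw [this, ← hom_eval₂, hf0, map_zero]
  have hb := IsAlgClosed.algebraMap_bijective_of_isIntegral (k := K) (K := O ⧸ Q)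
  let e := RingEquiv.ofBijective _ hb
  refine ⟨e.symm.toRingHom.comp (Ideal.Quotient.mk Q), fun p => ?_⟩
  simp only [RingHom.comp_apply, hev]
  exact e.symm_apply_apply _

theorem Over.map_aeval {E : O →+* K} {x : K} (h : Over E x) (f : K[X][X]) (z : O) :
    E (aeval z f) = (f.map (evalRingHom x)).eval (E z) := by
  rw [aeval_def, hom_eval₂, eval_map]
  congr 1
  ext p
  · exact h _
  · exact h _

/-- zero set bound -/
theorem finite_zero (z : O) (hz : z ≠ 0) :
    (minpoly K[X] z).coeff 0 ≠ 0 ∧ ∀ (E : O →+* K) (x : K), Over E x → E z = 0 →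
      ((minpoly K[X] z).coeff 0).eval x = 0 := by
  have hi : IsIntegral K[X] z := Algebra.IsIntegral.isIntegral z
  refine ⟨?_, ?_⟩
  · intro h0
    have hX : X ∣ minpoly K[X] z := X_dvd_iff.2 h0
    obtain ⟨g, hg⟩ := hX
    have h1 := minpoly.aeval K[X] z
    rw [hg, map_mul, aeval_X] at h1
    have h2 : Polynomial.aeval z g = 0 := (mul_eq_zero.1 h1).resolve_left hz
    have h3 := minpoly.isIntegrallyClosed_dvd hi h2
    have hg0 : g ≠ 0 := by
      rintro rfl
      exact (minpoly.monic hi).ne_zero (by simpa using hg)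
    have h4 := natDegree_le_of_dvd h3 hg0
    rw [hg, natDegree_X_mul hg0] at h4
    omega
  · intro E x hE h0
    have := hE.map_aeval (minpoly K[X] z) z
    rw [minpoly.aeval, map_zero, h0, ← coeff_zero_eq_eval_zero, coeff_map] at this
    exact this.symm

theorem finite_zero' (z : O) (hz : z ≠ 0) : {x : K | ∃ E : O →+* K, Over E x ∧ E z = 0}.Finite := by
  obtain ⟨h0, h1⟩ := finite_zero (K := K) z hz
  classical
  refine (Multiset.toFinset ((minpoly K[X] z).coeff 0).roots).finite_toSet.subset ?_
  rintro x ⟨E, hE, hz⟩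
  simp [h0, h1 E x hE hz]

end
end CDM
end

section
namespace CDM
open Polynomial

theorem exists_sep {K : Type} [Field K] [Infinite K] (n : ℕ) (S : Finset (Fin n → K)) :
    ∃ α : Fin n → K, ∀ s ∈ S, ∀ s' ∈ S, ∑ i, α i * s i = ∑ i, α i * s' i → s = s' := by
  classical
  let P : (Fin n → K) → K[X] := fun s => ∑ i, C (s i) * X ^ (i : ℕ)
  have hc : ∀ s (i : Fin n), (P s).coeff i = s i := by
    intro s i
    simp only [P, finset_sum_coeff, coeff_C_mul, coeff_X_pow, mul_ite, mul_one, mul_zero]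
    rw [Finset.sum_eq_single i]
    · simp
    · intro j _ hj
      rw [if_neg]
      intro h
      exact hj (Fin.ext h.symm)
    · simp
  let Q : K[X] := ∏ q ∈ (S ×ˢ S).filter (fun q => q.1 ≠ q.2), (P q.1 - P q.2)
  have hQ : Q ≠ 0 := by
    refine Finset.prod_ne_zero_iff.2 ?_
    intro q hq h0
    apply (Finset.mem_filter.1 hq).2
    funext i
    have := congrArg (fun f => coeff f (i : ℕ)) h0
    simp only [coeff_sub, hc, coeff_zero] at this
    exact sub_eq_zero.1 this
  obtain ⟨β, hβ⟩ : ∃ β, Q.eval β ≠ 0 := by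
    by_contra h
    push Not at h
    exact hQ (Polynomial.funext (by simpa using h))
  refine ⟨fun i => β ^ (i : ℕ), ?_⟩
  intro s hs s' hs' h
  by_contra hne
  apply hβ
  rw [eval_prod]
  refine Finset.prod_eq_zero (i := (s, s')) ?_ ?_
  · simp [hs, hs', hne]
  · simp only [P, eval_sub, eval_finset_sum, eval_mul, eval_C, eval_pow, eval_X, sub_eq_zero]
    simpa [mul_comm] using h

section
variable {K : Type} [Field K]

noncomputable def ev (H : K[X][X]) (x t : K) : K := (H.map (evalRingHom x)).eval t

def IsW (H : K[X][X]) (n : ℕ) (x : K) (s : Fin n → K) : Prop :=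
  Function.Injective s ∧ ∀ t, ev H x t = 0 ↔ ∃ i, s i = t

variable {O : Type} [CommRing O] [IsDomain O] [Algebra K[X] O]
    [Module.IsTorsionFree K[X] O] [Algebra.IsIntegral K[X] O]

def IsLab (H : K[X][X]) {n : ℕ} (l : Fin n → O) : Prop :=
  Function.Injective l ∧ ∀ r, aeval r H = 0 ↔ ∃ i, l i = r

def Spec {n : ℕ} (l : Fin n → O) (x : K) (s : Fin n → K) : Prop :=
  ∃ E : O →+* K, Over E x ∧ ∀ i, E (l i) = s i

theorem Over.root {E : O →+* K} {x : K} (hE : Over E x) {H : K[X][X]} {r : O}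
    (h : aeval r H = 0) : ev H x (E r) = 0 := by
  unfold ev; rw [← hE.map_aeval, h, map_zero]

theorem Over.exists_root [Cov K O] {E : O →+* K} {x : K} (hE : Over E x) {H : K[X][X]}
    (hH : H.Monic) {t : K} (h : ev H x t = 0) : ∃ r : O, aeval r H = 0 ∧ E r = t := by
  obtain ⟨m, hm⟩ := Cov.splits (O := O) H hH
  have h1 : H.map (evalRingHom x) = (m.map (fun r => X - C (E r))).prod := by
    have : evalRingHom x = E.comp (algebraMap K[X] O) := by
      refine RingHom.ext fun p => (hE p).symm
    rw [this, ← Polynomial.map_map, hm, Polynomial.map_multiset_prod, Multiset.map_map]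
    congr 1
    refine Multiset.map_congr rfl ?_
    intro r _
    simp
  unfold ev at h
  rw [h1, eval_multiset_prod, Multiset.map_map, Multiset.prod_eq_zero_iff, Multiset.mem_map] at h
  obtain ⟨r, hr, h0⟩ := h
  refine ⟨r, ?_, ?_⟩
  · rw [aeval_def, ← eval_map, hm, eval_multiset_prod, Multiset.map_map]
    exact Multiset.prod_eq_zero (Multiset.mem_map.2 ⟨r, hr, by simp⟩)
  · simp [sub_eq_zero] at h0
    exact h0.symm

variable (O) in
theorem exists_lab (H : K[X][X]) (hH : H.Monic) : ∃ (n : ℕ) (l : Fin n → O), n ≤ H.natDegree ∧ IsLab H l := by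
  classical
  let R := (H.map (algebraMap K[X] O)).roots.toFinset
  have hR : ∀ r, r ∈ R ↔ aeval r H = 0 := by
    intro r
    have : (H.map (algebraMap K[X] O)) ≠ 0 := (hH.map _).ne_zero
    simp [R, this, eval_map, aeval_def]
  refine ⟨R.card, fun i => (R.equivFin.symm i : O), ?_, ?_, ?_⟩
  · calc R.card ≤ _ := Multiset.toFinset_card_le _
      _ ≤ (H.map (algebraMap K[X] O)).natDegree := card_roots' _
      _ ≤ _ := natDegree_map_le
  · exact Subtype.val_injective.comp (Equiv.injective _)
  · intro r
    rw [← hR]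
    constructor
    · intro h
      exact ⟨R.equivFin ⟨r, h⟩, by simp⟩
    · rintro ⟨i, rfl⟩
      exact (R.equivFin.symm i).2

theorem IsW.surj_inj {H : K[X][X]} {n : ℕ} {x : K} {s s' : Fin n → K} (hs : IsW H n x s)
    (hr : ∀ t, ev H x t = 0 ↔ ∃ i, s' i = t) : IsW H n x s' := by
  refine ⟨?_, hr⟩
  have h : ∀ i, ∃ j, s' j = s i := fun i => (hr _).1 ((hs.2 _).2 ⟨i, rfl⟩)
  choose f hf using h
  have hfi : Function.Injective f := by
    intro a b hab
    apply hs.1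
    rw [← hf, ← hf, hab]
  have hfb := Finite.injective_iff_bijective.1 hfi
  intro a b hab
  obtain ⟨a, rfl⟩ := hfb.2 a
  obtain ⟨b, rfl⟩ := hfb.2 b
  rw [hf, hf] at hab
  rw [hs.1 hab]

theorem IsW.comp {H : K[X][X]} {n : ℕ} {x : K} {s : Fin n → K} (hs : IsW H n x s)
    (τ : Equiv.Perm (Fin n)) : IsW H n x (s ∘ τ) := by
  refine ⟨hs.1.comp τ.injective, fun t => ?_⟩
  rw [hs.2]
  constructor
  · rintro ⟨i, rfl⟩; exact ⟨τ.symm i, by simp⟩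
  · rintro ⟨i, rfl⟩; exact ⟨τ i, rfl⟩

theorem IsW.perm {H : K[X][X]} {n : ℕ} {x : K} {s s' : Fin n → K} (hs : IsW H n x s)
    (hs' : IsW H n x s') : ∃ τ : Equiv.Perm (Fin n), s' = s ∘ τ := by
  have h : ∀ i, ∃ j, s j = s' i := fun i => (hs.2 _).1 ((hs'.2 _).2 ⟨i, rfl⟩)
  choose f hf using h
  have hfi : Function.Injective f := by
    intro a b hab
    apply hs'.1
    rw [← hf, ← hf, hab]
  refine ⟨Equiv.ofBijective f (Finite.injective_iff_bijective.1 hfi), ?_⟩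
  funext i
  exact (hf i).symm

theorem IsLab.comp {H : K[X][X]} {n : ℕ} {l : Fin n → O} (hs : IsLab H l)
    (τ : Equiv.Perm (Fin n)) : IsLab H (l ∘ τ) := by
  refine ⟨hs.1.comp τ.injective, fun t => ?_⟩
  rw [hs.2]
  constructor
  · rintro ⟨i, rfl⟩; exact ⟨τ.symm i, by simp⟩
  · rintro ⟨i, rfl⟩; exact ⟨τ i, rfl⟩

theorem IsLab.perm {H : K[X][X]} {n : ℕ} {s s' : Fin n → O} (hs : IsLab H s)
    (hs' : IsLab H s') : ∃ τ : Equiv.Perm (Fin n), s' = s ∘ τ := by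
  have h : ∀ i, ∃ j, s j = s' i := fun i => (hs.2 _).1 ((hs'.2 _).2 ⟨i, rfl⟩)
  choose f hf using h
  have hfi : Function.Injective f := by
    intro a b hab
    apply hs'.1
    rw [← hf, ← hf, hab]
  refine ⟨Equiv.ofBijective f (Finite.injective_iff_bijective.1 hfi), ?_⟩
  funext i
  exact (hf i).symm

theorem IsLab.gal {H : K[X][X]} {n : ℕ} {l : Fin n → O} (hl : IsLab H l)
    (γ : O ≃ₐ[K[X]] O) : IsLab H (fun i => γ (l i)) := by
  refine ⟨γ.injective.comp hl.1, fun r => ?_⟩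
  have : aeval r H = 0 ↔ aeval (γ.symm r) H = 0 := by
    rw [← map_eq_zero_iff γ γ.injective (x := aeval (γ.symm r) H), ← aeval_algHom_apply]
    simp
  rw [this, hl.2]
  constructor
  · rintro ⟨i, hi⟩; exact ⟨i, by simp [hi]⟩
  · rintro ⟨i, hi⟩; exact ⟨i, by rw [← hi]; simp⟩

theorem Spec.gal {n : ℕ} {l : Fin n → O} {x : K} {s : Fin n → K} (h : Spec l x s)
    (γ : O ≃ₐ[K[X]] O) : Spec (fun i => γ (l i)) x s := by
  obtain ⟨E, hE, h⟩ := h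
  refine ⟨E.comp (γ.symm : O →+* O), fun p => ?_, fun i => ?_⟩
  · have : γ.symm (algebraMap K[X] O p) = algebraMap K[X] O p := γ.symm.commutes p
    simp [this, hE p]
  · simp [h]

theorem Spec.comp {n : ℕ} {l : Fin n → O} {x : K} {s : Fin n → K} (h : Spec l x s)
    (τ : Equiv.Perm (Fin n)) : Spec (l ∘ τ) x (s ∘ τ) := by
  obtain ⟨E, hE, h⟩ := h
  exact ⟨E, hE, fun i => h _⟩

/-- over a good point, any `E` maps a labelling to an enumeration -/
theorem IsLab.isW [Cov K O] {H : K[X][X]} (hH : H.Monic) {n : ℕ} {l : Fin n → O} (hl : IsLab H l)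
    {x : K} {s : Fin n → K} (hs : IsW H n x s) {E : O →+* K} (hE : Over E x) :
    IsW H n x (fun i => E (l i)) := by
  refine hs.surj_inj fun t => ⟨fun h => ?_, ?_⟩
  · obtain ⟨r, hr, rfl⟩ := hE.exists_root hH h
    obtain ⟨i, rfl⟩ := (hl.2 r).1 hr
    exact ⟨i, rfl⟩
  · rintro ⟨i, rfl⟩
    exact hE.root ((hl.2 _).2 ⟨i, rfl⟩)

theorem Spec.isW [Cov K O] {H : K[X][X]} (hH : H.Monic) {n : ℕ} {l : Fin n → O} (hl : IsLab H l)
    {x : K} {s s' : Fin n → K} (hs : IsW H n x s) (h : Spec l x s') : IsW H n x s' := by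
  obtain ⟨E, hE, h⟩ := h
  have := hl.isW hH hs hE
  simpa [h] using this

/-- every point has a label -/
theorem exists_label [Cov K O] [IsAlgClosed K] {H : K[X][X]} (hH : H.Monic) {n : ℕ} {l : Fin n → O} (hl : IsLab H l)
    {x : K} {s : Fin n → K} (hs : IsW H n x s) : ∃ l' : Fin n → O, IsLab H l' ∧ Spec l' x s := by
  obtain ⟨E, hE⟩ := exists_over (O := O) x
  obtain ⟨τ, hτ⟩ := (hl.isW hH hs hE).perm hs
  exact ⟨l ∘ τ, hl.comp τ, E, hE, fun i => by rw [hτ]; rfl⟩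

/-- conjugates of a linear form in the label -/
theorem conj_of_root [Cov K O] (x : K) (E : O →+* K) (hE : Over E x) (z : O) (u : K)
    (h : ev (minpoly K[X] z) x u = 0) : ∃ γ : O ≃ₐ[K[X]] O, E (γ z) = u := by
  obtain ⟨r, hr, hu⟩ := hE.exists_root (minpoly.monic (Algebra.IsIntegral.isIntegral z)) h
  obtain ⟨γ, hγ⟩ := Cov.conj z r hr
  exact ⟨γ, by rw [hγ, hu]⟩

noncomputable def lin {n : ℕ} (α : Fin n → K) (l : Fin n → O) : O := ∑ i, algebraMap K[X] O (C (α i)) * l i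

theorem lin_map {n : ℕ} (α : Fin n → K) (l : Fin n → O) {E : O →+* K} {x : K} (hE : Over E x) :
    E (lin α l) = ∑ i, α i * E (l i) := by
  simp only [lin, map_sum, map_mul, hE (C _), eval_C]

theorem lin_gal {n : ℕ} (α : Fin n → K) (l : Fin n → O) (γ : O ≃ₐ[K[X]] O) :
    γ (lin α l) = lin α (fun i => γ (l i)) := by
  simp only [lin, map_sum, map_mul, AlgEquiv.commutes]

theorem IsW.sep_of [Cov K O] {H : K[X][X]} (hH : H.Monic) {n : ℕ} {l l' : Fin n → O}
    (hl : IsLab H l) (hl' : IsLab H l') {x : K} {s : Fin n → K} (hs : IsW H n x s)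
    (h' : Spec l' x s) (α : Fin n → K)
    (hα : ∀ s', IsW H n x s' → ∑ i, α i * s' i = ∑ i, α i * s i → s' = s)
    (h0 : ev (minpoly K[X] (lin α l)) x (∑ i, α i * s i) = 0) :
    ∃ γ : O ≃ₐ[K[X]] O, ∀ i, l' i = γ (l i) := by
  obtain ⟨E, hE, hEs⟩ := h'
  obtain ⟨γ, hγ⟩ := conj_of_root x E hE _ _ h0
  refine ⟨γ, fun i => ?_⟩
  rw [lin_gal, lin_map _ _ hE] at hγ
  have h1 := hα _ ((hl.gal γ).isW hH hs hE) hγ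
  have h2 := congrFun h1 i
  rw [← hEs i] at h2
  obtain ⟨j, hj⟩ := (hl'.2 (γ (l i))).1 (((hl.gal γ).2 _).2 ⟨i, rfl⟩)
  have h3 := hl'.isW hH hs hE
  rw [← hj] at h2 ⊢
  rw [h3.1 h2]

theorem exists_sepW [Infinite K] {H : K[X][X]} {n : ℕ} {x x' : K} :
    ∃ α : Fin n → K, (∀ s, IsW H n x s → ∀ s', IsW H n x s' → ∑ i, α i * s' i = ∑ i, α i * s i → s' = s) ∧
    (∀ s, IsW H n x' s → ∀ s', IsW H n x' s' → ∑ i, α i * s' i = ∑ i, α i * s i → s' = s) := by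
  classical
  have hf : ∀ x, {s | IsW H n x s}.Finite := by
    intro x
    by_cases h : ∃ s, IsW H n x s
    · obtain ⟨s, hs⟩ := h
      refine (Set.finite_range (fun τ : Equiv.Perm (Fin n) => s ∘ τ)).subset ?_
      intro s' hs'
      obtain ⟨τ, hτ⟩ := hs.perm hs'
      exact ⟨τ, hτ.symm⟩
    · push Not at h
      convert Set.finite_empty
      ext s; simp [h]
  obtain ⟨α, hα⟩ := exists_sep n ((hf x).toFinset ∪ (hf x').toFinset)
  refine ⟨α, ?_, ?_⟩
  · intro s hs s' hs' h
    exact hα _ (by simp [hs']) _ (by simp [hs]) h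
  · intro s hs s' hs' h
    exact hα _ (by simp [hs']) _ (by simp [hs]) h

theorem label_unique [Cov K O] [IsAlgClosed K] {H : K[X][X]} (hH : H.Monic) {n : ℕ} {l l' : Fin n → O}
    (hl : IsLab H l) (hl' : IsLab H l') {x : K} {s : Fin n → K} (hs : IsW H n x s)
    (h : Spec l x s) (h' : Spec l' x s) : ∃ γ : O ≃ₐ[K[X]] O, ∀ i, l' i = γ (l i) := by
  have : Infinite K := IsAlgClosed.instInfinite
  obtain ⟨α, hα, -⟩ := exists_sepW (H := H) (n := n) (x := x) (x' := x)
  refine hs.sep_of hH hl hl' h' α (hα s hs) ?_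
  obtain ⟨E, hE, hEs⟩ := h
  have := hE.root (minpoly.aeval K[X] (lin α l))
  rw [lin_map _ _ hE] at this
  simpa [hEs] using this

variable (O) in
def Rel (H : K[X][X]) (n : ℕ) (x : K) (s : Fin n → K) (x' : K) (s' : Fin n → K) : Prop :=
  ∃ l : Fin n → O, IsLab H l ∧ Spec l x s ∧ Spec l x' s'

section rel
variable [Cov K O] [IsAlgClosed K] {H : K[X][X]} {n : ℕ}
theorem Rel.symm (hH : H.Monic) {x : K} {s : Fin n → K} {x' : K} {s' : Fin n → K} (h : Rel O H n x s x' s') :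
    Rel O H n x' s' x s := by
  obtain ⟨l, h1, h2, h3⟩ := h
  exact ⟨l, h1, h3, h2⟩

theorem Rel.refl' (hH : H.Monic) {l : Fin n → O} (hl : IsLab H l) {x : K} {s : Fin n → K} (hs : IsW H n x s) :
    Rel O H n x s x s := by
  obtain ⟨l', h1, h2⟩ := exists_label hH hl hs
  exact ⟨l', h1, h2, h2⟩

theorem Rel.spec (hH : H.Monic) {x : K} {s : Fin n → K} {x' : K} {s' : Fin n → K} (h : Rel O H n x s x' s')
    (hs : IsW H n x s) {l : Fin n → O} (hl : IsLab H l) (h0 : Spec l x s) : Spec l x' s' := by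
  obtain ⟨l', h1, h2, h3⟩ := h
  obtain ⟨γ, hγ⟩ := label_unique hH h1 hl hs h2 h0
  have := h3.gal γ
  simpa [← hγ] using this

theorem Rel.trans (hH : H.Monic) {x : K} {s : Fin n → K} {x' : K} {s' : Fin n → K} {x'' : K} {s'' : Fin n → K}
    (h : Rel O H n x s x' s') (h' : Rel O H n x' s' x'' s'') (hs' : IsW H n x' s') :
    Rel O H n x s x'' s'' := by
  obtain ⟨l, h1, h2, h3⟩ := h
  exact ⟨l, h1, h2, h'.spec hH hs' h1 h3⟩

theorem Rel.comp (hH : H.Monic) {x : K} {s : Fin n → K} {x' : K} {s' : Fin n → K} (h : Rel O H n x s x' s')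
    (τ : Equiv.Perm (Fin n)) : Rel O H n x (s ∘ τ) x' (s' ∘ τ) := by
  obtain ⟨l, h1, h2, h3⟩ := h
  exact ⟨l ∘ τ, h1.comp τ, h2.comp τ, h3.comp τ⟩

theorem Rel.exists_over (hH : H.Monic) {l : Fin n → O} (hl : IsLab H l) {x : K} {s : Fin n → K} (hs : IsW H n x s)
    {x' : K} {s' : Fin n → K} (hs' : IsW H n x' s') : ∃ s'', IsW H n x' s'' ∧ Rel O H n x s x' s'' := by
  obtain ⟨l', h1, h2⟩ := exists_label hH hl hs
  obtain ⟨E, hE⟩ := CDM.exists_over (O := O) x'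
  exact ⟨_, h1.isW hH hs' hE, l', h1, h2, E, hE, fun i => rfl⟩
end rel
end
end CDM
end

section
namespace CDM
open Polynomial

section
variable {K : Type} [Field K]

theorem coeff_swap (f : K[X][X]) (i j : ℕ) :
    ((Bivariate.swap f).coeff i).coeff j = (f.coeff j).coeff i := by
  induction f using Polynomial.induction_on' with
  | add p q hp hq => simp [hp, hq]
  | monomial n a =>
    induction a using Polynomial.induction_on' with
    | add p q hp hq => simp only [map_add, coeff_add, hp, hq]
    | monomial m r =>
      rw [Bivariate.swap_monomial_monomial]
      simp only [coeff_monomial]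
      by_cases h1 : m = i <;> by_cases h2 : n = j <;> simp [h1, h2, coeff_monomial]

noncomputable def xdeg (f : K[X][X]) : ℕ := (Bivariate.swap f).natDegree

theorem xdeg_le_iff (f : K[X][X]) (d : ℕ) : xdeg f ≤ d ↔ ∀ i, (f.coeff i).natDegree ≤ d := by
  unfold xdeg
  constructor
  · intro h i
    rw [natDegree_le_iff_coeff_eq_zero]
    intro N hN
    rw [← coeff_swap, coeff_eq_zero_of_natDegree_lt (lt_of_le_of_lt h hN), coeff_zero]
  · intro h
    rw [natDegree_le_iff_coeff_eq_zero]
    intro N hN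
    ext j
    rw [coeff_swap, coeff_eq_zero_of_natDegree_lt (lt_of_le_of_lt (h j) hN), coeff_zero]

theorem xdeg_le_of_dvd {f g : K[X][X]} (h : f ∣ g) (hg : g ≠ 0) : xdeg f ≤ xdeg g := by
  obtain ⟨k, rfl⟩ := h
  unfold xdeg
  have h1 : Bivariate.swap (f * k) ≠ 0 := (EmbeddingLike.map_ne_zero_iff (f := Bivariate.swap (R := K))).2 hg
  rw [map_mul] at h1 ⊢
  rw [natDegree_mul (left_ne_zero_of_mul h1) (right_ne_zero_of_mul h1)]
  omega

theorem xdeg_prod_le {ι : Type*} (s : Finset ι) (f : ι → K[X][X]) :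
    xdeg (∏ i ∈ s, f i) ≤ ∑ i ∈ s, xdeg (f i) := by
  unfold xdeg
  rw [map_prod]
  exact natDegree_prod_le _ _

theorem xdeg_charpoly {ι : Type*} [Fintype ι] [DecidableEq ι] (A : Matrix ι ι K[X]) (d : ℕ)
    (h : ∀ i j, (A i j).natDegree ≤ d) : xdeg A.charpoly ≤ Fintype.card ι * d := by
  unfold xdeg Matrix.charpoly
  rw [Matrix.det_apply, map_sum]
  refine natDegree_sum_le_of_forall_le _ _ fun σ _ => ?_
  rw [Units.smul_def, map_zsmul]
  refine (natDegree_smul_le _ _).trans ?_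
  rw [map_prod]
  refine (natDegree_prod_le _ _).trans ?_
  refine (Finset.sum_le_sum (g := fun _ => d) fun i _ => ?_).trans (by simp)
  rw [Matrix.charmatrix_apply]
  rw [map_sub, Bivariate.swap_C]
  refine (natDegree_sub_le _ _).trans (max_le ?_ (natDegree_map_le.trans (h _ _)))
  rw [Matrix.diagonal_apply]
  split_ifs
  · rw [Bivariate.swap_Y]; simp
  · simp

variable {O : Type} [CommRing O] [IsDomain O] [Algebra K[X] O]
    [Module.IsTorsionFree K[X] O] [Algebra.IsIntegral K[X] O]

theorem annih {ι : Type*} [Fintype ι] [DecidableEq ι] (A : Matrix ι ι K[X]) (w : ι → O) (z : O)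
    (h : ∀ e, z * w e = ∑ e', algebraMap K[X] O (A e e') * w e') (hw : ∃ e, w e ≠ 0) :
    aeval z A.charpoly = 0 := by
  have h1 : aeval z A.charpoly = ((aeval z).toRingHom.mapMatrix A.charmatrix).det := by
    rw [← RingHom.map_det]; rfl
  rw [h1, ← Matrix.exists_mulVec_eq_zero_iff]
  refine ⟨w, fun h0 => ?_, ?_⟩
  · obtain ⟨e, he⟩ := hw
    exact he (congrFun h0 e)
  · funext e
    simp only [Matrix.mulVec, dotProduct, RingHom.mapMatrix_apply, Matrix.map_apply,
      Matrix.charmatrix_apply, Pi.zero_apply]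
    have : ∀ e', (aeval z).toRingHom (Matrix.diagonal (fun _ => X) e e' - C (A e e')) * w e' =
      (if e = e' then z * w e' else 0) - algebraMap K[X] O (A e e') * w e' := by
      intro e'
      rw [Matrix.diagonal_apply]
      split_ifs with hh <;> simp [sub_mul]
    simp only [this, Finset.sum_sub_distrib, Finset.sum_ite_eq, Finset.mem_univ, if_true, h, sub_self]

theorem lin_bound {n : ℕ} (H : K[X][X]) (hH : H.Monic) (d : ℕ) (hd : ∀ i, (H.coeff i).natDegree ≤ d)
    (l : Fin n → O) (hl : ∀ i, aeval (l i) H = 0) (α : Fin n → K) :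
    (minpoly K[X] (lin α l)).natDegree ≤ H.natDegree ^ n ∧
    xdeg (minpoly K[X] (lin α l)) ≤ H.natDegree ^ n * d := by
  classical
  set D := H.natDegree with hD
  let B : Fin D → Fin D → K[X] := fun a b => if (a : ℕ) + 1 < D then (if (b : ℕ) = a + 1 then 1 else 0)
    else - H.coeff b
  have hB : ∀ (r : O), aeval r H = 0 → ∀ a : Fin D, r * r ^ (a : ℕ) = ∑ b, algebraMap K[X] O (B a b) * r ^ (b : ℕ) := by
    intro r hr a
    by_cases h : (a : ℕ) + 1 < D
    · simp only [B, if_pos h]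
      rw [Finset.sum_eq_single ⟨a + 1, h⟩]
      · simp [pow_succ']
      · intro b _ hb
        rw [if_neg]
        · simp
        · intro h'; apply hb; exact Fin.ext h'
      · simp
    · simp only [B, if_neg h]
      have ha : (a : ℕ) + 1 = D := by have := a.2; omega
      rw [← pow_succ', ha]
      have h2 := hr
      rw [aeval_eq_sum_range, Finset.sum_range_succ, ← hD, hD, hH.coeff_natDegree, ← hD, one_smul] at h2
      rw [eq_neg_of_add_eq_zero_right h2, ← Fin.sum_univ_eq_sum_range (fun i => H.coeff i • r ^ i), ← Finset.sum_neg_distrib]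
      refine Finset.sum_congr rfl fun i _ => ?_
      rw [Algebra.smul_def, map_neg, neg_mul]
  have hBd : ∀ a b, (B a b).natDegree ≤ d := by
    intro a b
    simp only [B]
    split_ifs <;> simp [hd]
  let w : (Fin n → Fin D) → O := fun e => ∏ i, l i ^ (e i : ℕ)
  let A : Matrix (Fin n → Fin D) (Fin n → Fin D) K[X] := fun e e' =>
    ∑ i, C (α i) * ∑ b, if Function.update e i b = e' then B (e i) b else 0
  have hA : ∀ e e', (A e e').natDegree ≤ d := by
    intro e e'
    refine natDegree_sum_le_of_forall_le _ _ fun i _ => ?_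
    refine (natDegree_C_mul_le _ _).trans ?_
    refine natDegree_sum_le_of_forall_le _ _ fun b _ => ?_
    split_ifs
    · exact hBd _ _
    · simp
  have hw : ∃ e, w e ≠ 0 := by
    refine ⟨fun i => ⟨0, ?_⟩, ?_⟩
    · rw [hD]
      rcases Nat.eq_zero_or_pos H.natDegree with h0 | h0
      · exfalso
        have := hl i
        rw [hH.natDegree_eq_zero.1 h0] at this
        simp at this
      · exact h0
    · simp [w]
  have hann : aeval (lin α l) A.charpoly = 0 := by
    refine annih A w _ (fun e => ?_) hw
    have h1 : ∀ i, l i * w e = ∑ b, algebraMap K[X] O (B (e i) b) * w (Function.update e i b) := by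
      intro i
      have h2 : ∀ e : Fin n → Fin D, w e = l i ^ (e i : ℕ) * ∏ j ∈ Finset.univ.erase i, l j ^ (e j : ℕ) := by
        intro e
        exact (Finset.mul_prod_erase _ _ (Finset.mem_univ i)).symm
      rw [h2 e, ← mul_assoc, hB _ (hl i), Finset.sum_mul]
      refine Finset.sum_congr rfl fun b _ => ?_
      rw [h2 (Function.update e i b), Function.update_self, mul_assoc]
      congr 2
      refine Finset.prod_congr rfl fun j hj => ?_
      rw [Function.update_of_ne (Finset.ne_of_mem_erase hj)]
    simp only [A, lin, Finset.sum_mul, map_sum, map_mul]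
    rw [Finset.sum_comm]
    refine Finset.sum_congr rfl fun i _ => ?_
    rw [mul_assoc, h1]
    simp only [mul_assoc, Finset.sum_mul, Finset.mul_sum]
    rw [Finset.sum_comm]
    refine Finset.sum_congr rfl fun b _ => ?_
    rw [Finset.sum_eq_single (Function.update e i b)]
    · simp
    · intro e' _ he'
      rw [if_neg he'.symm]; simp
    · simp
  have hi : IsIntegral K[X] (lin α l) := Algebra.IsIntegral.isIntegral _
  have hdvd := minpoly.isIntegrallyClosed_dvd hi hann
  have hne : A.charpoly ≠ 0 := (Matrix.charpoly_monic A).ne_zero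
  refine ⟨?_, ?_⟩
  · refine (natDegree_le_of_dvd hdvd hne).trans ?_
    rw [Matrix.charpoly_natDegree_eq_dim]; simp
  · refine (xdeg_le_of_dvd hdvd hne).trans ?_
    refine (xdeg_charpoly A d hA).trans ?_
    simp

/-- bound on the number of bad points -/
theorem bad_bound [Cov K O] [IsAlgClosed K] {n : ℕ} (H : K[X][X]) (hH : H.Monic) (d : ℕ) (hd : ∀ i, (H.coeff i).natDegree ≤ d)
    {l : Fin n → O} (hl : IsLab H l) : ∃ B : Finset K, B.card ≤ n * n * (H.natDegree ^ 2 * d) ∧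
      ∀ x ∉ B, ∃ s, IsW H n x s := by
  classical
  let c : Fin n × Fin n → K[X] := fun q => (minpoly K[X] (lin ![(1:K), -1] ![l q.1, l q.2])).coeff 0
  have hz : ∀ a b, (lin ![(1:K), -1] ![a, b] : O) = a - b := by
    intro a b
    simp [lin, sub_eq_add_neg]
  let B : Finset K := (Finset.univ.filter (fun q : Fin n × Fin n => q.1 ≠ q.2)).biUnion (fun q => (c q).roots.toFinset)
  refine ⟨B, ?_, ?_⟩
  · refine Finset.card_biUnion_le.trans ?_
    refine (Finset.sum_le_card_nsmul _ _ (H.natDegree ^ 2 * d) ?_).trans ?_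
    · intro q hq
      refine (Multiset.toFinset_card_le _).trans ((card_roots' _).trans ?_)
      refine (xdeg_le_iff _ _).1 ?_ 0
      refine (lin_bound H hH d hd _ ?_ _).2
      intro i
      fin_cases i
      · exact (hl.2 _).2 ⟨_, rfl⟩
      · exact (hl.2 _).2 ⟨_, rfl⟩
    · rw [smul_eq_mul]
      refine Nat.mul_le_mul_right _ ((Finset.card_filter_le _ _).trans ?_)
      simp
  · intro x hx
    obtain ⟨E, hE⟩ := exists_over (O := O) x
    refine ⟨fun i => E (l i), ?_, ?_⟩
    · intro i j hij
      by_contra hne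
      apply hx
      refine Finset.mem_biUnion.2 ⟨(i, j), by simp [hne], ?_⟩
      have h0 : (lin ![(1:K), -1] ![l i, l j] : O) ≠ 0 := by
        rw [hz]
        intro h
        exact hne (hl.1 (sub_eq_zero.1 h))
      obtain ⟨h1, h2⟩ := finite_zero (K := K) _ h0
      have := h2 E x hE (by rw [hz, map_sub]; exact sub_eq_zero.2 hij)
      simp only [Multiset.mem_toFinset]
      exact (mem_roots h1).2 this
    · intro t
      constructor
      · intro h
        obtain ⟨r, hr, rfl⟩ := hE.exists_root hH h
        obtain ⟨i, rfl⟩ := (hl.2 r).1 hr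
        exact ⟨i, rfl⟩
      · rintro ⟨i, rfl⟩
        exact hE.root ((hl.2 _).2 ⟨i, rfl⟩)

theorem IsW.card_le {H : K[X][X]} {n m : ℕ} {x : K} {s : Fin n → K} {s' : Fin m → K}
    (hs : IsW H n x s) (hs' : IsW H m x s') : n ≤ m := by
  have h : ∀ i, ∃ j, s' j = s i := fun i => (hs'.2 _).1 ((hs.2 _).2 ⟨i, rfl⟩)
  choose f hf using h
  have hfi : Function.Injective f := by
    intro a b hab
    apply hs.1
    rw [← hf, ← hf, hab]
  simpa using Fintype.card_le_of_injective f hfi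

variable (O) in
theorem lab_of_infinite [Cov K O] [IsAlgClosed K] {n : ℕ} (H : K[X][X]) (hH : H.Monic)
    (hinf : {x | ∃ s, IsW H n x s}.Infinite) : ∃ l : Fin n → O, IsLab H l := by
  obtain ⟨m, l, -, hl⟩ := exists_lab O H hH
  obtain ⟨B, -, hB⟩ := bad_bound H hH (xdeg H) ((xdeg_le_iff _ _).1 le_rfl) hl
  obtain ⟨x, ⟨s, hs⟩, hx⟩ := hinf.exists_notMem_finset B
  obtain ⟨s', hs'⟩ := hB x hx
  have : m = n := le_antisymm (hs'.card_le hs) (hs.card_le hs')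
  subst this
  exact ⟨l, hl⟩

theorem zero_of_infinite [Cov K O] (z : O) (S : Set K) (hS : S.Infinite)
    (h : ∀ x ∈ S, ∃ E : O →+* K, Over E x ∧ E z = 0) : z = 0 := by
  by_contra hz
  exact hS ((finite_zero' z hz).subset h)

theorem good_infinite [Cov K O] [IsAlgClosed K] {n : ℕ} (H : K[X][X]) (hH : H.Monic)
    {l : Fin n → O} (hl : IsLab H l) : {x | ∃ s, IsW H n x s}.Infinite := by
  have : Infinite K := IsAlgClosed.instInfinite
  obtain ⟨B, -, hB⟩ := bad_bound H hH (xdeg H) ((xdeg_le_iff _ _).1 le_rfl) hl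
  refine (B.finite_toSet.infinite_compl).mono ?_
  intro x hx
  exact hB x (by simpa using hx)

def BD (e : ℕ) (f : K[X][X]) : Prop := f.natDegree ≤ e ∧ ∀ i, (f.coeff i).natDegree ≤ e

def RelE (e : ℕ) (H : K[X][X]) (n : ℕ) (x : K) (s : Fin n → K) (x' : K) (s' : Fin n → K) : Prop :=
  ¬ ∃ (α : Fin n → K) (f f' : K[X][X]), BD e f ∧ BD e f' ∧
    (∀ x'' s'', IsW H n x'' s'' → ev f x'' (∑ i, α i * s'' i) * ev f' x'' (∑ i, α i * s'' i) = 0) ∧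
    ev f x (∑ i, α i * s i) ≠ 0 ∧ ev f' x' (∑ i, α i * s' i) ≠ 0

theorem ev_prod {ι : Type*} (S : Finset ι) (f : ι → K[X][X]) (x u : K) :
    ev (∏ i ∈ S, f i) x u = ∏ i ∈ S, ev (f i) x u := by
  simp [ev, Polynomial.map_prod, eval_prod]

theorem Over.ev {E : O →+* K} {x : K} (hE : Over E x) (f : K[X][X]) (z : O) :
    ev f x (E z) = E (Polynomial.aeval z f) := (hE.map_aeval f z).symm

def ebd (n D d : ℕ) : ℕ := (n.factorial + 1) * (D ^ n * (d + 1))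

theorem relE_iff [Cov K O] [IsAlgClosed K] {n : ℕ} (H : K[X][X]) (hH : H.Monic) (d : ℕ)
    (hd : ∀ i, (H.coeff i).natDegree ≤ d) {l₀ : Fin n → O} (hl₀ : IsLab H l₀)
    {x : K} {s : Fin n → K} {x' : K} {s' : Fin n → K} (hs : IsW H n x s) (hs' : IsW H n x' s') :
    RelE (ebd n H.natDegree d) H n x s x' s' ↔ Rel O H n x s x' s' := by
  classical
  have : Infinite K := IsAlgClosed.instInfinite
  constructor
  · intro h
    by_contra hR
    apply h
    obtain ⟨α, hα, hα'⟩ := exists_sepW (H := H) (n := n) (x := x) (x' := x')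
    obtain ⟨l, hl, hls⟩ := exists_label hH hl₀ hs
    obtain ⟨l2, hl2, hls2⟩ := exists_label hH hl₀ hs'
    let S : Finset (Equiv.Perm (Fin n)) := Finset.univ.filter (fun τ => ¬ ∃ γ : O ≃ₐ[K[X]] O, ∀ i, l (τ i) = γ (l i))
    let g : (Fin n → O) → K[X][X] := fun l' => minpoly K[X] (lin α l')
    have hroot : ∀ l' : Fin n → O, ∀ x'' s'', Spec l' x'' s'' → ev (g l') x'' (∑ i, α i * s'' i) = 0 := by
      rintro l' x'' s'' ⟨E, hE, hEs⟩
      have := hE.root (minpoly.aeval K[X] (lin α l'))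
      rw [lin_map _ _ hE] at this
      simpa [hEs] using this
    have hb : ∀ l', IsLab H l' → (g l').natDegree ≤ H.natDegree ^ n * (d + 1) ∧ xdeg (g l') ≤ H.natDegree ^ n * (d + 1) := by
      intro l' hl'
      obtain ⟨h1, h2⟩ := lin_bound H hH d hd l' (fun i => (hl'.2 _).2 ⟨i, rfl⟩) α
      exact ⟨h1.trans (Nat.le_mul_of_pos_right _ (Nat.succ_pos _)), h2.trans (Nat.mul_le_mul_left _ (Nat.le_succ _))⟩
    have hle : H.natDegree ^ n * (d + 1) ≤ ebd n H.natDegree d := Nat.le_mul_of_pos_left _ (Nat.succ_pos _)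
    have hcard : S.card * (H.natDegree ^ n * (d + 1)) ≤ ebd n H.natDegree d := by
      refine Nat.mul_le_mul_right _ ((Finset.card_filter_le _ _).trans ?_)
      simp [Fintype.card_perm]
    refine ⟨α, ∏ τ ∈ S, g (l ∘ τ), g l, ⟨?_, ?_⟩, ⟨?_, ?_⟩, ?_, ?_, ?_⟩
    · refine (natDegree_prod_le _ _).trans (le_trans ?_ hcard)
      exact Finset.sum_le_card_nsmul _ _ _ (fun τ _ => (hb _ (hl.comp τ)).1)
    · refine (xdeg_le_iff _ _).1 ?_
      refine (xdeg_prod_le _ _).trans (le_trans ?_ hcard)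
      exact Finset.sum_le_card_nsmul _ _ _ (fun τ _ => (hb _ (hl.comp τ)).2)
    · exact (hb l hl).1.trans hle
    · exact (xdeg_le_iff _ _).1 ((hb l hl).2.trans hle)
    · intro x'' s'' hs''
      obtain ⟨l3, hl3, hls3⟩ := exists_label hH hl₀ hs''
      obtain ⟨τ, rfl⟩ := hl.perm hl3
      by_cases hc : ∃ γ : O ≃ₐ[K[X]] O, ∀ i, l (τ i) = γ (l i)
      · obtain ⟨γ, hγ⟩ := hc
        have := hls3.gal γ.symm
        rw [hroot l x'' s'' (by simpa [hγ] using this), mul_zero]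
      · rw [ev_prod, Finset.prod_eq_zero (i := τ), zero_mul]
        · simpa [S] using hc
        · exact hroot _ _ _ hls3
    · rw [ev_prod]
      refine Finset.prod_ne_zero_iff.2 ?_
      intro τ hτ h0
      obtain ⟨γ, hγ⟩ := hs.sep_of hH (hl.comp τ) hl hls α (hα s hs) h0
      refine (Finset.mem_filter.1 hτ).2 ⟨γ.symm, fun i => ?_⟩
      rw [hγ i]; simp
    · intro h0
      obtain ⟨γ, hγ⟩ := hs'.sep_of hH hl hl2 hls2 α (hα' s' hs') h0
      refine hR ⟨l2, hl2, ?_, hls2⟩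
      have := hls.gal γ
      simpa [← hγ] using this
  · rintro ⟨l, hl, hls, hls'⟩ ⟨α, f, f', -, -, h1, h2, h3⟩
    have hz : aeval (lin α l) f * aeval (lin α l) f' = 0 := by
      refine zero_of_infinite _ _ (good_infinite H hH hl) ?_
      rintro x'' ⟨s'', hs''⟩
      obtain ⟨E, hE⟩ := exists_over (O := O) x''
      refine ⟨E, hE, ?_⟩
      have := h1 x'' _ (hl.isW hH hs'' hE)
      rw [← lin_map _ _ hE, hE.ev, hE.ev, ← map_mul] at this
      exact this
    have key : ∀ (f : K[X][X]) x s, Spec l x s → aeval (lin α l) f = 0 → ev f x (∑ i, α i * s i) = 0 := by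
      rintro f x s ⟨E, hE, hEs⟩ h0
      have := hE.ev f (lin α l)
      rw [h0, map_zero, lin_map _ _ hE] at this
      simpa [hEs] using this
    rcases mul_eq_zero.1 hz with h0 | h0
    · exact h2 (key _ _ _ hls h0)
    · exact h3 (key _ _ _ hls' h0)

theorem poly_generic [Cov K O] [IsAlgClosed K] {n : ℕ} (H : K[X][X]) (hH : H.Monic)
    {x : K} {s : Fin n → K} (hs : IsW H n x s) {l₀ : Fin n → O} (hl₀ : IsLab H l₀)
    (Q : MvPolynomial (Option (Fin n)) K) :
    (∀ x' s', Rel O H n x s x' s' → MvPolynomial.eval (fun o => o.elim x' s') Q = 0) ∨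
    {x' | ∃ s', Rel O H n x s x' s' ∧ MvPolynomial.eval (fun o => o.elim x' s') Q = 0}.Finite := by
  obtain ⟨l, hl, hls⟩ := exists_label hH hl₀ hs
  let z : O := MvPolynomial.eval₂ ((algebraMap K[X] O).comp C) (fun o => o.elim (algebraMap K[X] O X) l) Q
  have hz : ∀ (E : O →+* K) x' s', Over E x' → (∀ i, E (l i) = s' i) → E z = MvPolynomial.eval (fun o => o.elim x' s') Q := by
    intro E x' s' hE hEs
    simp only [z]
    rw [MvPolynomial.eval₂_comp_left, ← MvPolynomial.eval₂_id]
    congr 1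
    · refine RingHom.ext fun a => ?_
      simpa using hE (C a)
    · funext o
      cases o with
      | none => simpa using hE X
      | some i => simpa using hEs i
  by_cases h0 : z = 0
  · left
    intro x' s' h
    obtain ⟨E, hE, hEs⟩ := h.spec hH hs hl hls
    rw [← hz E x' s' hE hEs, h0, map_zero]
  · right
    refine (finite_zero' z h0).subset ?_
    rintro x' ⟨s', h, hQ⟩
    obtain ⟨E, hE, hEs⟩ := h.spec hH hs hl hls
    exact ⟨E, hE, by rw [hz E x' s' hE hEs, hQ]⟩
end
end CDM
end

section
namespace CDM
open Polynomial

section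
variable {K : Type} [Field K]

noncomputable def cmap {K L : Type} [Field K] [Field L] (σ : K →+* L) (f : K[X][X]) : L[X][X] := f.map (mapRingHom σ)

theorem ev_cmap {K L : Type} [Field K] [Field L] (σ : K →+* L) (f : K[X][X]) (x u : K) : ev (cmap σ f) (σ x) (σ u) = σ (ev f x u) := by
  unfold ev cmap
  rw [Polynomial.map_map, eval_map, eval_map, hom_eval₂]
  congr 1
  refine RingHom.ext fun p => ?_
  simp [eval_map, hom_eval₂, eval₂_at_apply]

theorem cmap_cmap {K L M : Type} [Field K] [Field L] [Field M] (σ : K →+* L) (τ : L →+* M) (f : K[X][X]) :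
    cmap τ (cmap σ f) = cmap (τ.comp σ) f := by
  unfold cmap
  rw [Polynomial.map_map]
  congr 1
  refine RingHom.ext fun p => ?_
  simp [Polynomial.map_map]

theorem cmap_id (f : K[X][X]) : cmap (RingHom.id K) f = f := by
  unfold cmap
  have : mapRingHom (RingHom.id K) = RingHom.id _ := by
    refine RingHom.ext fun p => ?_
    simp
  rw [this, Polynomial.map_id]

theorem cmap_symm {σ : K ≃+* K} {H : K[X][X]} (h : cmap (σ : K →+* K) H = H) : cmap (σ.symm : K →+* K) H = H := by
  conv_lhs => rw [← h]
  rw [cmap_cmap]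
  convert cmap_id H
  ext x; simp

theorem BD.cmap {e : ℕ} {f : K[X][X]} (h : BD e f) (σ : K →+* K) : BD e (cmap σ f) := by
  refine ⟨natDegree_map_le.trans h.1, fun i => ?_⟩
  simp only [CDM.cmap, coeff_map, coe_mapRingHom]
  exact natDegree_map_le.trans (h.2 i)

theorem IsW.frob {σ : K ≃+* K} {H : K[X][X]} (hσ : cmap (σ : K →+* K) H = H) {n : ℕ} {x : K} {s : Fin n → K}
    (h : IsW H n x s) : IsW H n (σ x) (fun i => σ (s i)) := by
  refine ⟨σ.injective.comp h.1, fun t => ?_⟩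
  obtain ⟨t, rfl⟩ := σ.surjective t
  have := ev_cmap (σ : K →+* K) H x t
  rw [hσ] at this
  simp only [RingEquiv.coe_toRingHom] at this
  rw [this, map_eq_zero_iff _ σ.injective, h.2]
  simp

theorem RelE.frob {σ : K ≃+* K} {H : K[X][X]} (hσ : cmap (σ : K →+* K) H = H) {e n : ℕ} {x : K} {s : Fin n → K}
    {x' : K} {s' : Fin n → K}
    (h : RelE e H n x s x' s') : RelE e H n (σ x) (fun i => σ (s i)) (σ x') (fun i => σ (s' i)) := by
  rintro ⟨α, f, f', hf, hf', h1, h2, h3⟩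
  have key : ∀ (f : K[X][X]) x (s : Fin n → K), ev (cmap (σ.symm : K →+* K) f) x (∑ i, σ.symm (α i) * s i)
    = σ.symm (ev f (σ x) (∑ i, α i * σ (s i))) := by
    intro f x s
    have := ev_cmap (σ.symm : K →+* K) f (σ x) (∑ i, α i * σ (s i))
    simpa using this
  refine h ⟨fun i => σ.symm (α i), cmap (σ.symm : K →+* K) f, cmap (σ.symm : K →+* K) f', hf.cmap _, hf'.cmap _, ?_, ?_, ?_⟩
  · intro x'' s'' hs''
    rw [key, key, ← map_mul, h1 _ _ (hs''.frob hσ), map_zero]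
  · rw [key]; simpa using h2
  · rw [key]; simpa using h3

theorem Rel.frob {O : Type} [CommRing O] [IsDomain O] [Algebra K[X] O]
    [Module.IsTorsionFree K[X] O] [Algebra.IsIntegral K[X] O] [Cov K O] [IsAlgClosed K]
    {σ : K ≃+* K} {H : K[X][X]} (hH : H.Monic) (hσ : cmap (σ : K →+* K) H = H) {n : ℕ} {x : K} {s : Fin n → K}
    {x' : K} {s' : Fin n → K} (hs : IsW H n x s) (hs' : IsW H n x' s')
    (h : Rel O H n x s x' s') : Rel O H n (σ x) (fun i => σ (s i)) (σ x') (fun i => σ (s' i)) := by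
  have hd := (xdeg_le_iff H _).1 le_rfl
  obtain ⟨l, hl, h1, h2⟩ := id h
  rw [← relE_iff H hH _ hd hl hs hs'] at h
  rw [← relE_iff H hH _ hd hl (hs.frob hσ) (hs'.frob hσ)]
  exact h.frob hσ

/-- maximal contraction -/
theorem exists_contract {R : Type*} [CommRing R] [IsDomain R] (p : ℕ) [Fact p.Prime] [CharP R p] (N : ℕ) :
    ∀ f : R[X], f.natDegree ≤ N → 0 < f.natDegree → Irreducible f → f.Monic →
    ∃ (e : ℕ) (g : R[X]), f = expand R (p ^ e) g ∧ Irreducible g ∧ g.Monic ∧ derivative g ≠ 0 := by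
  have hp : p.Prime := Fact.out
  induction N with
  | zero => intro f h1 h2; omega
  | succ N ih =>
    intro f h1 h2 hi hm
    by_cases hd : derivative f = 0
    · have h3 := expand_contract p hd hp.ne_zero
      set g := contract p f with hg
      have h4 : f.natDegree = g.natDegree * p := by rw [← h3, natDegree_expand]
      have h5 : g.Monic := by
        have := (monic_expand_iff (p := p) (f := g) hp.pos).1 (by rw [h3]; exact hm)
        exact this
      have h6 : Irreducible g := of_irreducible_expand hp.ne_zero (by rw [h3]; exact hi)
      have h7 : 0 < g.natDegree := by
        rcases Nat.eq_zero_or_pos g.natDegree with h | h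
        · rw [h] at h4; omega
        · exact h
      have h8 : g.natDegree ≤ N := by
        have := hp.two_le
        nlinarith
      obtain ⟨e, k, hk, hk2, hk3, hk4⟩ := ih g h8 h7 h6 h5
      refine ⟨e + 1, k, ?_, hk2, hk3, hk4⟩
      rw [← h3, hk, expand_expand, pow_succ']
    · exact ⟨0, f, by simp, hi, hm, hd⟩

def FF (K : Type) [Field K] (p : ℕ) [Fact p.Prime] [CharP K p] (a : ℕ) : Subfield K :=
  RingHom.eqLocusField (iterateFrobenius K p a) (RingHom.id K)

theorem mem_FF {p : ℕ} [Fact p.Prime] [CharP K p] {a : ℕ} {x : K} : x ∈ FF K p a ↔ x ^ (p ^ a) = x := by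
  show iterateFrobenius K p a x = x ↔ _
  rw [iterateFrobenius_def]

theorem FF_card [IsAlgClosed K] {p : ℕ} [Fact p.Prime] [CharP K p] {a : ℕ} (ha : 1 ≤ a) :
    Finite (FF K p a) ∧ Nat.card (FF K p a) = p ^ a := by
  have hp : p.Prime := Fact.out
  have hq : 1 < p ^ a := Nat.one_lt_pow (by omega) hp.one_lt
  classical
  have hsep : (X ^ (p ^ a) - X : K[X]).Separable :=
    galois_poly_separable p (p ^ a) (dvd_pow_self p (by omega))
  have h0 : (X ^ (p ^ a) - X : K[X]) ≠ 0 := FiniteField.X_pow_card_sub_X_ne_zero K hq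
  have h1 : ((FF K p a : Set K)) = (X ^ (p ^ a) - X : K[X]).rootSet K := by
    ext x
    rw [mem_rootSet]
    simp only [SetLike.mem_coe, mem_FF, h0, ne_eq, not_false_eq_true, true_and]
    simp [sub_eq_zero]
  have h2 := card_rootSet_eq_natDegree (K := K) hsep (by simpa using IsAlgClosed.splits _)
  rw [FiniteField.X_pow_card_sub_X_natDegree_eq K hq] at h2
  have h3 : Nat.card (FF K p a : Set K) = p ^ a := by
    rw [h1, Nat.card_eq_fintype_card, h2]
  refine ⟨?_, h3⟩
  exact Nat.finite_of_card_ne_zero (by rw [show Nat.card (FF K p a) = p ^ a from h3]; positivity)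

/-- lifting coefficients to the fixed field -/
theorem exists_lift {p : ℕ} [Fact p.Prime] [CharP K p] {a : ℕ} (f : K[X][X])
    (hf : cmap (iterateFrobenius K p a) f = f) : ∃ g : (FF K p a)[X][X], cmap (FF K p a).subtype g = f := by
  have : f ∈ lifts (mapRingHom (FF K p a).subtype) := by
    rw [lifts_iff_coeff_lifts]
    intro i
    have h2 : f.coeff i ∈ lifts (FF K p a).subtype := by
      rw [lifts_iff_coeff_lifts]
      intro j
      refine ⟨⟨(f.coeff i).coeff j, ?_⟩, rfl⟩
      rw [mem_FF]
      have := congrArg (fun g : K[X][X] => (g.coeff i).coeff j) hf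
      simpa [cmap, iterateFrobenius_def] using this
    obtain ⟨g, hg⟩ := (mem_lifts _).1 h2
    exact ⟨g, hg⟩
  exact (mem_lifts _).1 this

/-- separating Frobenius-compatible linear form -/
theorem exists_alpha [IsAlgClosed K] (n : ℕ) (s : Fin n → K) (hs : Function.Injective s) (F : Finset K)
    (hF : n.factorial * n.factorial * n < F.card) :
    ∃ β ∈ F, ∀ τ τ' : Equiv.Perm (Fin n),
      ∑ i, (∑ k : Fin n, β ^ (k : ℕ) * s i ^ (k : ℕ)) * s (τ i) = ∑ i, (∑ k : Fin n, β ^ (k : ℕ) * s i ^ (k : ℕ)) * s (τ' i) →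
      τ = τ' := by
  classical
  let P : Equiv.Perm (Fin n) → Equiv.Perm (Fin n) → K[X] := fun τ τ' =>
    ∑ k : Fin n, C (∑ i, (s (τ i) - s (τ' i)) * s i ^ (k : ℕ)) * X ^ (k : ℕ)
  have hP : ∀ τ τ', P τ τ' = 0 → τ = τ' := by
    intro τ τ' h
    have h1 : ∀ k : Fin n, ∑ i, (s (τ i) - s (τ' i)) * s i ^ (k : ℕ) = 0 := by
      intro k
      have := congrArg (fun f => coeff f (k : ℕ)) h
      simp only [P, finset_sum_coeff, coeff_C_mul, coeff_X_pow, mul_ite, mul_one, mul_zero, coeff_zero] at this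
      rw [Finset.sum_eq_single k] at this
      · simpa using this
      · intro j _ hj
        rw [if_neg]
        intro h
        exact hj (Fin.ext h.symm)
      · simp
    have h2 : (fun i => s (τ i) - s (τ' i)) = 0 := by
      apply Matrix.eq_zero_of_vecMul_eq_zero (M := Matrix.vandermonde s)
      · exact Matrix.det_vandermonde_ne_zero_iff.2 hs
      · funext k
        simpa [Matrix.vecMul, dotProduct, Matrix.vandermonde_apply] using h1 k
    ext i
    have := congrFun h2 i
    simp only [Pi.zero_apply, sub_eq_zero] at this
    rw [hs this]
  let Q : K[X] := ∏ q ∈ (Finset.univ : Finset (Equiv.Perm (Fin n) × Equiv.Perm (Fin n))).filter (fun q => q.1 ≠ q.2), P q.1 q.2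
  have hQ : Q ≠ 0 := by
    refine Finset.prod_ne_zero_iff.2 ?_
    intro q hq h0
    exact (Finset.mem_filter.1 hq).2 (hP _ _ h0)
  have hdeg : Q.natDegree ≤ n.factorial * n.factorial * n := by
    refine (natDegree_prod_le _ _).trans ?_
    refine (Finset.sum_le_card_nsmul _ _ n ?_).trans ?_
    · intro q _
      refine natDegree_sum_le_of_forall_le _ _ fun k _ => ?_
      exact (natDegree_C_mul_X_pow_le _ _).trans k.2.le
    · rw [smul_eq_mul]
      refine Nat.mul_le_mul_right _ ((Finset.card_filter_le _ _).trans ?_)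
      simp [Fintype.card_perm]
  obtain ⟨β, hβF, hβ⟩ : ∃ β ∈ F, Q.eval β ≠ 0 := by
    by_contra h
    push Not at h
    have : F ⊆ Q.roots.toFinset := by
      intro β hβ
      simp [hQ, h β hβ]
    have := (Finset.card_le_card this).trans ((Multiset.toFinset_card_le _).trans ((card_roots' _).trans hdeg))
    omega
  refine ⟨β, hβF, fun τ τ' h => ?_⟩
  by_contra hne
  apply hβ
  rw [eval_prod]
  refine Finset.prod_eq_zero (i := (τ, τ')) (by simp [hne]) ?_
  simp only [P, eval_finset_sum, eval_mul, eval_C, eval_pow, eval_X]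
  rw [← sub_eq_zero, ← Finset.sum_sub_distrib] at h
  rw [← h]
  simp only [Finset.sum_mul]
  rw [Finset.sum_comm]
  refine Finset.sum_congr rfl fun i _ => ?_
  rw [← Finset.sum_sub_distrib]
  refine Finset.sum_congr rfl fun k _ => ?_
  ring
end
end CDM
end

section
namespace CDM
open Polynomial

section
variable {K : Type} [Field K]
variable {O : Type} [CommRing O] [IsDomain O] [Algebra K[X] O]
    [Module.IsTorsionFree K[X] O] [Algebra.IsIntegral K[X] O]

theorem minpoly_frob [Cov K O] [IsAlgClosed K] {H : K[X][X]} (hH : H.Monic) {n : ℕ} {σ : K ≃+* K}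
    (hσ : cmap (σ : K →+* K) H = H) {x₁ : K} {s₁ : Fin n → K} (hs₁ : IsW H n x₁ s₁) (π : Equiv.Perm (Fin n))
    (hx : σ x₁ = x₁) (hs : ∀ i, σ (s₁ i) = s₁ (π i)) {α : Fin n → K} (hα : ∀ i, σ (α i) = α (π i))
    {l : Fin n → O} (hl : IsLab H l) (hls : Spec l x₁ s₁) :
    cmap (σ : K →+* K) (minpoly K[X] (lin α l)) = minpoly K[X] (lin α l) := by
  set f := minpoly K[X] (lin α l) with hf
  have hInteg : IsIntegral K[X] (lin α l) := Algebra.IsIntegral.isIntegral _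
  have hfm : f.Monic := minpoly.monic hInteg
  have key : aeval (lin α l) (cmap (σ : K →+* K) f) = 0 := by
    apply zero_of_infinite (K := K) _ _ (good_infinite H hH hl)
    rintro x ⟨s₀, hs₀⟩
    obtain ⟨E, hE⟩ := exists_over (O := O) x
    refine ⟨E, hE, ?_⟩
    have hW := hl.isW hH hs₀ hE
    have h1 : Rel O H n x₁ s₁ x (fun i => E (l i)) := ⟨l, hl, hls, E, hE, fun i => rfl⟩
    have h2 := h1.frob hH (cmap_symm hσ) hs₁ hW
    have h3 := h2.comp hH π
    have e1 : σ.symm x₁ = x₁ := by rw [RingEquiv.symm_apply_eq, hx]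
    have e2 : (fun i => σ.symm (s₁ i)) ∘ π = s₁ := by
      funext i
      simp only [Function.comp_apply]
      rw [RingEquiv.symm_apply_eq, hs]
    rw [e1, e2] at h3
    obtain ⟨E', hE', h4⟩ := h3.spec hH hs₁ hl hls
    have h5 := hE'.ev f (lin α l)
    rw [hf, minpoly.aeval, map_zero, lin_map _ _ hE', ← hf] at h5
    have h6 := ev_cmap (σ : K →+* K) f (σ.symm x) (∑ i, α i * E' (l i))
    rw [h5, map_zero] at h6
    rw [← hE.ev, lin_map _ _ hE]
    convert h6 using 2
    · simp
    · simp only [map_sum, map_mul, RingEquiv.coe_toRingHom, hα, h4, Function.comp_apply, RingEquiv.apply_symm_apply]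
      exact (Equiv.sum_comp π (fun i => α i * E (l i))).symm
  have hd := minpoly.isIntegrallyClosed_dvd hInteg key
  have hm : (cmap (σ : K →+* K) f).Monic := hfm.map _
  exact (eq_of_monic_of_dvd_of_natDegree_le hfm hm hd natDegree_map_le)

theorem sep_inj (p : ℕ) [Fact p.Prime] [CharP K p] (e : ℕ) (z z' : O) (g A B : K[X][X]) (ρ : K[X])
    (h0 : aeval (z ^ p ^ e) g = 0) (h0' : aeval (z' ^ p ^ e) g = 0)
    (hAB : g * A + derivative g * B = C ρ) {E : O →+* K} {x : K} (hE : Over E x) (hx : ρ.eval x ≠ 0)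
    (h : E z = E z') : z = z' := by
  have hinj : Function.Injective ((algebraMap K[X] O).comp C) :=
    (FaithfulSMul.algebraMap_injective K[X] O).comp C_injective
  have : CharP O p := charP_of_injective_ringHom hinj p
  have : ExpChar O p := ExpChar.prime Fact.out
  set Z := z ^ p ^ e
  set Z' := z' ^ p ^ e
  suffices hZ : Z = Z' by
    apply iterateFrobenius_inj O p e
    simpa [iterateFrobenius_def] using hZ
  by_contra hne
  have hr : (g.map (algebraMap K[X] O)).IsRoot Z := by rw [IsRoot.def, eval_map]; exact h0
  obtain ⟨k, hk⟩ := dvd_iff_isRoot.2 hr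
  have h1 : eval Z' (g.map (algebraMap K[X] O)) = 0 := by rw [eval_map]; exact h0'
  rw [hk, eval_mul, eval_sub, eval_X, eval_C] at h1
  have h2 := (mul_eq_zero.1 h1).resolve_left (sub_ne_zero.2 (Ne.symm hne))
  obtain ⟨m, hm⟩ := dvd_iff_isRoot.2 (show k.IsRoot Z' from h2)
  rw [hm] at hk
  have e1 : E Z = E Z' := by simp only [Z, Z', map_pow, h]
  have hg : aeval Z g = 0 := h0
  have hg' : E (aeval Z (derivative g)) = 0 := by
    rw [aeval_def, ← eval_map, ← derivative_map, hk]
    simp [derivative_mul, e1]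
  have h3 := congrArg (fun f => E (aeval Z f)) hAB
  simp only [map_add, map_mul, hg, hg', map_zero, zero_mul, add_zero, aeval_C] at h3
  rw [hE] at h3
  exact hx h3.symm

theorem fib_bound {H : K[X][X]} {n : ℕ} (T : Finset (K × (Fin n → K))) (hT : ∀ P ∈ T, IsW H n P.1 P.2)
    (B : Finset K) (hB : ∀ P ∈ T, P.1 ∈ B) : T.card ≤ n.factorial * B.card := by
  classical
  refine Finset.card_le_mul_card_image_of_maps_to (f := Prod.fst) hB _ ?_
  intro x hx
  rcases Finset.eq_empty_or_nonempty ({P ∈ T | P.1 = x} : Finset (K × (Fin n → K))) with h | ⟨P, hP⟩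
  · rw [h]; simp
  · obtain ⟨hP1, rfl⟩ := Finset.mem_filter.1 hP
    have : ({Q ∈ T | Q.1 = P.1} : Finset (K × (Fin n → K))) ⊆
        (Finset.univ : Finset (Equiv.Perm (Fin n))).image (fun τ : Equiv.Perm (Fin n) => (P.1, P.2 ∘ τ)) := by
      intro Q hQ
      obtain ⟨h1, h2⟩ := Finset.mem_filter.1 hQ
      have h3 := hT Q h1
      rw [h2] at h3
      obtain ⟨τ, hτ⟩ := (hT P hP1).perm h3
      refine Finset.mem_image.2 ⟨τ, Finset.mem_univ _, ?_⟩
      rw [← hτ, ← h2]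
    refine (Finset.card_le_card this).trans (Finset.card_image_le.trans ?_)
    simp [Fintype.card_perm]

end
end CDM
end

section
namespace CDM
open Polynomial

theorem exists_sepmodel {F : Type} [Field F] (p : ℕ) [Fact p.Prime] [CharP F p] (N d : ℕ) (f : F[X][X]) (hm : f.Monic)
    (hi : Irreducible f) (hN : f.natDegree ≤ N) (hd : ∀ i, (f.coeff i).natDegree ≤ d) :
    ∃ (e : ℕ) (g A B : F[X][X]) (ρ : F[X]), f = expand F[X] (p ^ e) g ∧ Irreducible g ∧ g.Monic ∧
      g.natDegree ≤ N ∧ (∀ i, (g.coeff i).natDegree ≤ d) ∧ ρ ≠ 0 ∧ ρ.natDegree ≤ 2 * N * d ∧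
      g * A + derivative g * B = C ρ := by
  have hp : p.Prime := Fact.out
  have hpos : 0 < f.natDegree := by
    rcases Nat.eq_zero_or_pos f.natDegree with h | h
    · exact absurd (hm.natDegree_eq_zero.1 h ▸ hi) not_irreducible_one
    · exact h
  obtain ⟨e, g, h1, h2, h3, h4⟩ := exists_contract p N f hN hpos hi hm
  have hpe : 0 < p ^ e := Nat.pos_of_ne_zero (pow_ne_zero _ hp.ne_zero)
  have hgN : g.natDegree ≤ N := by
    refine le_trans ?_ hN
    rw [h1, natDegree_expand]
    exact Nat.le_mul_of_pos_right _ hpe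
  have hgd : ∀ i, (g.coeff i).natDegree ≤ d := by
    intro i
    have := hd (i * p ^ e)
    rwa [h1, coeff_expand_mul hpe] at this
  have hgpos : g.natDegree ≠ 0 := by
    intro h
    rw [h1, natDegree_expand, h] at hpos
    omega
  have hnd : ¬ g ∣ derivative g := by
    intro h
    have := natDegree_le_of_dvd h h4
    have := natDegree_derivative_lt hgpos
    omega
  have hdl : (derivative g).natDegree ≤ g.natDegree := (natDegree_derivative_lt hgpos).le
  have hr := resultant_ne_zero_of_not_dvd g (derivative g) h3 h2 hnd _ hdl
  obtain ⟨A, B, -, -, hAB⟩ := exists_mul_add_mul_eq_C_resultant g (derivative g) le_rfl hdl (Or.inl hgpos)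
  refine ⟨e, g, A, B, _, h1, h2, h3, hgN, hgd, hr, ?_, hAB⟩
  refine (natDegree_resultant_le g (derivative g) _ _ d d hgd ?_).trans ?_
  · intro i
    rw [coeff_derivative]
    refine natDegree_mul_le.trans ?_
    have : ((i : F[X]) + 1).natDegree = 0 := by
      have := natDegree_natCast (R := F) (i + 1)
      push_cast at this
      exact this
    rw [this]; simpa using hgd (i + 1)
  · calc _ = 2 * g.natDegree * d := by ring
      _ ≤ _ := by gcongr

theorem upper (n D d : ℕ) : ∃ Cst : ℝ, 0 ≤ Cst ∧ ∀ (K O : Type) [Field K] [IsAlgClosed K] [CommRing O] [IsDomain O]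
    [Algebra K[X] O] [Module.IsTorsionFree K[X] O] [Algebra.IsIntegral K[X] O] [Cov K O]
    (p : ℕ) [Fact p.Prime] [CharP K p] (a : ℕ) (ha : 1 ≤ a) (H : K[X][X]) (hH : H.Monic) (hD : H.natDegree = D)
    (hd : ∀ i, (H.coeff i).natDegree ≤ d) (hσ : cmap (iterateFrobenius K p a) H = H)
    (l₀ : Fin n → O) (hl₀ : IsLab H l₀) (π : Equiv.Perm (Fin n)) (x₀ : K) (s₀ : Fin n → K) (hs₀ : IsW H n x₀ s₀)
    (T : Finset (K × (Fin n → K))) (hT : ∀ P ∈ T, IsW H n P.1 P.2 ∧ Rel O H n x₀ s₀ P.1 P.2 ∧ P.1 ^ p ^ a = P.1 ∧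
      ∀ i, P.2 i ^ p ^ a = P.2 (π i)), (T.card : ℝ) ≤ (p ^ a : ℕ) + Cst * Real.sqrt (p ^ a : ℕ) := by
  classical
  obtain ⟨C₀, hC₀, hst⟩ := stepanov (D ^ n) (D ^ n * d)
  set c₁ : ℕ := n.factorial * n.factorial * n with hc₁
  set c₂ : ℕ := n.factorial * (2 * D ^ n * (D ^ n * d)) with hc₂
  refine ⟨C₀ + (n.factorial * c₁ : ℕ) + c₂, by positivity, ?_⟩
  intro K O _ _ _ _ _ _ _ _ p _ _ a ha H hH hD hd hσ l₀ hl₀ π x₀ s₀ hs₀ T hT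
  have hp : p.Prime := Fact.out
  obtain ⟨hfin, hcard⟩ := FF_card (K := K) (p := p) ha
  letI : Fintype (FF K p a) := Fintype.ofFinite _
  have hcard' : Fintype.card (FF K p a) = p ^ a := by rw [← hcard, Nat.card_eq_fintype_card]
  set q : ℕ := p ^ a with hq
  let FS : Finset K := (Finset.univ : Finset (FF K p a)).image Subtype.val
  have hFS : ∀ x, x ∈ FS ↔ x ^ q = x := by
    intro x
    simp only [FS, Finset.mem_image, Finset.mem_univ, true_and, Subtype.exists, exists_and_right, exists_eq_right, mem_FF]
    rw [← hq]; simp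
  have hFSc : FS.card = q := by
    rw [Finset.card_image_of_injective _ Subtype.val_injective, Finset.card_univ, hcard']
  have hq1 : 1 ≤ q := Nat.pos_of_ne_zero (pow_ne_zero _ hp.ne_zero)
  have hsq : 1 ≤ Real.sqrt (q : ℕ) := by
    rw [Real.one_le_sqrt]; exact_mod_cast hq1
  rcases le_or_gt q c₁ with hsmall | hbig
  · have h1 := fib_bound T (fun P hP => (hT P hP).1) FS (fun P hP => (hFS _).2 (hT P hP).2.2.1)
    rw [hFSc] at h1
    have h2 : (T.card : ℝ) ≤ (n.factorial * c₁ : ℕ) := by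
      exact_mod_cast h1.trans (Nat.mul_le_mul_left _ hsmall)
    have h3 : ((n.factorial * c₁ : ℕ) : ℝ) ≤ (n.factorial * c₁ : ℕ) * Real.sqrt (q : ℕ) :=
      le_mul_of_one_le_right (by positivity) hsq
    have h4 : 0 ≤ (C₀ + c₂) * Real.sqrt (q : ℕ) := by positivity
    have h5 : (0:ℝ) ≤ q := by positivity
    linarith
  rcases T.eq_empty_or_nonempty with rfl | ⟨⟨x₁, s₁⟩, hP₁⟩
  · simp only [Finset.card_empty, Nat.cast_zero]; positivity
  obtain ⟨hs₁, hr₁, hx₁, hπ₁⟩ := hT _ hP₁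
  simp only at hs₁ hr₁ hx₁ hπ₁
  obtain ⟨β, hβF, hβ⟩ := exists_alpha n s₁ hs₁.1 FS (by rw [hFSc]; exact hbig)
  rw [hFS] at hβF
  set α : Fin n → K := fun i => ∑ k : Fin n, β ^ (k : ℕ) * s₁ i ^ (k : ℕ) with hα
  let σ : K ≃+* K := iterateFrobeniusEquiv K p a
  have hσ1 : (σ : K →+* K) = iterateFrobenius K p a := rfl
  have hσ2 : ∀ x, σ x = x ^ q := fun x => iterateFrobenius_def _ _ _ 
  have hασ : ∀ i, σ (α i) = α (π i) := by
    intro i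
    simp only [hα, map_sum, map_mul, map_pow]
    simp only [hσ2, hβF, hπ₁]
  obtain ⟨l, hl, hls⟩ := exists_label hH hl₀ hs₁
  have hinv := minpoly_frob hH (σ := σ) (by rw [hσ1, hσ]) hs₁ π (by rw [hσ2, hx₁]) (by intro i; rw [hσ2, hπ₁]) hασ hl hls
  set z := lin α l with hz
  have hzint : IsIntegral K[X] z := Algebra.IsIntegral.isIntegral z
  set f := minpoly K[X] z with hf
  obtain ⟨hfdeg, hfx⟩ := lin_bound H hH d hd l (fun i => (hl.2 _).2 ⟨i, rfl⟩) α
  rw [hD, ← hz, ← hf] at hfdeg hfx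
  rw [xdeg_le_iff] at hfx
  have hfm : f.Monic := minpoly.monic hzint
  have hfi : Irreducible f := (minpoly.prime_of_isIntegrallyClosed hzint).irreducible
  obtain ⟨f₀, hf₀⟩ := exists_lift f (by rw [← hσ1]; exact hinv)
  have hinj : Function.Injective (mapRingHom (FF K p a).subtype) := map_injective _ Subtype.val_injective
  have hf₀m : f₀.Monic := by
    apply monic_of_injective hinj; rw [← cmap, hf₀]; exact hfm
  have hf₀i : Irreducible f₀ := hf₀m.irreducible_of_irreducible_map (mapRingHom (FF K p a).subtype) f₀ (by rw [← cmap, hf₀]; exact hfi)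
  obtain ⟨e, g, A, B, ρ, hfe, hgi, hgm, hgN, hgd, hρ0, hρd, hAB⟩ := exists_sepmodel p (D ^ n) (D ^ n * d) f₀ hf₀m hf₀i
    (by rw [← natDegree_map_eq_of_injective hinj, ← cmap, hf₀]; exact hfdeg)
    (by
      intro i
      have := hfx i
      rw [← hf₀, cmap, coeff_map, coe_mapRingHom, natDegree_map_eq_of_injective Subtype.val_injective] at this
      exact this)
  -- transfer to K
  let ι : FF K p a →+* K := (FF K p a).subtype
  have hgz : ∀ y : O, Polynomial.aeval y f = 0 → Polynomial.aeval (y ^ p ^ e) (cmap ι g) = 0 := by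
    intro y hy
    rw [← hf₀, hfe, cmap, map_expand, expand_aeval] at hy
    exact hy
  have hABK : cmap ι g * cmap ι A + derivative (cmap ι g) * cmap ι B = C (ρ.map ι) := by
    have := congrArg (cmap ι) hAB
    simpa [cmap, derivative_map] using this
  -- data for points
  have hpt : ∀ P ∈ T, ∃ E : O →+* K, Over E P.1 ∧ ∀ i, E (l i) = P.2 i := by
    intro P hP
    have h1 : Rel O H n x₁ s₁ P.1 P.2 := (hr₁.symm hH).trans hH (hT P hP).2.1 hs₀
    exact h1.spec hH hs₁ hl hls
  let U : K × (Fin n → K) → K := fun P => ∑ i, α i * P.2 i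
  have hU : ∀ P ∈ T, (U P ^ p ^ e) ^ q = U P ^ p ^ e := by
    intro P hP
    have : σ (U P) = U P := by
      simp only [U, map_sum, map_mul, hασ]
      simp only [hσ2, (hT P hP).2.2.2]
      exact Equiv.sum_comp π (fun i => α i * P.2 i)
    rw [← pow_mul, mul_comm, pow_mul, ← hσ2, this]
  -- split
  set Tb := T.filter (fun P => (ρ.map ι).eval P.1 = 0) with hTb
  set Tg := T.filter (fun P => ¬ (ρ.map ι).eval P.1 = 0) with hTg
  have hsplit : Tb.card + Tg.card = T.card := Finset.card_filter_add_card_filter_not _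
  have hρ0' : ρ.map ι ≠ 0 := (Polynomial.map_ne_zero_iff Subtype.val_injective).2 hρ0
  have hTbc : Tb.card ≤ c₂ := by
    refine (fib_bound Tb (fun P hP => (hT P (Finset.mem_filter.1 hP).1).1) (ρ.map ι).roots.toFinset ?_).trans ?_
    · intro P hP
      rw [Multiset.mem_toFinset, mem_roots hρ0']
      exact (Finset.mem_filter.1 hP).2
    · refine Nat.mul_le_mul_left _ ?_
      refine (Multiset.toFinset_card_le _).trans ((card_roots' _).trans (natDegree_map_le.trans hρd))
  let Φ : K × (Fin n → K) → FF K p a × FF K p a := fun P =>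
    (if h : P.1 ∈ FF K p a then ⟨P.1, h⟩ else 0, if h : U P ^ p ^ e ∈ FF K p a then ⟨U P ^ p ^ e, h⟩ else 0)
  have hΦ : ∀ P ∈ T, ((Φ P).1 : K) = P.1 ∧ ((Φ P).2 : K) = U P ^ p ^ e := by
    intro P hP
    have h1 : P.1 ∈ FF K p a := mem_FF.2 (hT P hP).2.2.1
    have h2 : U P ^ p ^ e ∈ FF K p a := mem_FF.2 (hU P hP)
    simp only [Φ, dif_pos h1, dif_pos h2, and_self]
  have hΦinj : Set.InjOn Φ Tg := by
    intro P hP P' hP' hPP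
    have hPT := (Finset.mem_filter.1 hP).1
    have hPT' := (Finset.mem_filter.1 hP').1
    have hρx := (Finset.mem_filter.1 hP).2
    obtain ⟨a1, a2⟩ := hΦ P hPT
    obtain ⟨b1, b2⟩ := hΦ P' hPT'
    rw [← hPP] at b1 b2
    have e1 : P.1 = P'.1 := by rw [← a1, b1]
    have e2 : U P ^ p ^ e = U P' ^ p ^ e := by rw [← a2, b2]
    have : ExpChar K p := ExpChar.prime Fact.out
    have e3 : U P = U P' := by
      apply iterateFrobenius_inj K p e
      simpa [iterateFrobenius_def] using e2
    obtain ⟨E, hE, hEs⟩ := hpt P hPT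
    obtain ⟨τ, hτ⟩ := (hT P hPT).1.perm (s' := P'.2) (by rw [e1]; exact (hT P' hPT').1)
    have hsp : Spec (l ∘ τ) P.1 P'.2 := ⟨E, hE, fun i => by rw [hτ]; simp [hEs]⟩
    have hsp' : Spec l P.1 P'.2 := by rw [e1]; exact hpt P' hPT'
    obtain ⟨γ, hγ⟩ := label_unique hH hl (hl.comp τ) (by rw [e1]; exact (hT P' hPT').1) hsp' hsp
    have hzz : z = γ z := by
      refine sep_inj p e z (γ z) (cmap ι g) (cmap ι A) (cmap ι B) (ρ.map ι) (hgz _ (minpoly.aeval _ _)) (hgz _ ?_) hABK hE hρx ?_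
      · have := Polynomial.aeval_algHom_apply (γ : O →ₐ[K[X]] O) z f
        rw [hf, minpoly.aeval, map_zero] at this
        exact this
      · rw [hz, lin_gal, lin_map _ _ hE, lin_map _ _ hE]
        simp only [← hγ, Function.comp_apply, hEs]
        have : ∀ i, P.2 (τ i) = P'.2 i := fun i => by rw [hτ]; rfl
        simp only [this]
        exact e3
    obtain ⟨E₁, hE₁, hE₁s⟩ := hls
    have h7 := congrArg E₁ hzz
    rw [hz, lin_gal, lin_map _ _ hE₁, lin_map _ _ hE₁] at h7
    simp only [← hγ, Function.comp_apply, hE₁s] at h7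
    have h8 : Equiv.refl _ = τ := hβ (Equiv.refl _) τ (by simpa using h7)
    refine Prod.ext e1 ?_
    rw [hτ, ← h8]; rfl
  have hev : ∀ (k : (FF K p a)[X][X]) (P : FF K p a × FF K p a), ((k.evalEval P.1 P.2 : FF K p a) : K) = ev (cmap ι k) P.1 P.2 := by
    intro k P
    have := ev_cmap ι k P.1 P.2
    refine Eq.trans ?_ this.symm
    show ι _ = ι _
    congr 1
    rw [ev, eval_map, eval₂_evalRingHom]
  have hTgc := hst (FF K p a) g hgm hgi hgd hgN (Tg.image Φ) (by
    intro Q hQ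
    obtain ⟨P, hP, rfl⟩ := Finset.mem_image.1 hQ
    have hPT := (Finset.mem_filter.1 hP).1
    have hρx := (Finset.mem_filter.1 hP).2
    obtain ⟨a1, a2⟩ := hΦ P hPT
    obtain ⟨E, hE, hEs⟩ := hpt P hPT
    have h1 : E (z ^ p ^ e) = U P ^ p ^ e := by
      rw [map_pow, hz, lin_map _ _ hE]
      simp only [hEs, U]
    have h2 := hE.ev (cmap ι g) (z ^ p ^ e)
    rw [hgz z (minpoly.aeval _ _), map_zero, h1] at h2
    have h3 : ev (derivative (cmap ι g)) P.1 (U P ^ p ^ e) ≠ 0 := by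
      intro h0
      apply hρx
      have h4 := congrArg (fun k => ev k P.1 (U P ^ p ^ e)) hABK
      simp only [ev, Polynomial.map_add, Polynomial.map_mul, eval_add, eval_mul, map_C, eval_C] at h4 h0 h2
      rw [h0, h2] at h4
      simpa using h4.symm
    constructor
    · apply Subtype.val_injective
      rw [hev, a1, a2, h2]; rfl
    · intro h0
      apply h3
      have := hev (derivative g) (Φ P)
      rw [h0, a1, a2] at this
      rw [show derivative (cmap ι g) = cmap ι (derivative g) by simp [cmap, derivative_map], ← this]
      rfl)
  rw [Finset.card_image_of_injOn hΦinj, hcard'] at hTgc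
  have h9 : (T.card : ℝ) = Tb.card + Tg.card := by rw [← hsplit]; push_cast; ring
  have h10 : (Tb.card : ℝ) ≤ c₂ := by exact_mod_cast hTbc
  have h11 : (c₂ : ℝ) ≤ c₂ * Real.sqrt (q : ℕ) := le_mul_of_one_le_right (by positivity) hsq
  have h12 : 0 ≤ ((n.factorial * c₁ : ℕ) : ℝ) * Real.sqrt (q : ℕ) := by positivity
  linarith
end CDM
end

section
namespace CDM
open Polynomial

section abs
variable {Γ ι : Type} [Group Γ] [Fintype Γ] [DecidableEq Γ] [DecidableEq ι]

open Classical in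
/-- abstract double counting -/
theorem sum_T (G : Finset ι) (R : Γ → ι → Γ → Prop) (ρ : ι → Γ) (g : ℕ)
    (hg : ∀ x ∈ G, ∀ κ, (Finset.univ.filter (fun τ => R τ x κ)).card = g)
    (Xp : ι → Prop) (w : Γ × Γ → Prop)
    (hw : ∀ x ∈ G, ∀ κ π τ, R τ x κ → ρ x * κ = κ * π → (w (π, τ) ↔ Xp x)) :
    ∑ t ∈ Finset.univ.filter w, ((G ×ˢ (Finset.univ : Finset Γ)).filter
      (fun y => R t.2 y.1 y.2 ∧ ρ y.1 * y.2 = y.2 * t.1)).card = g * Fintype.card Γ * (G.filter Xp).card := by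
  simp only [Finset.card_filter (fun y : ι × Γ => _)]
  rw [Finset.sum_comm, Finset.sum_product]
  have key : ∀ x ∈ G, ∑ κ : Γ, ∑ t ∈ Finset.univ.filter w, (if R t.2 x κ ∧ ρ x * κ = κ * t.1 then 1 else 0)
      = if Xp x then g * Fintype.card Γ else 0 := by
    intro x hx
    have h1 : ∀ κ : Γ, ∑ t ∈ Finset.univ.filter w, (if R t.2 x κ ∧ ρ x * κ = κ * t.1 then 1 else 0) = if Xp x then g else 0 := by
      intro κ
      rw [← Finset.card_filter]
      by_cases hX : Xp x
      · rw [if_pos hX, ← hg x hx κ]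
        refine (Finset.card_bij (fun τ _ => (κ⁻¹ * (ρ x * κ), τ)) ?_ ?_ ?_).symm
        · intro τ hτ
          simp only [Finset.mem_filter, Finset.mem_univ, true_and] at hτ ⊢
          have h2 : ρ x * κ = κ * (κ⁻¹ * (ρ x * κ)) := by group
          exact ⟨(hw x hx κ _ τ hτ h2).2 hX, hτ, h2⟩
        · intro a _ b _ h
          exact (Prod.ext_iff.1 h).2
        · rintro ⟨π, τ⟩ h
          simp only [Finset.mem_filter, Finset.mem_univ, true_and] at h
          refine ⟨τ, by simp [h.2.1], ?_⟩
          rw [h.2.2]; simp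
      · rw [if_neg hX, Finset.card_eq_zero, Finset.filter_eq_empty_iff]
        rintro ⟨π, τ⟩ h ⟨h1, h2⟩
        simp only [Finset.mem_filter, Finset.mem_univ, true_and] at h
        exact hX ((hw x hx κ π τ h1 h2).1 h)
    rw [Finset.sum_congr rfl (fun κ _ => h1 κ)]
    split_ifs <;> simp [mul_comm]
  rw [Finset.sum_congr rfl key, Finset.sum_ite, Finset.sum_const_zero, add_zero, Finset.sum_const, smul_eq_mul, mul_comm]

theorem cheb_num_lower (a q B C r γ : ℝ) (t tot : ℝ) (hB : 0 ≤ B) (hC : 0 ≤ C) (hr : 1 ≤ r) (ha : 1 ≤ a) (haγ : a ≤ γ)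
    (htot : a * (q - B) ≤ tot) (hrest : tot - t ≤ (a - 1) * (q + C * r)) : q - γ * (B + C) * r ≤ t := by
  have h1 : a * B ≤ γ * B * r := by
    calc a * B ≤ γ * B := by gcongr
      _ ≤ γ * B * r := le_mul_of_one_le_right (mul_nonneg (by linarith) hB) hr
  have h2 : (a - 1) * (C * r) ≤ γ * (C * r) := by
    have : 0 ≤ C * r := by positivity
    gcongr; linarith
  nlinarith

open Classical in
theorem cheb_abs (G : Finset ι) (R : Γ → ι → Γ → Prop) (ρ : ι → Γ) (g : ℕ) (hg0 : 1 ≤ g)  (hgc : g ≤ Fintype.card Γ)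
    (hg : ∀ x ∈ G, ∀ κ, (Finset.univ.filter (fun τ => R τ x κ)).card = g)
    (Xp : ι → Prop) (w : Γ × Γ → Prop)
    (hw : ∀ x ∈ G, ∀ κ π τ, R τ x κ → ρ x * κ = κ * π → (w (π, τ) ↔ Xp x))
    (cons : Γ × Γ → Prop) (hcons : ∀ x ∈ G, ∀ κ π τ, R τ x κ → ρ x * κ = κ * π → cons (π, τ))
    (hcc : (Finset.univ.filter cons).card = g * Fintype.card Γ)
    (q : ℕ) (r C B : ℝ) (hC : 0 ≤ C) (hB : 0 ≤ B) (hr : 1 ≤ r) (hGq : (q : ℝ) - B ≤ G.card)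
    (hT : ∀ t : Γ × Γ, (((G ×ˢ (Finset.univ : Finset Γ)).filter
      (fun y => R t.2 y.1 y.2 ∧ ρ y.1 * y.2 = y.2 * t.1)).card : ℝ) ≤ q + C * r) :
    |(g * Fintype.card Γ : ℝ) * (G.filter Xp).card - (Finset.univ.filter (fun t => cons t ∧ w t)).card * (q:ℝ)|
      ≤ (Fintype.card Γ) ^ 4 * (B + C) * r ∧
    ((Finset.univ.filter (fun t => cons t ∧ w t)).card = 0 → (G.filter Xp).card = 0) := by
  set T : Γ × Γ → ℝ := fun t => (((G ×ˢ (Finset.univ : Finset Γ)).filter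
      (fun y => R t.2 y.1 y.2 ∧ ρ y.1 * y.2 = y.2 * t.1)).card : ℝ) with hTdef
  have hT0 : ∀ t, ¬ cons t → T t = 0 := by
    rintro ⟨π, τ⟩ h
    simp only [hTdef, Nat.cast_eq_zero, Finset.card_eq_zero, Finset.filter_eq_empty_iff]
    rintro ⟨x, κ⟩ hx ⟨h1, h2⟩
    exact h (hcons x (Finset.mem_product.1 hx).1 κ π τ h1 h2)
  have hsum : ∀ (Xp : ι → Prop) (w : Γ × Γ → Prop)
    (hw : ∀ x ∈ G, ∀ κ π τ, R τ x κ → ρ x * κ = κ * π → (w (π, τ) ↔ Xp x)),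
    ∑ t ∈ Finset.univ.filter (fun t => cons t ∧ w t), T t = (g * Fintype.card Γ : ℝ) * (G.filter Xp).card := by
    intro Xp w hw
    have h1 := sum_T G R ρ g hg Xp w hw
    have h2 : ∑ t ∈ Finset.univ.filter w, T t = (g * Fintype.card Γ : ℝ) * (G.filter Xp).card := by
      simp only [hTdef]; exact_mod_cast h1
    rw [← h2]
    refine Finset.sum_subset ?_ ?_
    · intro t ht
      simp only [Finset.mem_filter, Finset.mem_univ, true_and] at ht ⊢
      exact ht.2
    · intro t ht hnt
      simp only [Finset.mem_filter, Finset.mem_univ, true_and] at ht hnt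
      exact hT0 t (fun h => hnt ⟨h, ht⟩)
  have hS := hsum Xp w hw
  have hTot := hsum (fun _ => True) (fun _ => True) (by intros; simp)
  simp only [and_true, Finset.filter_true] at hTot
  have hγ1 : (1:ℝ) ≤ Fintype.card Γ := by exact_mod_cast Fintype.card_pos (α := Γ)
  have hg1 : (1:ℝ) ≤ g := by exact_mod_cast hg0
  have hgγ : (g:ℝ) ≤ Fintype.card Γ := by exact_mod_cast hgc
  set γ : ℝ := ((Fintype.card Γ : ℕ) : ℝ) with hγ
  have hlow : ∀ t, cons t → (q:ℝ) - γ ^ 2 * (B + C) * r ≤ T t := by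
    intro t ht
    have hmem : t ∈ Finset.univ.filter cons := by simp [ht]
    have h1 := Finset.add_sum_erase _ T hmem
    have h2 : ∑ t' ∈ (Finset.univ.filter cons).erase t, T t' ≤ ((g:ℝ) * γ - 1) * (q + C * r) := by
      refine (Finset.sum_le_card_nsmul _ _ _ (fun t' _ => hT t')).trans ?_
      rw [nsmul_eq_mul, Finset.card_erase_of_mem hmem, hcc]
      have h3 : 1 ≤ g * Fintype.card Γ := Nat.mul_pos hg0 Fintype.card_pos
      rw [Nat.cast_sub h3]
      push_cast
      exact le_of_eq rfl
    refine cheb_num_lower (g * γ) q B C r (γ ^ 2) (T t) (∑ t' ∈ Finset.univ.filter cons, T t') hB hC hr ?_ ?_ ?_ ?_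
    · nlinarith
    · rw [sq]; gcongr
    · rw [hTot]; gcongr
    · linarith
  set Wf := Finset.univ.filter (fun t => cons t ∧ w t) with hWf
  have hWc : (Wf.card : ℝ) ≤ γ ^ 2 := by
    have := Finset.card_le_univ Wf
    rw [Fintype.card_prod] at this
    rw [sq, hγ]; exact_mod_cast this
  constructor
  · rw [← hS]
    have hup : ∑ t ∈ Wf, T t ≤ Wf.card * (q + C * r) := by
      have := Finset.sum_le_card_nsmul Wf T _ (fun t' _ => hT t')
      rwa [nsmul_eq_mul] at this
    have hdn : Wf.card * ((q:ℝ) - γ ^ 2 * (B + C) * r) ≤ ∑ t ∈ Wf, T t := by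
      have := Finset.card_nsmul_le_sum Wf T _ (fun t' ht' => hlow t' (by simp [hWf] at ht'; exact ht'.1))
      rwa [nsmul_eq_mul] at this
    have h5 : Wf.card * (γ ^ 2 * (B + C) * r) ≤ γ ^ 4 * (B + C) * r := by
      calc Wf.card * (γ ^ 2 * (B + C) * r) ≤ γ ^ 2 * (γ ^ 2 * (B + C) * r) := by gcongr
        _ = _ := by ring
    have h6 : Wf.card * (C * r) ≤ γ ^ 4 * (B + C) * r := by
      have : C * r ≤ γ ^ 2 * (B + C) * r := by
        have : C ≤ γ ^ 2 * (B + C) := by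
          have : (1:ℝ) ≤ γ ^ 2 := one_le_pow₀ hγ1
          nlinarith
        gcongr
      exact (mul_le_mul_of_nonneg_left this (by positivity)).trans h5
    rw [abs_le]
    constructor <;> nlinarith
  · intro h0
    rw [Finset.card_eq_zero.1 h0, Finset.sum_empty] at hS
    have := mul_eq_zero.1 hS.symm
    rcases this with h | h
    · nlinarith
    · exact_mod_cast h
end abs
end CDM
end

section
namespace CDM
open Polynomial

theorem IsW.exists_frob {K : Type} [Field K] {p : ℕ} [Fact p.Prime] [CharP K p] [IsAlgClosed K] {a : ℕ} {H : K[X][X]}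
    (hσ : cmap (iterateFrobenius K p a) H = H) {n : ℕ} {x : K} {s : Fin n → K} (hs : IsW H n x s) (hx : x ^ p ^ a = x) :
    ∃ ρ : Equiv.Perm (Fin n), ∀ i, s i ^ p ^ a = s (ρ i) := by
  have h1 := hs.frob (σ := iterateFrobeniusEquiv K p a) hσ
  have e1 : ∀ x, (iterateFrobeniusEquiv K p a) x = x ^ p ^ a := fun x => iterateFrobenius_def _ _ _
  simp only [e1, hx] at h1
  obtain ⟨τ, hτ⟩ := hs.perm h1
  exact ⟨τ, fun i => congrFun hτ i⟩

open Classical in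
theorem cheb (n D d B : ℕ) : ∃ Cst : ℝ, 0 ≤ Cst ∧ ∀ (K : Type) [Field K] [IsAlgClosed K]
    (p : ℕ) [Fact p.Prime] [CharP K p] (a : ℕ) (ha : 1 ≤ a) (H : K[X][X]) (hH : H.Monic) (hD : H.natDegree = D)
    (hd : ∀ i, (H.coeff i).natDegree ≤ d) (hσ : cmap (iterateFrobenius K p a) H = H)
    (hinf : {x | ∃ s, IsW H n x s}.Infinite) (x₀ : K) (hx₀ : x₀ ^ p ^ a = x₀) (s₀ : Fin n → K) (hs₀ : IsW H n x₀ s₀)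
    (G : Finset K) (hG : ∀ x ∈ G, x ^ p ^ a = x ∧ ∃ s, IsW H n x s) (hGc : p ^ a ≤ G.card + B)
    (Xp : K → Prop) (w : Equiv.Perm (Fin n) × Equiv.Perm (Fin n) → Prop)
    (hw : ∀ x ∈ G, ∀ (s : Fin n → K) (π τ : Equiv.Perm (Fin n)), IsW H n x s → RelE (ebd n D d) H n x₀ (s₀ ∘ τ) x s → (∀ i, s i ^ p ^ a = s (π i)) →
      (w (π, τ) ↔ Xp x)),
    let g := (Finset.univ.filter (fun τ : Equiv.Perm (Fin n) => RelE (ebd n D d) H n x₀ s₀ x₀ (s₀ ∘ τ))).card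
    let c := (Finset.univ.filter (fun t : Equiv.Perm (Fin n) × Equiv.Perm (Fin n) =>
      RelE (ebd n D d) H n x₀ (fun i => s₀ (t.2 i) ^ p ^ a) x₀ (s₀ ∘ ⇑(t.2 * t.1)) ∧ w t)).card
    1 ≤ g ∧ |((g * n.factorial : ℕ) : ℝ) * (G.filter Xp).card - c * (p ^ a : ℕ)| ≤ Cst * Real.sqrt (p ^ a : ℕ) ∧
    (c = 0 → (G.filter Xp).card = 0) := by
  obtain ⟨C₀, hC₀, hup⟩ := upper n D d
  refine ⟨(n.factorial : ℝ) ^ 4 * (B + C₀), by positivity, ?_⟩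
  intro K _ _ p _ _ a ha H hH hD hd hσ hinf x₀ hx₀ s₀ hs₀ G hG hGc Xp w hw g c
  obtain ⟨l₀, hl₀⟩ := lab_of_infinite (OO K) H hH hinf
  have hrel : ∀ {x s x' s'}, IsW H n x s → IsW H n x' s' →
      (RelE (ebd n D d) H n x s x' s' ↔ Rel (OO K) H n x s x' s') := by
    intro x s x' s' h h'
    rw [← hD]; exact relE_iff H hH d hd hl₀ h h'
  have hp : p.Prime := Fact.out
  choose! e he using fun x hx => (hG x hx).2
  choose! ρ hρ using fun x hx => (he x hx).exists_frob hσ (hG x hx).1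
  obtain ⟨ρ₀, hρ₀⟩ := hs₀.exists_frob hσ hx₀
  have hs₀c : ∀ τ : Equiv.Perm (Fin n), IsW H n x₀ (s₀ ∘ τ) := fun τ => hs₀.comp τ
  have hec : ∀ x ∈ G, ∀ τ : Equiv.Perm (Fin n), IsW H n x (e x ∘ τ) := fun x hx τ => (he x hx).comp τ
  have ecomp : ∀ {x : K} (s : Fin n → K) (τ κ : Equiv.Perm (Fin n)), (s ∘ τ) ∘ κ = s ∘ ⇑(τ * κ) := by
    intros; rfl
  -- normalisation of relations over x₀
  have hnorm : ∀ τ κ : Equiv.Perm (Fin n), Rel (OO K) H n x₀ (s₀ ∘ τ) x₀ (s₀ ∘ κ) ↔ Rel (OO K) H n x₀ s₀ x₀ (s₀ ∘ ⇑(κ * τ⁻¹)) := by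
    intro τ κ
    constructor
    · intro h
      have := h.comp hH τ⁻¹
      rw [ecomp (x := x₀), ecomp (x := x₀), mul_inv_cancel] at this
      exact this
    · intro h
      have := h.comp hH τ
      rw [ecomp (x := x₀), inv_mul_cancel_right] at this
      exact this
  have hgR : ∀ κ : Equiv.Perm (Fin n) ≃ Equiv.Perm (Fin n),
      (Finset.univ.filter (fun τ => Rel (OO K) H n x₀ s₀ x₀ (s₀ ∘ (κ τ)))).card = g := by
    intro κ
    refine Finset.card_equiv κ ?_
    intro τ
    simp only [Finset.mem_filter, Finset.mem_univ, true_and]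
    rw [hrel hs₀ (hs₀c _)]
  have hg0 : 1 ≤ g := by
    rw [Nat.succ_le_iff, Finset.card_pos]
    refine ⟨1, ?_⟩
    simp only [Finset.mem_filter, Finset.mem_univ, true_and]
    rw [hrel hs₀ (hs₀c _)]
    exact Rel.refl' hH hl₀ hs₀
  have hgc : g ≤ Fintype.card (Equiv.Perm (Fin n)) := Finset.card_le_univ _
  have hq1 : 1 ≤ p ^ a := Nat.pos_of_ne_zero (pow_ne_zero _ hp.ne_zero)
  have hcons_iff : ∀ t : Equiv.Perm (Fin n) × Equiv.Perm (Fin n),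
      RelE (ebd n D d) H n x₀ (fun i => s₀ (t.2 i) ^ p ^ a) x₀ (s₀ ∘ ⇑(t.2 * t.1)) ↔
      Rel (OO K) H n x₀ (s₀ ∘ ⇑(ρ₀ * t.2)) x₀ (s₀ ∘ ⇑(t.2 * t.1)) := by
    intro t
    have : (fun i => s₀ (t.2 i) ^ p ^ a) = s₀ ∘ ⇑(ρ₀ * t.2) := by
      funext i; simp [hρ₀]
    rw [this, hrel (hs₀c _) (hs₀c _)]
  have hmemT : ∀ x ∈ G, ∀ κ π τ : Equiv.Perm (Fin n), ρ x * κ = κ * π → ∀ i, (e x ∘ κ) i ^ p ^ a = (e x ∘ κ) (π i) := by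
    intro x hx κ π τ h i
    have := congrArg (fun f : Equiv.Perm (Fin n) => e x (f i)) h
    simpa [hρ x hx] using this
  have main := cheb_abs (Γ := Equiv.Perm (Fin n)) (ι := K) G (fun τ x κ => Rel (OO K) H n x₀ (s₀ ∘ τ) x (e x ∘ κ)) ρ g hg0 hgc
    (by
      intro x hx κ
      obtain ⟨s₁, hs₁, hr₁⟩ := Rel.exists_over hH hl₀ (hec x hx κ) hs₀
      obtain ⟨τ₁, rfl⟩ := hs₀.perm hs₁
      rw [← hgR ((Equiv.inv (Equiv.Perm (Fin n))).trans (Equiv.mulLeft τ₁))]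
      congr 1
      ext τ
      simp only [Finset.mem_filter, Finset.mem_univ, true_and]
      rw [show ((Equiv.inv (Equiv.Perm (Fin n))).trans (Equiv.mulLeft τ₁)) τ = τ₁ * τ⁻¹ from rfl, ← hnorm]
      constructor
      · intro h; exact h.trans hH hr₁ (hec x hx κ)
      · intro h; exact h.trans hH (hr₁.symm hH) hs₁)
    Xp w (by
      intro x hx κ π τ h1 h2
      exact hw x hx (e x ∘ κ) π τ (hec x hx κ) ((hrel (hs₀c _) (hec x hx κ)).2 h1) (hmemT x hx κ π τ h2))
    (fun t => RelE (ebd n D d) H n x₀ (fun i => s₀ (t.2 i) ^ p ^ a) x₀ (s₀ ∘ ⇑(t.2 * t.1)))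
    (by
      intro x hx κ π τ h1 h2
      rw [hcons_iff]
      have h3 := h1.frob hH (σ := iterateFrobeniusEquiv K p a) hσ (hs₀c _) (hec x hx κ)
      have e1 : ∀ x, (iterateFrobeniusEquiv K p a) x = x ^ p ^ a := fun x => iterateFrobenius_def _ _ _
      simp only [e1, hx₀, (hG x hx).1] at h3
      have e2 : (fun i => (s₀ ∘ τ) i ^ p ^ a) = s₀ ∘ ⇑(ρ₀ * τ) := by
        funext i; simp [hρ₀]
      have e3 : (fun i => (e x ∘ κ) i ^ p ^ a) = (e x ∘ κ) ∘ π := by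
        funext i; exact hmemT x hx κ π τ h2 i
      rw [e2, e3] at h3
      exact h3.trans hH ((h1.comp hH π).symm hH) ((hec x hx κ).comp π))
    (by
      rw [Finset.card_filter, Fintype.sum_prod_type, Finset.sum_comm]
      have : ∀ τ : Equiv.Perm (Fin n), ∑ π : Equiv.Perm (Fin n),
        (if RelE (ebd n D d) H n x₀ (fun i => s₀ (τ i) ^ p ^ a) x₀ (s₀ ∘ ⇑(τ * π)) then 1 else 0) = g := by
        intro τ
        rw [← Finset.card_filter, ← hgR ((Equiv.mulLeft τ).trans (Equiv.mulRight (ρ₀ * τ)⁻¹))]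
        congr 1
        ext π
        simp only [Finset.mem_filter, Finset.mem_univ, true_and]
        rw [hcons_iff (π, τ), hnorm]
        rfl
      rw [Finset.sum_congr rfl (fun τ _ => this τ), Finset.sum_const, smul_eq_mul, mul_comm, Finset.card_univ])
    (p ^ a) (Real.sqrt (p ^ a : ℕ)) C₀ B hC₀ (by positivity) (by rw [Real.one_le_sqrt]; exact_mod_cast hq1)
    (by
      have : ((p ^ a : ℕ) : ℝ) ≤ G.card + B := by exact_mod_cast hGc
      linarith)
    (by
      rintro ⟨π, τ⟩
      have := hup K (OO K) p a ha H hH hD hd hσ l₀ hl₀ π x₀ (s₀ ∘ τ) (hs₀c τ)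
        (((G ×ˢ (Finset.univ : Finset (Equiv.Perm (Fin n)))).filter
          (fun y => Rel (OO K) H n x₀ (s₀ ∘ τ) y.1 (e y.1 ∘ y.2) ∧ ρ y.1 * y.2 = y.2 * π)).image (fun y => (y.1, e y.1 ∘ y.2)))
        (by
          intro P hP
          obtain ⟨⟨x, κ⟩, hy, rfl⟩ := Finset.mem_image.1 hP
          obtain ⟨h1, h2, h3⟩ := Finset.mem_filter.1 hy
          have hx := (Finset.mem_product.1 h1).1
          exact ⟨hec x hx κ, h2, (hG x hx).1, hmemT x hx κ π τ h3⟩)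
      rwa [Finset.card_image_of_injOn] at this
      rintro ⟨x, κ⟩ hy ⟨x', κ'⟩ hy' h
      obtain ⟨rfl, h⟩ := Prod.ext_iff.1 h
      simp only at h
      have hx := (Finset.mem_product.1 (Finset.mem_filter.1 hy).1).1
      have : κ = κ' := by
        ext i
        have := congrFun h i
        rw [(he x hx).1 this]
      rw [this])
  refine ⟨hg0, ?_, main.2⟩
  have := main.1
  rw [Fintype.card_perm, Fintype.card_fin] at this
  push_cast at this ⊢
  exact this
end CDM
end

section
namespace CDM
open Polynomial

theorem amalg_field (k K M : Type) [Field k] [Field K] [Field M] [Algebra k K] [Algebra k M] :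
    ∃ (L : Type) (_ : Field L) (i : K →+* L) (j : M →+* L),
      i.comp (algebraMap k K) = j.comp (algebraMap k M) := by
  haveI : Nontrivial (TensorProduct k K M) :=
    Algebra.TensorProduct.nontrivial_of_algebraMap_injective_of_flat_left k K M
      (algebraMap k M).injective
  obtain ⟨m, hm⟩ := Ideal.exists_maximal (TensorProduct k K M)
  letI : Field (TensorProduct k K M ⧸ m) := Ideal.Quotient.field m
  refine ⟨_, this, (Ideal.Quotient.mk m).comp Algebra.TensorProduct.includeLeftRingHom,
    (Ideal.Quotient.mk m).comp
      (Algebra.TensorProduct.includeRight : M →ₐ[k] TensorProduct k K M).toRingHom, ?_⟩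
  ext r
  simp only [RingHom.comp_apply]
  congr 1
  change _ = (Algebra.TensorProduct.includeRight : M →ₐ[k] TensorProduct k K M) _
  rw [AlgHom.commutes]
  rfl

/-- amalgamation of two fields over a common subring image -/
theorem amalg {R K M : Type} [CommRing R] [Field K] [Field M] (u : R →+* K) (w : R →+* M)
    (h : RingHom.ker u = RingHom.ker w) :
    ∃ (L : Type) (_ : Field L) (i : K →+* L) (j : M →+* L), i.comp u = j.comp w := by
  let A := R ⧸ RingHom.ker u
  let u' : A →+* K := RingHom.kerLift u
  have hu' : Function.Injective u' := RingHom.kerLift_injective u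
  let w' : A →+* M := Ideal.Quotient.lift (RingHom.ker u) w (fun a ha => by rw [h] at ha; exact ha)
  have hw' : Function.Injective w' := by
    apply RingHom.lift_injective_of_ker_le_ideal
    exact h.ge
  haveI : (RingHom.ker u).IsPrime := RingHom.ker_isPrime u
  haveI : IsDomain A := Ideal.Quotient.isDomain _
  let k := FractionRing A
  let uk : k →+* K := IsFractionRing.lift hu'
  let wk : k →+* M := IsFractionRing.lift hw'
  letI : Algebra k K := uk.toAlgebra
  letI : Algebra k M := wk.toAlgebra
  obtain ⟨L, iL, i, j, hij⟩ := amalg_field k K M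
  refine ⟨L, iL, i, j, ?_⟩
  ext r
  simp only [RingHom.comp_apply]
  have e1 : u r = algebraMap k K (algebraMap A k (Ideal.Quotient.mk _ r)) := by
    change _ = uk _
    simp only [uk, IsFractionRing.lift_algebraMap]; rfl
  have e2 : w r = algebraMap k M (algebraMap A k (Ideal.Quotient.mk _ r)) := by
    change _ = wk _
    simp only [wk, IsFractionRing.lift_algebraMap]; rfl
  rw [e1, e2]
  exact congrArg (fun z : k →+* L => z _) hij

/-- points of one-variable constructible sets over an algebraically closed field -/
theorem exists_point {R K : Type} [CommRing R] [Field K] [IsAlgClosed K] (u : R →+* K)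
    {m : ℕ} (g : Fin m → R[X]) (f : R[X]) (Q : Ideal R[X]) (hQ : Q.IsPrime)
    (hQu : Q.comap C = RingHom.ker u) (hg : ∀ i, g i ∈ Q) (hf : f ∉ Q) :
    ∃ t : K, (∀ i, eval₂ u t (g i) = 0) ∧ eval₂ u t f ≠ 0 := by
  let B := R[X] ⧸ Q
  haveI : IsDomain B := Ideal.Quotient.isDomain _
  let M := FractionRing B
  let w0 : R[X] →+* M := (algebraMap B M).comp (Ideal.Quotient.mk Q)
  have hw0 : ∀ r, w0 r = 0 ↔ r ∈ Q := by
    intro r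
    simp only [w0, RingHom.comp_apply]
    rw [map_eq_zero_iff _ (IsFractionRing.injective B M), Ideal.Quotient.eq_zero_iff_mem]
  obtain ⟨L, _, i, j, hij⟩ := amalg u (w0.comp C) (by
    rw [← hQu]; ext r
    rw [Ideal.mem_comap, RingHom.mem_ker, RingHom.comp_apply, hw0])
  have key : ∀ r : R[X], eval₂ (i.comp u) (j (w0 X)) r = j (w0 r) := by
    intro r
    rw [hij]
    have : (eval₂RingHom (j.comp (w0.comp C)) (j (w0 X))) = j.comp w0 := by
      apply Polynomial.ringHom_ext <;> simp
    exact congrArg (fun z : R[X] →+* L => z r) this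
  have key2 : ∀ r : R[X], eval₂ i (j (w0 X)) (r.map u) = j (w0 r) := by
    intro r; rw [eval₂_map]; exact key r
  by_cases hz : ∀ k, (g k).map u = 0
  · have hf0 : f.map u ≠ 0 := by
      intro h0
      have := key2 f
      rw [h0, eval₂_zero] at this
      exact hf ((hw0 f).1 ((map_eq_zero j).1 this.symm))
    haveI : Infinite K := IsAlgClosed.instInfinite
    obtain ⟨t, ht⟩ := Polynomial.exists_eval_ne_zero_of_natDegree_lt_card (f.map u) hf0
      (lt_of_lt_of_le (Cardinal.natCast_lt_aleph0) (Cardinal.infinite_iff.1 inferInstance))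
    refine ⟨t, fun k => ?_, ?_⟩
    · rw [← eval_map, hz k, eval_zero]
    · rw [← eval_map]; exact ht
  · push Not at hz
    obtain ⟨k, hk⟩ := hz
    have hroot : eval₂ i (j (w0 X)) ((g k).map u) = 0 := by
      rw [key2, (hw0 _).2 (hg k), map_zero]
    have hs : ((g k).map u).Splits := IsAlgClosed.splits _
    obtain ⟨t, ht⟩ : ∃ t, i t = j (w0 X) := by
      have := hs.map i
      have hr : j (w0 X) ∈ (((g k).map u).map i).roots := by
        rw [mem_roots (by rwa [Ne, Polynomial.map_eq_zero]), IsRoot, eval_map]; exact hroot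
      rw [hs.roots_map i] at hr
      obtain ⟨t, -, ht⟩ := Multiset.mem_map.1 hr
      exact ⟨t, ht⟩
    have key3 : ∀ r : R[X], i (eval₂ u t r) = j (w0 r) := by
      intro r; rw [hom_eval₂, ht]; exact key r
    refine ⟨t, fun l => ?_, fun h => ?_⟩
    · apply i.injective; rw [key3, (hw0 _).2 (hg l), map_zero, map_zero]
    · have := key3 f
      rw [h, map_zero] at this
      exact hf ((hw0 f).1 ((map_eq_zero j).1 this.symm))
end CDM
end

section
namespace CDM
open Polynomial

instance factPrimes (p : Nat.Primes) : Fact (p : ℕ).Prime := ⟨p.2⟩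

/-- algebraic closure of the prime field -/
def KK (p : Nat.Primes) : Type := AlgebraicClosure (ZMod p)

noncomputable instance (p : Nat.Primes) : Field (KK p) :=
  inferInstanceAs (Field (AlgebraicClosure (ZMod p)))
instance (p : Nat.Primes) : IsAlgClosed (KK p) :=
  inferInstanceAs (IsAlgClosed (AlgebraicClosure (ZMod p)))
instance (p : Nat.Primes) : CharP (KK p) p :=
  inferInstanceAs (CharP (AlgebraicClosure (ZMod p)) p)
instance (p : Nat.Primes) : Infinite (KK p) := IsAlgClosed.instInfinite

/-- uniform predicates -/
abbrev Pred (α : Type) := ∀ p : Nat.Primes, (α → KK p) → Prop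

/-- uniform functions -/
abbrev Fn (α : Type) := ∀ p : Nat.Primes, (α → KK p) → KK p

/-- polynomial functions with integer coefficients -/
def Tm {α : Type} (f : Fn α) : Prop :=
  ∃ P : MvPolynomial α ℤ, ∀ p v, f p v = MvPolynomial.aeval v P

/-- uniformly constructible predicates -/
inductive Cons {α : Type} : Pred α → Prop
  | atom (P : MvPolynomial α ℤ) : Cons (fun p v => MvPolynomial.aeval v P = 0)
  | and {X Y : Pred α} : Cons X → Cons Y → Cons (fun p v => X p v ∧ Y p v)
  | not {X : Pred α} : Cons X → Cons (fun p v => ¬ X p v)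

section
variable {α β : Type}

theorem Tm.var (a : α) : Tm (fun p v => v a) := ⟨.X a, fun p v => by simp⟩
theorem Tm.const (z : ℤ) : Tm (α := α) (fun p v => z) := ⟨.C z, fun p v => by simp⟩
theorem Tm.zero : Tm (α := α) (fun p v => 0) := ⟨0, fun p v => by simp⟩
theorem Tm.one : Tm (α := α) (fun p v => 1) := ⟨1, fun p v => by simp⟩
theorem Tm.add {f g : Fn α} (hf : Tm f) (hg : Tm g) : Tm (fun p v => f p v + g p v) := by
  obtain ⟨P, hP⟩ := hf; obtain ⟨Q, hQ⟩ := hg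
  exact ⟨P + Q, fun p v => by simp [hP, hQ]⟩
theorem Tm.mul {f g : Fn α} (hf : Tm f) (hg : Tm g) : Tm (fun p v => f p v * g p v) := by
  obtain ⟨P, hP⟩ := hf; obtain ⟨Q, hQ⟩ := hg
  exact ⟨P * Q, fun p v => by simp [hP, hQ]⟩
theorem Tm.neg {f : Fn α} (hf : Tm f) : Tm (fun p v => - f p v) := by
  obtain ⟨P, hP⟩ := hf
  exact ⟨-P, fun p v => by simp [hP]⟩
theorem Tm.sub {f g : Fn α} (hf : Tm f) (hg : Tm g) : Tm (fun p v => f p v - g p v) := by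
  obtain ⟨P, hP⟩ := hf; obtain ⟨Q, hQ⟩ := hg
  exact ⟨P - Q, fun p v => by simp [hP, hQ]⟩
theorem Tm.pow {f : Fn α} (hf : Tm f) (n : ℕ) : Tm (fun p v => f p v ^ n) := by
  obtain ⟨P, hP⟩ := hf
  exact ⟨P ^ n, fun p v => by simp [hP]⟩
theorem Tm.sum {ι : Type} (s : Finset ι) {f : ι → Fn α} (hf : ∀ i, Tm (f i)) :
    Tm (fun p v => ∑ i ∈ s, f i p v) := by
  choose P hP using hf
  exact ⟨∑ i ∈ s, P i, fun p v => by simp [hP]⟩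
theorem Tm.poly (P : MvPolynomial β ℤ) {g : β → Fn α} (hg : ∀ b, Tm (g b)) :
    Tm (fun p v => MvPolynomial.aeval (fun b => g b p v) P) := by
  choose G hG using hg
  refine ⟨MvPolynomial.bind₁ G P, fun p v => ?_⟩
  rw [MvPolynomial.aeval_bind₁]
  simp [hG]

theorem Cons.congr {X Y : Pred α} (h : Cons X) (hXY : ∀ p v, X p v ↔ Y p v) : Cons Y := by
  have : X = Y := by funext p v; exact propext (hXY p v)
  exact this ▸ h

theorem Cons.eq {f g : Fn α} (hf : Tm f) (hg : Tm g) : Cons (fun p v => f p v = g p v) := by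
  obtain ⟨P, hP⟩ := hf.sub hg
  exact (Cons.atom P).congr fun p v => by rw [← hP, sub_eq_zero]

theorem Cons.ne {f g : Fn α} (hf : Tm f) (hg : Tm g) : Cons (fun p v => f p v ≠ g p v) :=
  (Cons.eq hf hg).not

theorem Cons.or {X Y : Pred α} (hX : Cons X) (hY : Cons Y) : Cons (fun p v => X p v ∨ Y p v) :=
  (hX.not.and hY.not).not.congr fun p v => by tauto

theorem Cons.imp {X Y : Pred α} (hX : Cons X) (hY : Cons Y) : Cons (fun p v => X p v → Y p v) :=
  (hX.and hY.not).not.congr fun p v => by tauto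

theorem Cons.iff {X Y : Pred α} (hX : Cons X) (hY : Cons Y) : Cons (fun p v => X p v ↔ Y p v) :=
  ((hX.imp hY).and (hY.imp hX)).congr fun p v => by tauto

theorem Cons.true : Cons (α := α) (fun p v => True) :=
  (Cons.eq Tm.zero Tm.zero).congr fun p v => by simp

theorem Cons.const (P : Prop) : Cons (α := α) (fun p v => P) := by
  by_cases h : P
  · exact Cons.true.congr fun p v => by simp [h]
  · exact Cons.true.not.congr fun p v => by simp [h]

theorem Cons.allF {ι : Type} [hι : Finite ι] {X : ι → Pred α} (h : ∀ i, Cons (X i)) :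
    Cons (fun p v => ∀ i, X i p v) := by
  classical
  have := Fintype.ofFinite ι
  have : ∀ s : Finset ι, Cons (fun p v => ∀ i ∈ s, X i p v) := by
    intro s
    induction s using Finset.induction_on with
    | empty => exact Cons.true.congr fun p v => by simp
    | insert a s ha ih => exact ((h a).and ih).congr fun p v => by simp
  exact (this Finset.univ).congr fun p v => by simp

theorem Cons.exF {ι : Type} [hι : Finite ι] {X : ι → Pred α} (h : ∀ i, Cons (X i)) :
    Cons (fun p v => ∃ i, X i p v) :=
  (Cons.allF fun i => (h i).not).not.congr fun p v => by simp

theorem Cons.subst {X : Pred β} (h : Cons X) {g : β → Fn α} (hg : ∀ b, Tm (g b)) :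
    Cons (fun p v => X p (fun b => g b p v)) := by
  induction h with
  | atom P => exact Cons.eq (Tm.poly P hg) Tm.zero
  | and _ _ h1 h2 => exact h1.and h2
  | not _ h1 => exact h1.not

/-- counting over a finite set of constructible predicates -/
theorem Cons.count {ι : Type} [Fintype ι] {X : ι → Pred α} (h : ∀ i, Cons (X i)) (c : ℕ) :
    Cons (fun p v => Nat.card {i // X i p v} = c) := by
  classical
  have : Cons (fun p v => ∃ s : Finset ι, s.card = c ∧ ∀ i, (X i p v ↔ i ∈ s)) :=
    Cons.exF fun s => (Cons.const _).and (Cons.allF fun i => (h i).iff (Cons.const _))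
  refine this.congr fun p v => ?_
  rw [Nat.card_eq_fintype_card, Fintype.card_subtype]
  constructor
  · rintro ⟨s, hs, h⟩; rw [← hs]; congr 1; ext i; simp [h]
  · intro h; exact ⟨_, h, fun i => by simp⟩

theorem Cons.spec {X : Pred α} (h : Cons X) :
    ∃ C : Set (PrimeSpectrum (MvPolynomial α ℤ)), Topology.IsConstructible C ∧
      ∀ p (v : α → KK p), X p v ↔ ⟨RingHom.ker (MvPolynomial.aeval v : MvPolynomial α ℤ →ₐ[ℤ] KK p).toRingHom,
        RingHom.ker_isPrime _⟩ ∈ C := by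
  induction h with
  | atom P =>
    refine ⟨(PrimeSpectrum.basicOpen P : Set _)ᶜ,
      Topology.isConstructible_compl.2 PrimeSpectrum.isConstructible_basicOpen, fun p v => ?_⟩
    simp [PrimeSpectrum.mem_basicOpen, RingHom.mem_ker]
  | and _ _ h1 h2 =>
    obtain ⟨C, hC, h1⟩ := h1
    obtain ⟨C', hC', h2⟩ := h2
    exact ⟨C ∩ C', hC.inter hC', fun p v => and_congr (h1 p v) (h2 p v)⟩
  | not _ h1 =>
    obtain ⟨C, hC, h1⟩ := h1
    exact ⟨Cᶜ, Topology.isConstructible_compl.2 hC, fun p v => not_congr (h1 p v)⟩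

theorem mem_data {R : Type} [CommRing R] (S : PrimeSpectrum.ConstructibleSetData R) (x : PrimeSpectrum R) :
    x ∈ S.toSet ↔ ∃ D ∈ S, (∀ i, D.g i ∈ x.asIdeal) ∧ D.f ∉ x.asIdeal := by
  simp only [PrimeSpectrum.ConstructibleSetData.toSet, Set.mem_iUnion,
    PrimeSpectrum.BasicConstructibleSetData.toSet, Set.mem_diff, PrimeSpectrum.mem_zeroLocus,
    Set.range_subset_iff, Set.singleton_subset_iff, SetLike.mem_coe, exists_prop]

theorem Cons.of_spec {X : Pred α} (C : Set (PrimeSpectrum (MvPolynomial α ℤ)))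
    (hC : Topology.IsConstructible C)
    (h : ∀ p (v : α → KK p), X p v ↔ ⟨RingHom.ker (MvPolynomial.aeval v : MvPolynomial α ℤ →ₐ[ℤ] KK p).toRingHom,
        RingHom.ker_isPrime _⟩ ∈ C) : Cons X := by
  obtain ⟨S, rfl⟩ := PrimeSpectrum.exists_constructibleSetData_iff.2 hC
  have : Cons (fun p v => ∃ D : S, (∀ i, MvPolynomial.aeval v (D.1.g i) = 0) ∧
      ¬ MvPolynomial.aeval v D.1.f = 0) :=
    Cons.exF fun D => (Cons.allF fun i => Cons.atom _).and (Cons.atom _).not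
  refine this.congr fun p v => ?_
  rw [h, mem_data]
  constructor
  · rintro ⟨D, h1, h2⟩
    exact ⟨D.1, D.2, by simpa [RingHom.mem_ker] using h1, by simpa [RingHom.mem_ker] using h2⟩
  · rintro ⟨D, h0, h1, h2⟩
    exact ⟨⟨D, h0⟩, by simpa [RingHom.mem_ker] using h1, by simpa [RingHom.mem_ker] using h2⟩

theorem Cons.exK {X : ∀ p, (α → KK p) → KK p → Prop}
    (h : Cons (fun p (w : Option α → KK p) => X p (fun a => w (some a)) (w none))) :
    Cons (fun p v => ∃ t, X p v t) := by
  obtain ⟨C0, hC, h⟩ := h.spec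
  let e := MvPolynomial.optionEquivLeft ℤ α
  obtain ⟨S, rfl⟩ := PrimeSpectrum.exists_constructibleSetData_iff.2 hC
  let S2 := S.map e.toRingEquiv.toRingHom
  refine Cons.of_spec _ (PrimeSpectrum.isConstructible_comap_C S2.isConstructible_toSet) fun p v => ?_
  let u := (MvPolynomial.aeval v : MvPolynomial α ℤ →ₐ[ℤ] KK p).toRingHom
  have hev : ∀ (t : KK p) (r : MvPolynomial (Option α) ℤ),
      MvPolynomial.aeval (fun o : Option α => o.elim t v) r = eval₂ u t (e r) := by
    intro t r
    have : (MvPolynomial.aeval (fun o : Option α => o.elim t v) : _ →ₐ[ℤ] KK p).toRingHom =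
        (eval₂RingHom u t).comp e.toRingEquiv.toRingHom := by
      apply MvPolynomial.ringHom_ext
      · intro z; simp
      · intro i
        cases i <;> simp [e, u, MvPolynomial.optionEquivLeft_apply]
    exact congrArg (fun z : MvPolynomial (Option α) ℤ →+* KK p => z r) this
  have hmem : ∀ t : KK p, X p v t ↔ ∃ D ∈ S, (∀ i, eval₂ u t (e (D.g i)) = 0) ∧
      eval₂ u t (e D.f) ≠ 0 := by
    intro t
    have h1 := h p (fun o : Option α => o.elim t v)
    simp only [Option.elim] at h1
    rw [h1, mem_data]
    simp only [RingHom.mem_ker]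
    have h2 := hev t
    simp only [← h2]
    rfl
  constructor
  · rintro ⟨t, ht⟩
    refine ⟨⟨RingHom.ker (eval₂RingHom u t), RingHom.ker_isPrime _⟩, ?_, ?_⟩
    · rw [PrimeSpectrum.ConstructibleSetData.toSet_map, Set.mem_preimage, mem_data]
      exact (hmem t).1 ht
    · ext r
      simp [RingHom.mem_ker, u]
  · rintro ⟨Q, hQ, hQu⟩
    rw [PrimeSpectrum.ConstructibleSetData.toSet_map, Set.mem_preimage, mem_data] at hQ
    obtain ⟨D, hD, hg, hf⟩ := hQ
    have hQu' := congrArg PrimeSpectrum.asIdeal hQu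
    obtain ⟨t, h1, h2⟩ := exists_point u (fun i => e (D.g i)) (e D.f) Q.asIdeal Q.2 hQu' hg hf
    exact ⟨t, (hmem t).2 ⟨D, hD, h1, h2⟩⟩

theorem Cons.allK {X : ∀ p, (α → KK p) → KK p → Prop}
    (h : Cons (fun p (w : Option α → KK p) => X p (fun a => w (some a)) (w none))) :
    Cons (fun p v => ∀ t, X p v t) :=
  (Cons.exK (X := fun p v t => ¬ X p v t) h.not).not.congr fun p v => by simp

theorem Cons.exFin (n : ℕ) : ∀ {α : Type} {X : ∀ p, (α → KK p) → (Fin n → KK p) → Prop},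
    Cons (fun p (w : α ⊕ Fin n → KK p) => X p (fun a => w (.inl a)) (fun i => w (.inr i))) →
    Cons (fun p v => ∃ s, X p v s) := by
  induction n with
  | zero =>
    intro α X h
    refine (h.subst (g := fun b p (v : α → KK p) => (Sum.elim v (fun i : Fin 0 => 0) b))
      (fun b => ?_)).congr fun p v => ?_
    · rcases b with a | i
      · exact Tm.var a
      · exact i.elim0
    · simp only [Sum.elim_inl, Sum.elim_inr]
      constructor
      · intro h; exact ⟨_, h⟩
      · rintro ⟨s, h⟩; convert h
  | succ n ih =>
    intro α X h
    have h1 : Cons (fun p (w : Option α → KK p) => ∃ s : Fin n → KK p,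
        X p (fun a => w (some a)) (Fin.cons (w none) s)) := by
      apply ih
      refine (h.subst (g := fun b p (v : Option α ⊕ Fin n → KK p) => (Sum.elim (fun a => v (.inl (some a)))
        (Fin.cons (v (.inl none)) (fun i => v (.inr i)) : Fin (n+1) → KK p) b)) (fun b => ?_)).congr fun p v => ?_
      · rcases b with a | i
        · exact Tm.var _
        · refine Fin.cases ?_ (fun i => ?_) i
          · simp only [Sum.elim_inr, Fin.cons_zero]; exact Tm.var _
          · simp only [Sum.elim_inr, Fin.cons_succ]; exact Tm.var _
      · rfl
    refine (Cons.exK (X := fun p v t => ∃ s : Fin n → KK p, X p v (Fin.cons t s)) h1).congr fun p v => ?_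
    constructor
    · rintro ⟨t, s, h⟩; exact ⟨_, h⟩
    · rintro ⟨s, h⟩; exact ⟨s 0, Fin.tail s, by rwa [Fin.cons_self_tail s]⟩

theorem Cons.exFun {ι : Type} [Finite ι] {X : ∀ p, (α → KK p) → (ι → KK p) → Prop}
    (h : Cons (fun p (w : α ⊕ ι → KK p) => X p (fun a => w (.inl a)) (fun i => w (.inr i)))) :
    Cons (fun p v => ∃ s, X p v s) := by
  obtain ⟨n, ⟨e⟩⟩ := Finite.exists_equiv_fin ι
  have : Cons (fun p v => ∃ s : Fin n → KK p, X p v (fun i => s (e i))) := by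
    apply Cons.exFin
    refine (h.subst (g := fun b p (v : α ⊕ Fin n → KK p) => v (Sum.map id e b)) (fun b => Tm.var _)).congr ?_
    intro p v; rfl
  refine this.congr fun p v => ?_
  constructor
  · rintro ⟨s, h⟩; exact ⟨_, h⟩
  · rintro ⟨s, h⟩; exact ⟨fun i => s (e.symm i), by simpa using h⟩

theorem Cons.allFun {ι : Type} [Finite ι] {X : ∀ p, (α → KK p) → (ι → KK p) → Prop}
    (h : Cons (fun p (w : α ⊕ ι → KK p) => X p (fun a => w (.inl a)) (fun i => w (.inr i)))) :
    Cons (fun p v => ∀ s, X p v s) :=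
  (Cons.exFun (X := fun p v t => ¬ X p v t) h.not).not.congr fun p v => by simp
end
end CDM
end

section
namespace CDM
open Polynomial

section
variable {α β : Type}

/-- evaluation homomorphism on coefficients -/
noncomputable def uu {p : Nat.Primes} (v : α → KK p) : MvPolynomial α ℤ →+* KK p :=
  (MvPolynomial.aeval v : MvPolynomial α ℤ →ₐ[ℤ] KK p).toRingHom

theorem uu_apply {p : Nat.Primes} (v : α → KK p) (P) : uu v P = MvPolynomial.aeval v P := rfl

theorem aeval_option {p : Nat.Primes} (v : Option α → KK p) (r : MvPolynomial (Option α) ℤ) :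
    MvPolynomial.aeval v r =
      eval₂ (uu (fun a => v (some a))) (v none) (MvPolynomial.optionEquivLeft ℤ α r) := by
  have : (MvPolynomial.aeval v : _ →ₐ[ℤ] KK p).toRingHom =
      (eval₂RingHom (uu (fun a => v (some a))) (v none)).comp
        (MvPolynomial.optionEquivLeft ℤ α).toRingEquiv.toRingHom := by
    apply MvPolynomial.ringHom_ext
    · intro z; simp
    · intro i
      cases i <;> simp [uu, MvPolynomial.optionEquivLeft_apply]
  exact congrArg (fun z : MvPolynomial (Option α) ℤ →+* KK p => z r) this

theorem Cons.generic {Y : Pred (Option α)} (h : Cons Y) :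
    ∃ (L : List (MvPolynomial α ℤ)[X]) (gen : Pred α), Cons gen ∧ ∀ p (w : Option α → KK p),
      (Y p w ↔ gen p (fun a => w (some a))) ∨
        ∃ h ∈ L, h.map (uu (fun a => w (some a))) ≠ 0 ∧ eval₂ (uu (fun a => w (some a))) (w none) h = 0 := by
  induction h with
  | atom P =>
    set Q := MvPolynomial.optionEquivLeft ℤ α P with hQ
    refine ⟨[Q], fun p v => ∀ i : Fin (Q.natDegree + 1), MvPolynomial.aeval v (Q.coeff i) = 0,
      Cons.allF fun i => Cons.atom _, fun p w => ?_⟩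
    have h0 : (∀ i : Fin (Q.natDegree + 1), MvPolynomial.aeval (fun a => w (some a)) (Q.coeff i) = 0) ↔
        Q.map (uu (fun a => w (some a))) = 0 := by
      constructor
      · intro h
        ext i
        rw [coeff_map, coeff_zero]
        by_cases hi : i < Q.natDegree + 1
        · exact h ⟨i, hi⟩
        · rw [coeff_eq_zero_of_natDegree_lt (by omega), map_zero]
      · intro h i
        have := congrArg (fun z => z.coeff i) h
        simpa [coeff_map, uu_apply] using this
    show (MvPolynomial.aeval w P = 0 ↔ ∀ i : Fin (Q.natDegree + 1), MvPolynomial.aeval (fun a => w (some a)) (Q.coeff i) = 0) ∨ _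
    rw [h0, aeval_option, ← hQ]
    by_cases hz : Q.map (uu (fun a => w (some a))) = 0
    · left
      rw [← eval_map, hz]; simp
    · by_cases he : eval₂ (uu (fun a => w (some a))) (w none) Q = 0
      · right; exact ⟨Q, by simp, hz, he⟩
      · left; simp [hz, he]
  | and _ _ h1 h2 =>
    obtain ⟨L, g, hg, h1⟩ := h1
    obtain ⟨L', g', hg', h2⟩ := h2
    refine ⟨L ++ L', _, hg.and hg', fun p w => ?_⟩
    rcases h1 p w with h1 | ⟨h, hL, h1⟩
    · rcases h2 p w with h2 | ⟨h, hL, h2⟩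
      · left; exact and_congr h1 h2
      · right; exact ⟨h, by simp [hL], h2⟩
    · right; exact ⟨h, by simp [hL], h1⟩
  | not _ h1 =>
    obtain ⟨L, g, hg, h1⟩ := h1
    refine ⟨L, _, hg.not, fun p w => ?_⟩
    rcases h1 p w with h1 | h1
    · left; exact not_congr h1
    · right; exact h1

theorem roots_bound {p : Nat.Primes} (v : α → KK p) (L : List (MvPolynomial α ℤ)[X]) :
    {t : KK p | ∃ h ∈ L, h.map (uu v) ≠ 0 ∧ eval₂ (uu v) t h = 0}.Finite ∧
    {t : KK p | ∃ h ∈ L, h.map (uu v) ≠ 0 ∧ eval₂ (uu v) t h = 0}.ncard ≤ (L.map natDegree).sum := by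
  classical
  induction L with
  | nil => simp
  | cons h L ih =>
    have : {t : KK p | ∃ h' ∈ h :: L, h'.map (uu v) ≠ 0 ∧ eval₂ (uu v) t h' = 0} ⊆
        ((h.map (uu v)).roots.toFinset : Set (KK p)) ∪
        {t : KK p | ∃ h ∈ L, h.map (uu v) ≠ 0 ∧ eval₂ (uu v) t h = 0} := by
      rintro t ⟨h', hm, h1, h2⟩
      rcases List.mem_cons.1 hm with rfl | hm
      · left; simp [h1, eval_map, h2]
      · right; exact ⟨h', hm, h1, h2⟩
    have hf := (Finset.finite_toSet (h.map (uu v)).roots.toFinset).union ih.1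
    refine ⟨hf.subset this, (Set.ncard_le_ncard this hf).trans ((Set.ncard_union_le _ _).trans ?_)⟩
    rw [List.map_cons, List.sum_cons, Set.ncard_coe_finset]
    refine add_le_add ?_ ih.2
    exact (Multiset.toFinset_card_le _).trans ((card_roots' _).trans natDegree_map_le)

variable {X : ∀ p, (α → KK p) → KK p → Prop}

/-- the basic uniform statement -/
theorem Cons.uniform
    (h : Cons (fun p (w : Option α → KK p) => X p (fun a => w (some a)) (w none))) :
    ∃ (L : List (MvPolynomial α ℤ)[X]) (B : ℕ), Cons (fun p v => {t | X p v t}.Infinite) ∧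
      (∀ p v, {t | X p v t}.Finite → {t | X p v t}.ncard ≤ B ∧
        ∀ t, X p v t → ∃ h ∈ L, h.map (uu v) ≠ 0 ∧ eval₂ (uu v) t h = 0) ∧
      (∀ p v, {t | X p v t}.Infinite → {t | ¬ X p v t}.Finite ∧ {t | ¬ X p v t}.ncard ≤ B) := by
  obtain ⟨L, gen, hgen, hL⟩ := h.generic
  have hL' : ∀ p (v : α → KK p) t, (X p v t ↔ gen p v) ∨
      ∃ h ∈ L, h.map (uu v) ≠ 0 ∧ eval₂ (uu v) t h = 0 := fun p v t => hL p (fun o => o.elim t v)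
  have h1 : ∀ p v, gen p v → {t | ¬ X p v t} ⊆ {t : KK p | ∃ h ∈ L, h.map (uu v) ≠ 0 ∧ eval₂ (uu v) t h = 0} := by
    intro p v hg t ht
    rcases hL' p v t with h | h
    · exact absurd (h.2 hg) ht
    · exact h
  have h2 : ∀ p v, ¬ gen p v → {t | X p v t} ⊆ {t : KK p | ∃ h ∈ L, h.map (uu v) ≠ 0 ∧ eval₂ (uu v) t h = 0} := by
    intro p v hg t ht
    rcases hL' p v t with h | h
    · exact absurd (h.1 ht) hg
    · exact h
  have h3 : ∀ p v, gen p v ↔ {t | X p v t}.Infinite := by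
    intro p v
    constructor
    · intro hg hfin
      have := hfin.union ((roots_bound v L).1.subset (h1 p v hg))
      refine Set.infinite_univ (α := KK p) (this.subset fun t _ => ?_)
      by_cases h : X p v t
      · left; exact h
      · right; exact h
    · intro hinf
      by_contra hg
      exact hinf ((roots_bound v L).1.subset (h2 p v hg))
  refine ⟨L, (L.map natDegree).sum, hgen.congr h3, fun p v hf => ?_, fun p v hinf => ?_⟩
  · have hg : ¬ gen p v := by rw [h3]; exact fun h => h hf
    exact ⟨(Set.ncard_le_ncard (h2 p v hg) (roots_bound v L).1).trans (roots_bound v L).2,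
      fun t ht => h2 p v hg ht⟩
  · have hg := (h3 p v).2 hinf
    exact ⟨(roots_bound v L).1.subset (h1 p v hg),
      (Set.ncard_le_ncard (h1 p v hg) (roots_bound v L).1).trans (roots_bound v L).2⟩

theorem Cons.exInf
    (h : Cons (fun p (w : Option α → KK p) => X p (fun a => w (some a)) (w none))) :
    Cons (fun p v => {t | X p v t}.Infinite) := by
  obtain ⟨_, _, h, _⟩ := h.uniform; exact h

theorem aeval_hom {p : Nat.Primes} (σ : KK p →+* KK p) (v : α → KK p) (P : MvPolynomial α ℤ) :
    MvPolynomial.aeval (fun a => σ (v a)) P = σ (MvPolynomial.aeval v P) := by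
  have : (MvPolynomial.aeval (fun a => σ (v a)) : MvPolynomial α ℤ →ₐ[ℤ] KK p).toRingHom =
      σ.comp (MvPolynomial.aeval v : MvPolynomial α ℤ →ₐ[ℤ] KK p).toRingHom := by
    apply MvPolynomial.ringHom_ext
    · intro z; simp
    · intro i; simp
  exact congrArg (fun z : MvPolynomial α ℤ →+* KK p => z P) this

theorem Cons.hom {Y : Pred α} (h : Cons Y) (p : Nat.Primes) (σ : KK p →+* KK p) (v : α → KK p) :
    Y p (fun a => σ (v a)) ↔ Y p v := by
  induction h with
  | atom P => simp only [aeval_hom]; exact map_eq_zero σ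
  | and _ _ h1 h2 => exact and_congr h1 h2
  | not _ h1 => exact not_congr h1

theorem Cons.frob {Y : Pred α} (h : Cons Y) (p : Nat.Primes) (a : ℕ) (v : α → KK p) :
    Y p (fun i => v i ^ (p : ℕ) ^ a) ↔ Y p v := by
  have := h.hom p (iterateFrobenius (KK p) p a) v
  simpa only [iterateFrobenius_def] using this
end
end CDM
end

section
namespace CDM
open Polynomial

section
variable {α β : Type}

theorem Tm.subst {f : Fn β} (hf : Tm f) {g : β → Fn α} (hg : ∀ b, Tm (g b)) :
    Tm (fun p v => f p (fun b => g b p v)) := by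
  obtain ⟨P, hP⟩ := hf
  obtain ⟨Q, hQ⟩ := Tm.poly P hg
  exact ⟨Q, fun p v => (hP p _).trans (hQ p v)⟩

theorem Tm.comap {f : Fn β} (hf : Tm f) (e : β → α) :
    Tm (fun p (w : α → KK p) => f p (fun b => w (e b))) := hf.subst fun b => Tm.var _

theorem Cons.comap {X : Pred β} (h : Cons X) (e : β → α) :
    Cons (fun p (w : α → KK p) => X p (fun b => w (e b))) := h.subst fun b => Tm.var _

/-- constructible family of subsets -/
def ConsS (S : ∀ p, (α → KK p) → KK p → Prop) : Prop :=
  Cons (fun p (w : Option α → KK p) => S p (fun a => w (some a)) (w none))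

def ConsV {n : ℕ} (Θ : ∀ p, (α → KK p) → (Fin n → KK p) → Prop) : Prop :=
  Cons (fun p (w : α ⊕ Fin n → KK p) => Θ p (fun a => w (.inl a)) (fun i => w (.inr i)))

theorem ConsS.at {S : ∀ p, (β → KK p) → KK p → Prop} (h : ConsS S) {g : β → Fn α}
    (hg : ∀ b, Tm (g b)) {f : Fn α} (hf : Tm f) :
    Cons (fun p v => S p (fun b => g b p v) (f p v)) := by
  have := Cons.subst h (g := fun o p v => Option.elim o (f p v) (fun b => g b p v)) (by
    intro o; cases o with
    | none => exact hf
    | some b => exact hg b)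
  exact this

theorem ConsV.at {n : ℕ} {Θ : ∀ p, (β → KK p) → (Fin n → KK p) → Prop} (h : ConsV Θ) {g : β → Fn α}
    (hg : ∀ b, Tm (g b)) {f : Fin n → Fn α} (hf : ∀ i, Tm (f i)) :
    Cons (fun p v => Θ p (fun b => g b p v) (fun i => f i p v)) := by
  have := Cons.subst h (g := fun o p v => Sum.elim (fun b => g b p v) (fun i => f i p v) o) (by
    intro o; cases o with
    | inl b => exact hg b
    | inr i => exact hf i)
  exact this

def Enum {K : Type} {n : ℕ} (S : K → Prop) (s : Fin n → K) : Prop :=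
  Function.Injective s ∧ ∀ t, S t ↔ ∃ i, s i = t

theorem Cons.inj {n : ℕ} {f : Fin n → Fn α} (hf : ∀ i, Tm (f i)) :
    Cons (fun p v => Function.Injective (fun i => f i p v)) :=
  Cons.allF fun i => Cons.allF fun j => (Cons.eq (hf i) (hf j)).imp (Cons.const _)

theorem Cons.enum {S : ∀ p, (α → KK p) → KK p → Prop} (hS : ConsS S) {n : ℕ} {f : Fin n → Fn α}
    (hf : ∀ i, Tm (f i)) : Cons (fun p v => Enum (S p v) (fun i => f i p v)) := by
  refine (Cons.inj hf).and ?_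
  apply Cons.allK (X := fun p v t => S p v t ↔ ∃ i, f i p v = t)
  exact Cons.iff hS (Cons.exF fun i => Cons.eq ((hf i).comap some) (Tm.var none))

end

abbrev WPred := ∀ p : Nat.Primes, ℕ → (ℕ → KK p) → Prop

structure Adm (N : ℕ) (p : Nat.Primes) (a : ℕ) (v : ℕ → KK p) : Prop where
  ha : 1 ≤ a
  hN : N ≤ (p : ℕ) ^ a
  hv : ∀ i, v i ^ (p : ℕ) ^ a = v i
  hd : ∀ i < N, ∀ j < N, v (2 * i) = v (2 * j) → i = j

theorem Adm.mono {N N' : ℕ} {p a v} (h : Adm N p a v) (hN : N' ≤ N) : Adm N' p a v :=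
  ⟨h.ha, hN.trans h.hN, h.hv, fun i hi j hj => h.hd i (hi.trans_le hN) j (hj.trans_le hN)⟩

theorem Adm.update {N : ℕ} {p a v} (h : Adm N p a v) {j : ℕ} (hj : Odd j) {x : KK p}
    (hx : x ^ (p : ℕ) ^ a = x) : Adm N p a (Function.update v j x) := by
  refine ⟨h.ha, h.hN, fun i => ?_, fun i hi k hk => ?_⟩
  · by_cases hij : i = j
    · subst hij; simpa using hx
    · rw [Function.update_of_ne hij]; exact h.hv i
  · have h1 : ∀ i, 2 * i ≠ j := by rintro i rfl; exact (Nat.not_odd_iff_even.2 (even_two_mul i)) hj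
    rw [Function.update_of_ne (h1 i), Function.update_of_ne (h1 k)]
    exact h.hd i hi k hk

structure IsSet (S : ∀ p, (ℕ → KK p) → KK p → Prop) : Prop where
  cons : ConsS S
  fin : ∀ p v, {t | S p v t}.Finite

abbrev Th := ∀ n : ℕ, Equiv.Perm (Fin n) → ∀ p : Nat.Primes, (ℕ → KK p) → (Fin n → KK p) → Prop

def Data (X : WPred) (S : ∀ p, (ℕ → KK p) → KK p → Prop) (Θ : Th) (N : ℕ) : Prop :=
  IsSet S ∧ (∀ n π, ConsV (Θ n π)) ∧ ∀ p a v, Adm N p a v → ∀ n π (s : Fin n → KK p), Enum (S p v) s →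
    (∀ i, s i ^ (p : ℕ) ^ a = s (π i)) → (X p a v ↔ Θ n π p v s)

def DD (X : WPred) : Prop := ∃ S Θ N, Data X S Θ N

/-- a finite Frobenius-stable set is enumerated with a permutation -/
theorem IsSet.exists_enum {S} (hS : IsSet S) {p : Nat.Primes} {a : ℕ} {v : ℕ → KK p}
    (hv : ∀ i, v i ^ (p : ℕ) ^ a = v i) :
    ∃ (n : ℕ) (s : Fin n → KK p) (π : Equiv.Perm (Fin n)), Enum (S p v) s ∧
      ∀ i, s i ^ (p : ℕ) ^ a = s (π i) := by
  have hf := hS.fin p v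
  haveI := hf.to_subtype
  let e := (Finite.equivFin {t | S p v t}).symm
  have hE : Enum (S p v) (fun i => (e i : KK p)) := by
    refine ⟨fun i j h => e.injective (Subtype.ext h), fun t => ⟨fun h => ⟨e.symm ⟨t, h⟩, congrArg Subtype.val (e.apply_symm_apply ⟨t, h⟩)⟩, ?_⟩⟩
    rintro ⟨i, rfl⟩; exact (e i).2
  have hfr : ∀ t, S p v t → S p v (t ^ (p : ℕ) ^ a) := by
    intro t ht
    have := (Cons.frob hS.cons p a (fun o => o.elim t v)).2 ht
    simpa only [Option.elim, hv] using this
  have : ∀ i, ∃ j, (e j : KK p) = (e i : KK p) ^ (p : ℕ) ^ a := fun i => (hE.2 _).1 (hfr _ (e i).2)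
  choose f hf' using this
  have hinj : Function.Injective f := by
    intro i j hij
    have h1 := hf' i
    rw [hij, hf' j] at h1
    have h2 : (iterateFrobenius (KK p) p a) (e j) = (iterateFrobenius (KK p) p a) (e i) := by
      simpa only [iterateFrobenius_def] using h1
    exact (hE.1 ((iterateFrobenius (KK p) p a).injective h2)).symm
  exact ⟨_, _, Equiv.ofBijective f (Finite.injective_iff_bijective.1 hinj), hE, fun i => (hf' i).symm⟩

def sub (S : ∀ p, (ℕ → KK p) → KK p → Prop) (Θ : Th) : Th := fun m ρ p v u =>
  ∃ n : Fin (m + 1), ∃ (ι : Fin n → Fin m) (π : Equiv.Perm (Fin n)), (∀ i, ρ (ι i) = ι (π i)) ∧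
    Enum (S p v) (fun i => u (ι i)) ∧ Θ n π p v (fun i => u (ι i))

theorem Data.sub_iff {X S Θ N} (h : Data X S Θ N) {p a v} (hA : Adm N p a v) {m : ℕ} {u : Fin m → KK p}
    {ρ : Equiv.Perm (Fin m)} (hu : Function.Injective u) (hρ : ∀ i, u i ^ (p : ℕ) ^ a = u (ρ i))
    (hS : ∀ t, S p v t → ∃ i, u i = t) : X p a v ↔ sub S Θ m ρ p v u := by
  obtain ⟨h1, h2, h3⟩ := h
  constructor
  · intro hX
    obtain ⟨n, s, π, hE, hπ⟩ := h1.exists_enum hA.hv (a := a)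
    have : ∀ i, ∃ j, u j = s i := fun i => hS _ ((hE.2 _).2 ⟨i, rfl⟩)
    choose ι hι using this
    have hs : s = fun i => u (ι i) := funext fun i => (hι i).symm
    have hι' : Function.Injective ι := by
      intro i j hij; apply hE.1; rw [← hι, ← hι, hij]
    have hn : n ≤ m := by simpa using Fintype.card_le_of_injective ι hι'
    refine ⟨⟨n, by omega⟩, ι, π, fun i => ?_, ?_, ?_⟩
    · apply hu; rw [← hρ, hι, hι, hπ]
    · rw [← hs]; exact hE
    · rw [← hs]; exact (h3 p a v hA n π s hE hπ).1 hX
  · rintro ⟨n, ι, π, h4, h5, h6⟩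
    exact (h3 p a v hA n π _ h5 fun i => by rw [hρ, h4]).2 h6

theorem ConsV.sub {S} {Θ : Th} (hS : ConsS S) (hΘ : ∀ n π, ConsV (Θ n π)) (m ρ) : ConsV (sub S Θ m ρ) := by
  unfold ConsV CDM.sub
  refine Cons.exF fun n => Cons.exF fun ι => Cons.exF fun π => (Cons.const _).and (Cons.and ?_ ?_)
  · refine (Cons.enum (S := fun p (w : ℕ ⊕ Fin m → KK p) t => S p (fun a => w (.inl a)) t) ?_
      (f := fun i p w => w (.inr (ι i))) fun i => Tm.var _)
    exact ConsS.at hS (fun b => Tm.var _) (Tm.var _)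
  · exact ConsV.at (hΘ n π) (fun b => Tm.var _) (fun i => Tm.var _)

theorem DD.congr {X Y : WPred} (hX : DD X) (N : ℕ) (h : ∀ p a v, Adm N p a v → (X p a v ↔ Y p a v)) : DD Y := by
  obtain ⟨S, Θ, N', h1, h2, h3⟩ := hX
  refine ⟨S, Θ, max N N', h1, h2, fun p a v hA n π s hE hπ => ?_⟩
  rw [← h p a v (hA.mono (le_max_left _ _)), h3 p a v (hA.mono (le_max_right _ _)) n π s hE hπ]

theorem DD.cons {X : Pred ℕ} (h : Cons X) : DD (fun p a v => X p v) :=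
  ⟨fun _ _ _ => False, fun n π p v s => X p v, 0,
    ⟨Cons.const _, fun p v => by simp⟩, fun n π => Cons.comap h _, fun p a v hA n π s hE hπ => Iff.rfl⟩

theorem DD.not {X : WPred} (h : DD X) : DD (fun p a v => ¬ X p a v) := by
  obtain ⟨S, Θ, N, h1, h2, h3⟩ := h
  exact ⟨S, fun n π p v s => ¬ Θ n π p v s, N, h1, fun n π => (h2 n π).not,
    fun p a v hA n π s hE hπ => not_congr (h3 p a v hA n π s hE hπ)⟩

theorem DD.and {X Y : WPred} (hX : DD X) (hY : DD Y) : DD (fun p a v => X p a v ∧ Y p a v) := by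
  obtain ⟨S, Θ, N, hX⟩ := hX
  obtain ⟨S', Θ', N', hY⟩ := hY
  refine ⟨fun p v t => S p v t ∨ S' p v t, fun m ρ p v u => sub S Θ m ρ p v u ∧ sub S' Θ' m ρ p v u,
    max N N', ⟨hX.1.cons.or hY.1.cons, fun p v => (hX.1.fin p v).union (hY.1.fin p v)⟩,
    fun m ρ => (ConsV.sub hX.1.cons hX.2.1 m ρ).and (ConsV.sub hY.1.cons hY.2.1 m ρ),
    fun p a v hA n π s hE hπ => and_congr ?_ ?_⟩
  · exact hX.sub_iff (hA.mono (le_max_left _ _)) hE.1 hπ fun t ht => (hE.2 t).1 (Or.inl ht)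
  · exact hY.sub_iff (hA.mono (le_max_right _ _)) hE.1 hπ fun t ht => (hE.2 t).1 (Or.inr ht)

theorem DD.or {X Y : WPred} (hX : DD X) (hY : DD Y) : DD (fun p a v => X p a v ∨ Y p a v) :=
  (hX.not.and hY.not).not.congr 0 fun p a v _ => by tauto

theorem DD.imp {X Y : WPred} (hX : DD X) (hY : DD Y) : DD (fun p a v => X p a v → Y p a v) :=
  (hX.and hY.not).not.congr 0 fun p a v _ => by tauto

theorem DD.allF {ι : Type} [Finite ι] {X : ι → WPred} (h : ∀ i, DD (X i)) :
    DD (fun p a v => ∀ i, X i p a v) := by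
  classical
  have := Fintype.ofFinite ι
  have : ∀ s : Finset ι, DD (fun p a v => ∀ i ∈ s, X i p a v) := by
    intro s
    induction s using Finset.induction_on with
    | empty => exact (DD.cons Cons.true).congr 0 fun p a v _ => by simp
    | insert b s ha ih => exact ((h b).and ih).congr 0 fun p a v _ => by simp
  exact (this Finset.univ).congr 0 fun p a v _ => by simp

theorem DD.exF {ι : Type} [Finite ι] {X : ι → WPred} (h : ∀ i, DD (X i)) :
    DD (fun p a v => ∃ i, X i p a v) :=
  (DD.allF fun i => (h i).not).not.congr 0 fun p a v _ => by simp

theorem Tm.update {α : Type} (j : ℕ) {g : ℕ → Fn α} (hg : ∀ b, Tm (g b)) {f : Fn α} (hf : Tm f) (b : ℕ) :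
    Tm (fun p v => Function.update (fun b => g b p v) j (f p v) b) := by
  by_cases h : b = j
  · subst h; simpa using hf
  · simp only [Function.update_of_ne h]; exact hg b

/-- exact counting over a finite constructible set -/
theorem DD.bad {X : WPred} (hX : DD X) {B} (hB : IsSet B) {j : ℕ} (hj : Odd j) (c : ℕ) :
    DD (fun p a v => Nat.card {x : KK p // x ^ (p : ℕ) ^ a = x ∧ B p v x ∧
      X p a (Function.update v j x)} = c) := by
  obtain ⟨S, Θ, N, hX⟩ := hX
  have hS1 : ConsS (fun p v t => ∃ x, B p v x ∧ S p (Function.update v j x) t) := by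
    apply Cons.exK (X := fun p (v : Option ℕ → KK p) x => B p (fun a => v (some a)) x ∧
      S p (Function.update (fun a => v (some a)) j x) (v none))
    refine Cons.and (hB.cons.at (fun b => Tm.var _) (Tm.var _)) ?_
    exact hX.1.cons.at (g := fun b p v => Function.update (fun a => v (some (some a))) j (v none) b)
      (fun b => Tm.update j (g := fun b p v => v (some (some b))) (fun b => Tm.var _) (Tm.var none) b) (Tm.var _)
  refine ⟨fun p v t => B p v t ∨ ∃ x, B p v x ∧ S p (Function.update v j x) t,
    fun m ρ p v u => Nat.card {i : Fin m // ρ i = i ∧ B p v (u i) ∧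
      sub S Θ m ρ p (Function.update v j (u i)) u} = c, N, ⟨hB.cons.or hS1, fun p v => ?_⟩, fun m ρ => ?_, ?_⟩
  · have : {t | B p v t ∨ ∃ x, B p v x ∧ S p (Function.update v j x) t} ⊆
        {t | B p v t} ∪ ⋃ x ∈ {t | B p v t}, {t | S p (Function.update v j x) t} := by
      rintro t (h | ⟨x, h1, h2⟩)
      · exact Or.inl h
      · right; simp only [Set.mem_iUnion]; exact ⟨x, h1, h2⟩
    exact ((hB.fin p v).union ((hB.fin p v).biUnion fun x _ => hX.1.fin p _)).subset this
  · refine Cons.count (fun i => (Cons.const _).and (Cons.and ?_ ?_)) c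
    · exact hB.cons.at (fun b => Tm.var _) (Tm.var _)
    · exact (ConsV.sub hX.1.cons hX.2.1 m ρ).at
        (g := fun b p (v : ℕ ⊕ Fin m → KK p) => Function.update (fun a => v (.inl a)) j (v (.inr i)) b)
        (fun b => Tm.update j (g := fun b p (v : ℕ ⊕ Fin m → KK p) => v (.inl b)) (fun b => Tm.var _) (Tm.var _) b) (fun i => Tm.var _)
  · intro p a v hA m ρ u hE hρ
    have key : ∀ i, ρ i = i ↔ u i ^ (p : ℕ) ^ a = u i := by
      intro i; rw [hρ]; exact hE.1.eq_iff.symm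
    have key2 : ∀ i, ρ i = i → B p v (u i) → (X p a (Function.update v j (u i)) ↔
        sub S Θ m ρ p (Function.update v j (u i)) u) := by
      intro i h1 h2
      exact hX.sub_iff (hA.update hj ((key i).1 h1)) hE.1 hρ fun t ht => (hE.2 t).1 (Or.inr ⟨_, h2, ht⟩)
    have : Nat.card {x : KK p // x ^ (p : ℕ) ^ a = x ∧ B p v x ∧ X p a (Function.update v j x)} =
        Nat.card {i : Fin m // ρ i = i ∧ B p v (u i) ∧ sub S Θ m ρ p (Function.update v j (u i)) u} := by
      symm
      refine Nat.card_eq_of_bijective (fun i => ⟨u i.1, (key _).1 i.2.1, i.2.2.1,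
        (key2 _ i.2.1 i.2.2.1).2 i.2.2.2⟩) ⟨?_, ?_⟩
      · intro i i' h
        exact Subtype.ext (hE.1 (congrArg Subtype.val h))
      · rintro ⟨x, h1, h2, h3⟩
        obtain ⟨i, rfl⟩ := (hE.2 x).1 (Or.inl h2)
        exact ⟨⟨i, (key i).2 h1, h2, (key2 i ((key i).2 h1) h2).1 h3⟩, rfl⟩
    exact ⟨fun h => this.symm.trans h, fun h => this.trans h⟩
end CDM
end

section
namespace CDM
open Polynomial

/-- specialize all variables but `j` -/
noncomputable def psi {p : Nat.Primes} (j : ℕ) (v : ℕ → KK p) : MvPolynomial ℕ ℤ →+* (KK p)[X] :=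
  (MvPolynomial.aeval (Function.update (fun i => C (v i)) j X) : MvPolynomial ℕ ℤ →ₐ[ℤ] (KK p)[X]).toRingHom

theorem eval_psi {p : Nat.Primes} (j : ℕ) (v : ℕ → KK p) (x : KK p) :
    (evalRingHom x).comp (psi j v) = uu (Function.update v j x) := by
  apply MvPolynomial.ringHom_ext
  · intro z; simp [psi, uu]
  · intro i
    by_cases h : i = j
    · subst h; simp [psi, uu]
    · simp [psi, uu, Function.update_of_ne h]

theorem eval_psi' {p : Nat.Primes} (j : ℕ) (v : ℕ → KK p) (x : KK p) (P) :
    eval x (psi j v P) = uu (Function.update v j x) P := by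
  rw [← eval_psi]; rfl

theorem exists_eval_ne {K : Type} [Field K] [Infinite K] {f : K[X]} (hf : f ≠ 0) : ∃ x, eval x f ≠ 0 := by
  by_contra h
  push Not at h
  exact hf (Polynomial.funext fun x => by simp [h])

noncomputable def mon {R : Type} [CommRing R] (P : R[X]) (D : ℕ) : R[X] :=
  X ^ D + ∑ i ∈ Finset.range D, C (P.coeff i * P.coeff D ^ (D - 1 - i)) * X ^ i

theorem mon_monic {R : Type} [CommRing R] (P : R[X]) (D : ℕ) : (mon P D).Monic := by
  apply monic_X_pow_add
  rw [degree_lt_iff_coeff_zero]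
  intro m hm
  rw [finset_sum_coeff]
  refine Finset.sum_eq_zero fun i hi => ?_
  rw [coeff_C_mul_X_pow, if_neg]
  have := Finset.mem_range.1 hi
  omega

theorem mon_eval {K R : Type} [CommRing R] [Field K] (u : R →+* K) (P : R[X]) (D : ℕ)
    (hD : ∀ i, D < i → u (P.coeff i) = 0) (hl : u (P.coeff D) ≠ 0) (t : K) (ht : eval₂ u t P = 0) :
    eval₂ u (u (P.coeff D) * t) (mon P D) = 0 := by
  have h1 : ∑ i ∈ Finset.range (D + 1), u (P.coeff i) * t ^ i = 0 := by
    rw [eval₂_eq_sum_range' u (n := P.natDegree + D + 1) (by omega)] at ht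
    rw [← ht]
    refine Finset.sum_subset (Finset.range_mono (by omega)) fun i hi hi' => ?_
    rw [hD i (by simpa using hi'), zero_mul]
  rcases Nat.eq_zero_or_pos D with rfl | hpos
  · simp at h1; exact absurd h1 hl
  rw [mon, eval₂_add, eval₂_X_pow, eval₂_finset_sum]
  have h2 : ∀ i ∈ Finset.range D, eval₂ u (u (P.coeff D) * t) (C (P.coeff i * P.coeff D ^ (D - 1 - i)) * X ^ i) =
      u (P.coeff D) ^ (D - 1) * (u (P.coeff i) * t ^ i) := by
    intro i hi
    have := Finset.mem_range.1 hi
    rw [eval₂_mul, eval₂_C, eval₂_X_pow, map_mul, map_pow]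
    have : u (P.coeff D) ^ (D - 1) = u (P.coeff D) ^ (D - 1 - i) * u (P.coeff D) ^ i := by
      rw [← pow_add]; congr 1; omega
    rw [this]; ring
  rw [Finset.sum_congr rfl h2, ← Finset.mul_sum]
  have h3 : (u (P.coeff D) * t) ^ D = u (P.coeff D) ^ (D - 1) * (u (P.coeff D) * t ^ D) := by
    have : u (P.coeff D) ^ D = u (P.coeff D) ^ (D - 1) * u (P.coeff D) := by
      rw [← pow_succ]; congr 1; omega
    rw [mul_pow, this]; ring
  rw [h3, ← mul_add, add_comm, ← Finset.sum_range_succ (fun i => u (P.coeff i) * t ^ i), h1, mul_zero]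

theorem cover {S} (hS : IsSet S) (j : ℕ) :
    ∃ (r : ℕ) (M : Fin r → (MvPolynomial ℕ ℤ)[X]) (l : Fin r → MvPolynomial ℕ ℤ), (∀ k, (M k).Monic) ∧
      ∀ p (v : ℕ → KK p), ∃ k, (∃ x, uu (Function.update v j x) (l k) ≠ 0) ∧
        ∀ x t, uu (Function.update v j x) (l k) ≠ 0 → S p (Function.update v j x) t →
          eval₂ (uu (Function.update v j x)) (uu (Function.update v j x) (l k) * t) (M k) = 0 := by
  classical
  obtain ⟨L, B, -, h, -⟩ := Cons.uniform hS.cons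
  have hL : ∀ p (v : ℕ → KK p) t, S p v t → ∃ h ∈ L, h.map (uu v) ≠ 0 ∧ eval₂ (uu v) t h = 0 :=
    fun p v => (h p v (hS.fin p v)).2
  let L' : List ((MvPolynomial ℕ ℤ)[X] × ℕ) :=
    L.sublists.flatMap fun I => (List.range (I.prod.natDegree + 1)).map fun D => (I.prod, D)
  refine ⟨L'.length, fun k => mon (L'.get k).1 (L'.get k).2, fun k => (L'.get k).1.coeff (L'.get k).2,
    fun k => mon_monic _ _, fun p v => ?_⟩
  let I := L.filter (fun h => h.map (psi j v) ≠ 0)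
  have hI0 : I.prod.map (psi j v) ≠ 0 := by
    rw [← coe_mapRingHom, map_list_prod, Ne, List.prod_eq_zero_iff, List.mem_map]
    rintro ⟨h, h1, h2⟩
    have := (List.mem_filter.1 h1).2
    simp only [coe_mapRingHom] at h2
    simp [h2] at this
  set D := (I.prod.map (psi j v)).natDegree with hD
  have hmem : (I.prod, D) ∈ L' := by
    simp only [L', List.mem_flatMap, List.mem_sublists, List.mem_map, List.mem_range]
    refine ⟨I, List.filter_sublist, D, ?_, rfl⟩
    have : D ≤ I.prod.natDegree := natDegree_map_le
    omega
  obtain ⟨k, hk⟩ := List.get_of_mem hmem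
  refine ⟨k, ?_, ?_⟩
  · simp only [hk]
    have : psi j v (I.prod.coeff D) ≠ 0 := by
      rw [← coeff_map, hD]; exact leadingCoeff_ne_zero.2 hI0
    obtain ⟨x, hx⟩ := exists_eval_ne this
    exact ⟨x, by rwa [eval_psi'] at hx⟩
  · simp only [hk]
    intro x t hl hSt
    refine mon_eval _ _ _ (fun i hi => ?_) hl t ?_
    · rw [← eval_psi', ← coeff_map, coeff_eq_zero_of_natDegree_lt hi, eval_zero]
    · obtain ⟨h, hhL, h1, h2⟩ := hL p _ t hSt
      have hhI : h ∈ I := by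
        refine List.mem_filter.2 ⟨hhL, ?_⟩
        simp only [decide_eq_true_eq]
        intro h0
        apply h1
        rw [← eval_psi, ← Polynomial.map_map, h0, Polynomial.map_zero]
      obtain ⟨c, hc⟩ := List.dvd_prod hhI
      rw [hc, eval₂_mul, h2, zero_mul]
end CDM
end

section
namespace CDM
open Polynomial

noncomputable def Hj (M : (MvPolynomial ℕ ℤ)[X]) (j : ℕ) {p : Nat.Primes} (v : ℕ → KK p) : (KK p)[X][X] :=
  M.map (psi j v)

theorem Hj_ev (M : (MvPolynomial ℕ ℤ)[X]) (j : ℕ) {p : Nat.Primes} (v : ℕ → KK p) (x t : KK p) :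
    ev (Hj M j v) x t = eval₂ (uu (Function.update v j x)) t M := by
  rw [ev, Hj, Polynomial.map_map, eval_psi, eval_map]

theorem Hj_monic {M : (MvPolynomial ℕ ℤ)[X]} (hM : M.Monic) (j : ℕ) {p : Nat.Primes} (v : ℕ → KK p) :
    (Hj M j v).Monic := hM.map _

theorem Hj_natDegree {M : (MvPolynomial ℕ ℤ)[X]} (hM : M.Monic) (j : ℕ) {p : Nat.Primes} (v : ℕ → KK p) :
    (Hj M j v).natDegree = M.natDegree := hM.natDegree_map _

noncomputable def xd (M : (MvPolynomial ℕ ℤ)[X]) : ℕ := M.support.sup fun i => (M.coeff i).totalDegree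

theorem totalDegree_map_le' {R S : Type} [CommSemiring R] [CommSemiring S] (f : R →+* S) (P : MvPolynomial ℕ R) :
    (MvPolynomial.map f P).totalDegree ≤ P.totalDegree := by
  unfold MvPolynomial.totalDegree
  exact Finset.sup_mono (MvPolynomial.support_map_subset _ _)

theorem Hj_coeff (M : (MvPolynomial ℕ ℤ)[X]) (j : ℕ) {p : Nat.Primes} (v : ℕ → KK p) (i : ℕ) :
    ((Hj M j v).coeff i).natDegree ≤ xd M := by
  rw [Hj, coeff_map]
  have h1 : (M.coeff i).totalDegree ≤ xd M := by
    by_cases h : i ∈ M.support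
    · exact Finset.le_sup (f := fun i => (M.coeff i).totalDegree) h
    · rw [notMem_support_iff.1 h]; simp
  have e : psi j v (M.coeff i) = MvPolynomial.aeval (Function.update (fun i => C (v i)) j X)
      (MvPolynomial.map (Int.castRingHom (KK p)) (M.coeff i)) := by
    generalize M.coeff i = P
    have : psi j v = ((MvPolynomial.aeval (Function.update (fun i => C (v i)) j X) :
        MvPolynomial ℕ (KK p) →ₐ[KK p] (KK p)[X]) : MvPolynomial ℕ (KK p) →+* (KK p)[X]).comp
        (MvPolynomial.map (Int.castRingHom (KK p))) := by
      apply MvPolynomial.ringHom_ext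
      · intro z; simp [psi]
      · intro i; simp [psi]
    rw [this]; rfl
  have h2 := MvPolynomial.aeval_natDegree_le (m := xd M) (n := 1) (MvPolynomial.map (Int.castRingHom (KK p)) (M.coeff i))
    ((totalDegree_map_le' _ _).trans h1)
    (Function.update (fun i => C (v i)) j X) (fun i => by
      by_cases h : i = j
      · subst h; simp
      · simp [Function.update_of_ne h])
  rw [← e, mul_one] at h2
  exact h2

theorem Hj_frob (M : (MvPolynomial ℕ ℤ)[X]) (j : ℕ) {p : Nat.Primes} {a : ℕ} (v : ℕ → KK p)
    (hv : ∀ i, v i ^ (p : ℕ) ^ a = v i) : cmap (iterateFrobenius (KK p) p a) (Hj M j v) = Hj M j v := by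
  rw [cmap, Hj, Polynomial.map_map]
  congr 1
  apply MvPolynomial.ringHom_ext
  · intro z; simp [psi]
  · intro i
    by_cases h : i = j
    · subst h; simp [psi]
    · simp [psi, Function.update_of_ne h, iterateFrobenius_def, hv]

section
variable {α : Type}

theorem Tm.uuj (P : MvPolynomial ℕ ℤ) (j : ℕ) {g : ℕ → Fn α} (hg : ∀ b, Tm (g b)) {x : Fn α} (hx : Tm x) :
    Tm (fun p v => uu (Function.update (fun b => g b p v) j (x p v)) P) :=
  Tm.poly P (g := fun b p v => Function.update (fun b => g b p v) j (x p v) b) (Tm.update j hg hx)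

theorem Tm.Hj (M : (MvPolynomial ℕ ℤ)[X]) (j : ℕ) {g : ℕ → Fn α} (hg : ∀ b, Tm (g b)) {x t : Fn α} (hx : Tm x) (ht : Tm t) :
    Tm (fun p v => ev (Hj M j (fun b => g b p v)) (x p v) (t p v)) := by
  have : (fun p v => ev (CDM.Hj M j (fun b => g b p v)) (x p v) (t p v)) =
      (fun p v => ∑ i ∈ Finset.range (M.natDegree + 1),
        uu (Function.update (fun b => g b p v) j (x p v)) (M.coeff i) * t p v ^ i) := by
    funext p v; rw [Hj_ev, eval₂_eq_sum_range]
  rw [this]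
  exact Tm.sum _ fun i => (Tm.uuj _ j hg hx).mul (ht.pow i)

theorem Cons.isW (M : (MvPolynomial ℕ ℤ)[X]) (j : ℕ) {g : ℕ → Fn α} (hg : ∀ b, Tm (g b)) {x : Fn α} (hx : Tm x)
    {n : ℕ} {s : Fin n → Fn α} (hs : ∀ i, Tm (s i)) :
    Cons (fun p v => IsW (Hj M j (fun b => g b p v)) n (x p v) (fun i => s i p v)) := by
  refine (Cons.inj hs).and ?_
  apply Cons.allK (X := fun p v t => ev (Hj M j (fun b => g b p v)) (x p v) t = 0 ↔ ∃ i, s i p v = t)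
  exact Cons.iff (Cons.eq (Tm.Hj M j (fun b => (hg b).comap some) (hx.comap some) (Tm.var none)) Tm.zero)
    (Cons.exF fun i => Cons.eq ((hs i).comap some) (Tm.var none))
end

section
variable {K : Type} [Field K]
def bev {e : ℕ} (c : Fin (e+1) × Fin (e+1) → K) (x u : K) : K := ∑ ij, c ij * x ^ (ij.2 : ℕ) * u ^ (ij.1 : ℕ)

theorem bev_iff (e : ℕ) (P : (K → K → K) → Prop) :
    (∃ f : K[X][X], BD e f ∧ P (ev f)) ↔ ∃ c : Fin (e+1) × Fin (e+1) → K, P (bev c) := by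
  constructor
  · rintro ⟨f, hf, hP⟩
    refine ⟨fun ij => (f.coeff ij.1).coeff ij.2, ?_⟩
    convert hP using 1
    funext x u
    rw [bev, ev, Fintype.sum_prod_type, eval_map, eval₂_eq_sum_range' _ (n := e+1) (by have := hf.1; omega), ← Fin.sum_univ_eq_sum_range
      (fun i => (evalRingHom x) (f.coeff i) * u ^ i)]
    refine Finset.sum_congr rfl fun i _ => ?_
    simp only []
    rw [← Finset.sum_mul]
    congr 1
    rw [coe_evalRingHom, eval_eq_sum_range' (n := e+1) (by have := hf.2 i; omega), ← Fin.sum_univ_eq_sum_range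
      (fun k => (f.coeff i).coeff k * x ^ k)]
  · rintro ⟨c, hP⟩
    refine ⟨∑ i : Fin (e+1), C (∑ k : Fin (e+1), C (c (i, k)) * X ^ (k : ℕ)) * X ^ (i : ℕ), ⟨?_, ?_⟩, ?_⟩
    · refine natDegree_sum_le_of_forall_le _ _ fun i _ => (natDegree_C_mul_X_pow_le _ _).trans (by omega)
    · intro m
      rw [finset_sum_coeff]
      refine natDegree_sum_le_of_forall_le _ _ fun i _ => ?_
      rw [coeff_C_mul_X_pow]
      split_ifs
      · exact natDegree_sum_le_of_forall_le _ _ fun i _ => (natDegree_C_mul_X_pow_le _ _).trans (by omega)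
      · simp
    · convert hP using 1
      funext x u
      rw [bev, ev, Fintype.sum_prod_type, Polynomial.map_sum, eval_finset_sum]
      refine Finset.sum_congr rfl fun i _ => ?_
      rw [Polynomial.map_mul, eval_mul, map_C, eval_C, Polynomial.map_pow, map_X, eval_pow, eval_X, coe_evalRingHom,
        eval_finset_sum, Finset.sum_mul]
      simp

theorem relE_bev (e : ℕ) (H : K[X][X]) (n : ℕ) (x : K) (s : Fin n → K) (x' : K) (s' : Fin n → K) :
    RelE e H n x s x' s' ↔ ¬ ∃ (α : Fin n → K) (c c' : Fin (e+1) × Fin (e+1) → K),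
    (∀ x'' s'', IsW H n x'' s'' → bev c x'' (∑ i, α i * s'' i) * bev c' x'' (∑ i, α i * s'' i) = 0) ∧
    bev c x (∑ i, α i * s i) ≠ 0 ∧ bev c' x' (∑ i, α i * s' i) ≠ 0 := by
  rw [RelE, not_iff_not]
  refine exists_congr fun α => ?_
  have h1 := fun f' : K[X][X] => bev_iff e (fun F => BD e f' ∧ (∀ x'' s'', IsW H n x'' s'' → F x'' (∑ i, α i * s'' i) * ev f' x'' (∑ i, α i * s'' i) = 0) ∧
    F x (∑ i, α i * s i) ≠ 0 ∧ ev f' x' (∑ i, α i * s' i) ≠ 0)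
  have h2 := fun c : Fin (e+1) × Fin (e+1) → K => bev_iff e (fun F => (∀ x'' s'', IsW H n x'' s'' → bev c x'' (∑ i, α i * s'' i) * F x'' (∑ i, α i * s'' i) = 0) ∧
    bev c x (∑ i, α i * s i) ≠ 0 ∧ F x' (∑ i, α i * s' i) ≠ 0)
  rw [exists_comm]
  refine (exists_congr h1).trans ?_
  rw [exists_comm]
  exact exists_congr h2
end

section
variable {α : Type}
theorem Tm.bev {e : ℕ} {c : Fin (e+1) × Fin (e+1) → Fn α} (hc : ∀ k, Tm (c k)) {x u : Fn α} (hx : Tm x) (hu : Tm u) :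
    Tm (fun p v => bev (fun k => c k p v) (x p v) (u p v)) :=
  Tm.sum _ fun k => ((hc k).mul (hx.pow _)).mul (hu.pow _)

theorem Cons.relE (e : ℕ) (M : (MvPolynomial ℕ ℤ)[X]) (j : ℕ) {g : ℕ → Fn α} (hg : ∀ b, Tm (g b)) {x x' : Fn α} (hx : Tm x) (hx' : Tm x')
    {n : ℕ} {s s' : Fin n → Fn α} (hs : ∀ i, Tm (s i)) (hs' : ∀ i, Tm (s' i)) :
    Cons (fun p v => RelE e (Hj M j (fun b => g b p v)) n (x p v) (fun i => s i p v) (x' p v) (fun i => s' i p v)) := by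
  simp only [relE_bev]
  apply Cons.not
  let I := Fin (e+1) × Fin (e+1)
  apply Cons.exFun (ι := Fin n) (X := fun p v A => ∃ (c c' : I → KK p),
    (∀ x'' s'', IsW (Hj M j (fun b => g b p v)) n x'' s'' → CDM.bev c x'' (∑ i, A i * s'' i) * CDM.bev c' x'' (∑ i, A i * s'' i) = 0) ∧
    CDM.bev c (x p v) (∑ i, A i * s i p v) ≠ 0 ∧ CDM.bev c' (x' p v) (∑ i, A i * s' i p v) ≠ 0)
  apply Cons.exFun (α := α ⊕ Fin n) (ι := I) (X := fun p v c => ∃ (c' : I → KK p),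
    (∀ x'' s'', IsW (Hj M j (fun b => g b p (fun a => v (.inl a)))) n x'' s'' → CDM.bev c x'' (∑ i, v (.inr i) * s'' i) * CDM.bev c' x'' (∑ i, v (.inr i) * s'' i) = 0) ∧
    CDM.bev c (x p (fun a => v (.inl a))) (∑ i, v (.inr i) * s i p (fun a => v (.inl a))) ≠ 0 ∧
      CDM.bev c' (x' p (fun a => v (.inl a))) (∑ i, v (.inr i) * s' i p (fun a => v (.inl a))) ≠ 0)
  apply Cons.exFun (α := (α ⊕ Fin n) ⊕ I) (ι := I) (X := fun p v c' =>
    (∀ x'' s'', IsW (Hj M j (fun b => g b p (fun a => v (.inl (.inl a))))) n x'' s'' →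
      CDM.bev (fun i => v (.inr i)) x'' (∑ i, v (.inl (.inr i)) * s'' i) * CDM.bev c' x'' (∑ i, v (.inl (.inr i)) * s'' i) = 0) ∧
    CDM.bev (fun i => v (.inr i)) (x p (fun a => v (.inl (.inl a)))) (∑ i, v (.inl (.inr i)) * s i p (fun a => v (.inl (.inl a)))) ≠ 0 ∧
      CDM.bev c' (x' p (fun a => v (.inl (.inl a)))) (∑ i, v (.inl (.inr i)) * s' i p (fun a => v (.inl (.inl a)))) ≠ 0)
  refine Cons.and ?_ (Cons.and (Cons.ne (Tm.bev (fun k => Tm.var _) (hx.comap _) (Tm.sum _ fun i => (Tm.var _).mul ((hs i).comap _))) Tm.zero)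
    (Cons.ne (Tm.bev (fun k => Tm.var _) (hx'.comap _) (Tm.sum _ fun i => (Tm.var _).mul ((hs' i).comap _))) Tm.zero))
  apply Cons.allK (α := ((α ⊕ Fin n) ⊕ I) ⊕ I) (X := fun p v x'' =>
    (∀ s'', IsW (Hj M j (fun b => g b p (fun a => v (.inl (.inl (.inl a)))))) n x'' s'' →
      CDM.bev (fun i => v (.inl (.inr i))) x'' (∑ i, v (.inl (.inl (.inr i))) * s'' i) * CDM.bev (fun i => v (.inr i)) x'' (∑ i, v (.inl (.inl (.inr i))) * s'' i) = 0))
  apply Cons.allFun (α := Option (((α ⊕ Fin n) ⊕ I) ⊕ I)) (ι := Fin n) (X := fun p v s'' =>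
    (IsW (Hj M j (fun b => g b p (fun a => v (some (.inl (.inl (.inl a))))))) n (v none) s'' →
      CDM.bev (fun i => v (some (.inl (.inr i)))) (v none) (∑ i, v (some (.inl (.inl (.inr i)))) * s'' i) * CDM.bev (fun i => v (some (.inr i))) (v none) (∑ i, v (some (.inl (.inl (.inr i)))) * s'' i) = 0))
  refine Cons.imp ?_ ?_
  · exact Cons.isW M j (fun b => (hg b).comap _) (Tm.var _) (fun i => Tm.var _)
  · exact Cons.eq ((Tm.bev (fun k => Tm.var _) (Tm.var _) (Tm.sum _ fun i => (Tm.var _).mul (Tm.var _))).mul (Tm.bev (fun k => Tm.var _) (Tm.var _) (Tm.sum _ fun i => (Tm.var _).mul (Tm.var _)))) Tm.zero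
end
end CDM
end

section
namespace CDM
open Polynomial

abbrev TT (n : ℕ) := ∀ p : Nat.Primes, (ℕ → KK p) → (Fin n → KK p) → Prop

theorem eval_aeval {σ τ K : Type} [Field K] (P : MvPolynomial σ ℤ) (w : σ → MvPolynomial τ K) (e : τ → K) :
    MvPolynomial.eval e (MvPolynomial.aeval w P) = MvPolynomial.aeval (fun i => MvPolynomial.eval e (w i)) P := by
  induction P using MvPolynomial.induction_on with
  | C z => simp
  | add a b h1 h2 => rw [map_add, map_add, map_add, h1, h2]
  | mul_X a i h => rw [map_mul, map_mul, map_mul, h, MvPolynomial.aeval_X, MvPolynomial.aeval_X]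

/-- dichotomy on a class -/
theorem class_generic {M : (MvPolynomial ℕ ℤ)[X]} (hM : M.Monic) (j : ℕ) {n : ℕ} {Y : Pred (ℕ ⊕ Fin n)} (hY : Cons Y)
    {p : Nat.Primes} (v : ℕ → KK p) {x : KK p} {s : Fin n → KK p} (hs : IsW (Hj M j v) n x s)
    {l₀ : Fin n → OO (KK p)} (hl₀ : IsLab (Hj M j v) l₀) :
    {x' | ∃ s', Rel (OO (KK p)) (Hj M j v) n x s x' s' ∧ Y p (Sum.elim (Function.update v j x') s')}.Finite ∨
    {x' | ∃ s', Rel (OO (KK p)) (Hj M j v) n x s x' s' ∧ ¬ Y p (Sum.elim (Function.update v j x') s')}.Finite := by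
  have hH := Hj_monic hM j v
  induction hY with
  | atom P =>
    let Q : MvPolynomial (Option (Fin n)) (KK p) := MvPolynomial.aeval
      (Sum.elim (Function.update (fun i => MvPolynomial.C (v i)) j (MvPolynomial.X none)) (fun i => MvPolynomial.X (some i))) P
    have hQ : ∀ x' s', MvPolynomial.eval (fun o => Option.elim o x' s') Q =
        MvPolynomial.aeval (Sum.elim (Function.update v j x') s') P := by
      intro x' s'
      rw [eval_aeval]
      congr 2
      funext i
      rcases i with i | i
      · by_cases h : i = j
        · subst h; simp
        · simp [Function.update_of_ne h]
      · simp
    rcases poly_generic (Hj M j v) hH hs hl₀ Q with h | h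
    · right
      convert Set.finite_empty
      ext x'
      simp only [Set.mem_setOf_eq, Set.mem_empty_iff_false, iff_false, not_exists, not_and, not_not]
      intro s' h'
      rw [← hQ]; exact h x' s' h'
    · left
      simpa only [hQ] using h
  | and _ _ h1 h2 =>
    rcases h1 with h1 | h1
    · left; exact h1.subset fun x' ⟨s', a, b⟩ => ⟨s', a, b.1⟩
    rcases h2 with h2 | h2
    · left; exact h2.subset fun x' ⟨s', a, b⟩ => ⟨s', a, b.2⟩
    right
    refine (h1.union h2).subset ?_
    rintro x' ⟨s', a, b⟩
    rcases not_and_or.1 b with b | b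
    · exact Or.inl ⟨s', a, b⟩
    · exact Or.inr ⟨s', a, b⟩
  | not _ h1 =>
    rcases h1 with h1 | h1
    · right; simpa only [not_not] using h1
    · left; exact h1

noncomputable def eb (M : (MvPolynomial ℕ ℤ)[X]) (n : ℕ) : ℕ := ebd n M.natDegree (xd M)

def Tgen (M : (MvPolynomial ℕ ℤ)[X]) (j : ℕ) {n : ℕ} (T : TT n) (p : Nat.Primes) (v : ℕ → KK p) (x : KK p) (s : Fin n → KK p) : Prop :=
  {x' | ∃ s', IsW (Hj M j v) n x' s' ∧ RelE (eb M n) (Hj M j v) n x s x' s' ∧ T p (Function.update v j x') s'}.Infinite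

theorem Cons.tgen {α : Type} (M : (MvPolynomial ℕ ℤ)[X]) (j : ℕ) {n : ℕ} {T : TT n} (hT : ConsV T)
    {g : ℕ → Fn α} (hg : ∀ b, Tm (g b)) {x : Fn α} (hx : Tm x) {s : Fin n → Fn α} (hs : ∀ i, Tm (s i)) :
    Cons (fun p v => Tgen M j T p (fun b => g b p v) (x p v) (fun i => s i p v)) := by
  apply Cons.exInf (X := fun p v x' => ∃ s', IsW (Hj M j (fun b => g b p v)) n x' s' ∧
    RelE (eb M n) (Hj M j (fun b => g b p v)) n (x p v) (fun i => s i p v) x' s' ∧ T p (Function.update (fun b => g b p v) j x') s')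
  apply Cons.exFun (ι := Fin n) (X := fun p v s' => IsW (Hj M j (fun b => g b p (fun a => v (some a)))) n (v none) s' ∧
    RelE (eb M n) (Hj M j (fun b => g b p (fun a => v (some a)))) n (x p (fun a => v (some a))) (fun i => s i p (fun a => v (some a))) (v none) s' ∧ T p (Function.update (fun b => g b p (fun a => v (some a))) j (v none)) s')
  refine Cons.and ?_ (Cons.and ?_ ?_)
  · exact Cons.isW M j (fun b => (hg b).comap _) (Tm.var _) (fun i => Tm.var _)
  · exact Cons.relE _ M j (fun b => (hg b).comap _) (hx.comap _) (Tm.var _) (fun i => (hs i).comap _) (fun i => Tm.var _)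
  · exact hT.at (g := fun b p (v : Option α ⊕ Fin n → KK p) => Function.update (fun b => g b p (fun a => v (.inl (some a)))) j (v (.inl none)) b)
      (fun b => Tm.update j (g := fun b p (v : Option α ⊕ Fin n → KK p) => g b p (fun a => v (.inl (some a)))) (fun b => (hg b).comap _) (Tm.var _) b) (fun i => Tm.var _)

section

theorem relEj {M : (MvPolynomial ℕ ℤ)[X]} (hM : M.Monic) (j : ℕ) {n : ℕ} {p : Nat.Primes} {v : ℕ → KK p}
  {l₀ : Fin n → OO (KK p)} (hl₀ : IsLab (Hj M j v) l₀) {x : KK p} {s : Fin n → KK p} {x' : KK p} {s' : Fin n → KK p} (hs : IsW (Hj M j v) n x s) (hs' : IsW (Hj M j v) n x' s') :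
    RelE (eb M n) (Hj M j v) n x s x' s' ↔ Rel (OO (KK p)) (Hj M j v) n x s x' s' := by
  rw [eb, ← Hj_natDegree hM j v]
  exact relE_iff _ (Hj_monic hM j v) _ (Hj_coeff M j v) hl₀ hs hs'

theorem Rel.isW_right {M : (MvPolynomial ℕ ℤ)[X]} (hM : M.Monic) (j : ℕ) {n : ℕ} {p : Nat.Primes} {v : ℕ → KK p}
  {l₀ : Fin n → OO (KK p)} (hl₀ : IsLab (Hj M j v) l₀) {x : KK p} {s : Fin n → KK p} {x' : KK p} {s' : Fin n → KK p} {s₁ : Fin n → KK p}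
    (h : Rel (OO (KK p)) (Hj M j v) n x s x' s') (h1 : IsW (Hj M j v) n x' s₁) : IsW (Hj M j v) n x' s' := by
  obtain ⟨l, hl, -, E, hE, hEs⟩ := h
  have := hl.isW (Hj_monic hM j v) h1 hE
  convert this using 1
  funext i; exact (hEs i).symm

theorem Tgen.congr {M : (MvPolynomial ℕ ℤ)[X]} (hM : M.Monic) (j : ℕ) {n : ℕ} {p : Nat.Primes} {v : ℕ → KK p}
  {l₀ : Fin n → OO (KK p)} (hl₀ : IsLab (Hj M j v) l₀) {T : TT n} {x : KK p} {s : Fin n → KK p} {x' : KK p} {s' : Fin n → KK p} (hs : IsW (Hj M j v) n x s)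
    (hs' : IsW (Hj M j v) n x' s') (h : Rel (OO (KK p)) (Hj M j v) n x s x' s') :
    Tgen M j T p v x s ↔ Tgen M j T p v x' s' := by
  have hH := Hj_monic hM j v
  unfold Tgen
  have : {x'' | ∃ s'', IsW (Hj M j v) n x'' s'' ∧ RelE (eb M n) (Hj M j v) n x s x'' s'' ∧ T p (Function.update v j x'') s''} =
    {x'' | ∃ s'', IsW (Hj M j v) n x'' s'' ∧ RelE (eb M n) (Hj M j v) n x' s' x'' s'' ∧ T p (Function.update v j x'') s''} := by
    ext x''
    refine exists_congr fun s'' => and_congr_right fun h'' => and_congr_left fun _ => ?_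
    rw [relEj hM j hl₀ hs h'', relEj hM j hl₀ hs' h'']
    exact ⟨fun h3 => (h.symm hH).trans hH h3 hs, fun h3 => h.trans hH h3 hs'⟩
  rw [this]

theorem Tgen.exceptions {M : (MvPolynomial ℕ ℤ)[X]} (hM : M.Monic) (j : ℕ) {n : ℕ} {p : Nat.Primes} {v : ℕ → KK p}
  {l₀ : Fin n → OO (KK p)} (hl₀ : IsLab (Hj M j v) l₀) {T : TT n} (hT : ConsV T) {x : KK p} {s : Fin n → KK p} (hs : IsW (Hj M j v) n x s) :
    {x' | ∃ s', IsW (Hj M j v) n x' s' ∧ Rel (OO (KK p)) (Hj M j v) n x s x' s' ∧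
      ¬ (T p (Function.update v j x') s' ↔ Tgen M j T p v x' s')}.Finite := by
  have key : ∀ x' s', IsW (Hj M j v) n x' s' → Rel (OO (KK p)) (Hj M j v) n x s x' s' →
      (Tgen M j T p v x' s' ↔ Tgen M j T p v x s) := fun x' s' h1 h2 => (Tgen.congr hM j hl₀ hs h1 h2).symm
  have e : ∀ x' s', T p (Function.update v j x') s' ↔
    (fun p (w : ℕ ⊕ Fin n → KK p) => T p (fun a => w (.inl a)) (fun i => w (.inr i))) p (Sum.elim (Function.update v j x') s') :=
    fun x' s' => Iff.rfl
  rcases class_generic hM j hT v hs hl₀ with h | h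
  · have : ¬ Tgen M j T p v x s := by
      unfold Tgen
      rw [Set.not_infinite]
      refine h.subset ?_
      rintro x' ⟨s', h1, h2, h3⟩
      exact ⟨s', (relEj hM j hl₀ hs h1).1 h2, h3⟩
    refine h.subset ?_
    rintro x' ⟨s', h1, h2, h3⟩
    rw [key x' s' h1 h2] at h3
    exact ⟨s', h2, by_contra fun h4 => h3 ⟨fun h5 => absurd h5 h4, fun h5 => absurd h5 this⟩⟩
  · by_cases h0 : Tgen M j T p v x s
    · refine h.subset ?_
      rintro x' ⟨s', h1, h2, h3⟩
      rw [key x' s' h1 h2] at h3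
      exact ⟨s', h2, fun h5 => h3 ⟨fun _ => h0, fun _ => h5⟩⟩
    · unfold Tgen at h0
      rw [Set.not_infinite] at h0
      refine h0.subset ?_
      rintro x' ⟨s', h1, h2, h3⟩
      have h0' : ¬ Tgen M j T p v x s := by unfold Tgen; rw [Set.not_infinite]; exact h0
      rw [key x' s' h1 h2] at h3
      exact ⟨s', h1, (relEj hM j hl₀ hs h1).2 h2, by_contra fun h4 => h3 ⟨fun h5 => absurd h5 h4, fun h5 => absurd h5 h0'⟩⟩
end

def Good (M : (MvPolynomial ℕ ℤ)[X]) (j : ℕ) (l : MvPolynomial ℕ ℤ) {n : ℕ} (T : Equiv.Perm (Fin n) → TT n)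
    (p : Nat.Primes) (v : ℕ → KK p) (x : KK p) : Prop :=
  uu (Function.update v j x) l ≠ 0 ∧ (∃ s, IsW (Hj M j v) n x s) ∧
    ∀ π, ∀ s, IsW (Hj M j v) n x s → (T π p (Function.update v j x) s ↔ Tgen M j (T π) p v x s)

theorem Good.cons (M : (MvPolynomial ℕ ℤ)[X]) (j : ℕ) (l : MvPolynomial ℕ ℤ) {n : ℕ} {T : Equiv.Perm (Fin n) → TT n}
    (hT : ∀ π, ConsV (T π)) : ConsS (Good M j l T) := by
  refine Cons.and ?_ (Cons.and ?_ ?_)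
  · exact Cons.ne (Tm.uuj l j (fun b => Tm.var _) (Tm.var _)) Tm.zero
  · apply Cons.exFun (X := fun p (w : Option ℕ → KK p) s => IsW (Hj M j (fun a => w (some a))) n (w none) s)
    exact Cons.isW M j (fun b => Tm.var _) (Tm.var _) (fun i => Tm.var _)
  · refine Cons.allF fun π => ?_
    apply Cons.allFun (X := fun p (w : Option ℕ → KK p) s => IsW (Hj M j (fun a => w (some a))) n (w none) s →
      (T π p (Function.update (fun a => w (some a)) j (w none)) s ↔ Tgen M j (T π) p (fun a => w (some a)) (w none) s))
    refine Cons.imp ?_ (Cons.iff ?_ ?_)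
    · exact Cons.isW M j (fun b => Tm.var _) (Tm.var _) (fun i => Tm.var _)
    · exact (hT π).at (g := fun b p (v : Option ℕ ⊕ Fin n → KK p) => Function.update (fun b => v (.inl (some b))) j (v (.inl none)) b)
        (fun b => Tm.update j (g := fun b p (v : Option ℕ ⊕ Fin n → KK p) => v (.inl (some b))) (fun b => Tm.var _) (Tm.var _) b) (fun i => Tm.var _)
    · exact Cons.tgen M j (hT π) (fun b => Tm.var _) (Tm.var _) (fun i => Tm.var _)

theorem W_cons (M : (MvPolynomial ℕ ℤ)[X]) (j n : ℕ) : ConsS (fun p v x => ∃ s, IsW (Hj M j v) n x s) := by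
  apply Cons.exFun (X := fun p (w : Option ℕ → KK p) s => IsW (Hj M j (fun a => w (some a))) n (w none) s)
  exact Cons.isW M j (fun b => Tm.var _) (Tm.var _) (fun i => Tm.var _)

theorem Good.cofinite {M : (MvPolynomial ℕ ℤ)[X]} (hM : M.Monic) (j : ℕ) (l : MvPolynomial ℕ ℤ) {n : ℕ} {T : Equiv.Perm (Fin n) → TT n}
    (hT : ∀ π, ConsV (T π)) {p : Nat.Primes} {v : ℕ → KK p} (hl : ∃ x, uu (Function.update v j x) l ≠ 0)
    (hinf : {x | ∃ s, IsW (Hj M j v) n x s}.Infinite) : {x | ¬ Good M j l T p v x}.Finite := by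
  classical
  have hH := Hj_monic hM j v
  have h1 : {x | uu (Function.update v j x) l = 0}.Finite := by
    have h0 : psi j v l ≠ 0 := by
      rintro h; obtain ⟨x, hx⟩ := hl; rw [← eval_psi', h] at hx; simp at hx
    refine ((psi j v l).roots.toFinset.finite_toSet).subset ?_
    intro x hx
    simp only [Set.mem_setOf_eq] at hx
    rw [← eval_psi'] at hx
    simp [h0, hx]
  obtain ⟨_, _, -, -, h2⟩ := Cons.uniform (X := fun p v x => ∃ s, IsW (Hj M j v) n x s) (W_cons M j n)
  have h2 := (h2 p v hinf).1
  obtain ⟨l₀, hl₀⟩ := lab_of_infinite (OO (KK p)) _ hH hinf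
  obtain ⟨x₁, s₁, hs₁⟩ := hinf.nonempty
  have h3 : (⋃ π, ⋃ τ : Equiv.Perm (Fin n), {x' | ∃ s', IsW (Hj M j v) n x' s' ∧ Rel (OO (KK p)) (Hj M j v) n x₁ (s₁ ∘ τ) x' s' ∧
      ¬ (T π p (Function.update v j x') s' ↔ Tgen M j (T π) p v x' s')}).Finite :=
    Set.finite_iUnion fun π => Set.finite_iUnion fun τ => Tgen.exceptions hM j hl₀ (hT π) (hs₁.comp τ)
  refine ((h1.union h2).union h3).subset ?_
  intro x hx
  simp only [Set.mem_setOf_eq, Good] at hx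
  by_cases hx1 : uu (Function.update v j x) l = 0
  · exact Or.inl (Or.inl hx1)
  by_cases hx2 : ∃ s, IsW (Hj M j v) n x s
  · right
    have : ¬ ∀ π, ∀ s, IsW (Hj M j v) n x s → (T π p (Function.update v j x) s ↔ Tgen M j (T π) p v x s) :=
      fun h => hx ⟨hx1, hx2, h⟩
    push Not at this
    obtain ⟨π, s, hs, hne⟩ := this
    obtain ⟨s'', hs'', hr⟩ := Rel.exists_over hH hl₀ hs hs₁
    obtain ⟨τ, hτ⟩ := hs₁.perm hs''
    simp only [Set.mem_iUnion]
    refine ⟨π, τ, s, hs, ?_, ?_⟩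
    · rw [← hτ]; exact hr.symm hH
    · intro h; rcases hne with h' | h' <;> tauto
  · exact Or.inl (Or.inr hx2)
end CDM
end

section
namespace CDM
open Polynomial

theorem DD.root {S} (hS : IsSet S) {P : Th} (hP : ∀ n ρ, ConsV (P n ρ)) (n : ℕ) :
    DD (fun p a v => ∃ (s : Fin n → KK p) (ρ : Equiv.Perm (Fin n)), Enum (S p v) s ∧
      (∀ i, s i ^ (p : ℕ) ^ a = s (ρ i)) ∧ P n ρ p v s) := by
  refine ⟨S, fun m ρ p v s => m = n ∧ ∃ σ : Equiv.Perm (Fin m), P m (σ⁻¹ * ρ * σ) p v (fun i => s (σ i)), 0, hS, ?_, ?_⟩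
  · intro m ρ
    refine (Cons.const _).and (Cons.exF fun σ => ?_)
    exact (hP m _).at (fun b => Tm.var _) (fun i => Tm.var _)
  · intro p a v hA m ρ s hE hρ
    constructor
    · rintro ⟨s', ρ', hE', hρ', hP'⟩
      have hc : ∀ {m n : ℕ} {s : Fin m → KK p} {s' : Fin n → KK p}, Enum (S p v) s → Enum (S p v) s' →
          ∃ f : Fin n → Fin m, Function.Injective f ∧ ∀ i, s' i = s (f i) := by
        intro m n s s' hE hE'
        choose f hf using fun i => (hE.2 (s' i)).1 ((hE'.2 _).2 ⟨i, rfl⟩)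
        refine ⟨f, fun i i' h => hE'.1 (by rw [← hf, ← hf, h]), fun i => (hf i).symm⟩
      obtain ⟨f, hf, hfs⟩ := hc hE hE'
      obtain ⟨f', hf', -⟩ := hc hE' hE
      have h1 : n ≤ m := by simpa using Fintype.card_le_of_injective f hf
      have h2 : m ≤ n := by simpa using Fintype.card_le_of_injective f' hf'
      obtain rfl : m = n := le_antisymm h2 h1
      let σ := Equiv.ofBijective f (Finite.injective_iff_bijective.1 hf)
      have hσ : ∀ i, s' i = s (σ i) := hfs
      refine ⟨rfl, σ, ?_⟩
      have e1 : σ⁻¹ * ρ * σ = ρ' := by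
        ext i
        congr 1
        apply hE'.1
        rw [← hρ', hσ, hσ]
        simp [hρ]
      have e2 : (fun i => s (σ i)) = s' := funext fun i => (hσ i).symm
      rw [e1, e2]; exact hP'
    · rintro ⟨rfl, σ, hP'⟩
      refine ⟨fun i => s (σ i), σ⁻¹ * ρ * σ, ⟨hE.1.comp σ.injective, fun t => ?_⟩, fun i => ?_, hP'⟩
      · rw [hE.2]
        exact ⟨fun ⟨i, h⟩ => ⟨σ.symm i, by simpa using h⟩, fun ⟨i, h⟩ => ⟨σ i, h⟩⟩
      · rw [hρ]; simp

def Tt (l : MvPolynomial ℕ ℤ) (S : ∀ p, (ℕ → KK p) → KK p → Prop) (Θ : Th) (n : ℕ) (π : Equiv.Perm (Fin n)) : TT n :=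
  fun p v s => ∃ u : Fin n → KK p, (∀ i, uu v l * u i = s i) ∧ sub S Θ n π p v u

theorem Tt.cons (l : MvPolynomial ℕ ℤ) {S} {Θ : Th} (hS : ConsS S) (hΘ : ∀ n π, ConsV (Θ n π)) (n π) : ConsV (Tt l S Θ n π) := by
  apply Cons.exFun (X := fun p (w : ℕ ⊕ Fin n → KK p) u => (∀ i, uu (fun a => w (.inl a)) l * u i = w (.inr i)) ∧
    sub S Θ n π p (fun a => w (.inl a)) u)
  refine Cons.and (Cons.allF fun i => Cons.eq (Tm.mul ?_ (Tm.var _)) (Tm.var _)) ?_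
  · exact Tm.poly l fun b => Tm.var _
  · exact (ConsV.sub hS hΘ n π).at (fun b => Tm.var _) (fun i => Tm.var _)

theorem uu_frob {p : Nat.Primes} {a : ℕ} {v : ℕ → KK p} (hv : ∀ i, v i ^ (p : ℕ) ^ a = v i) (l : MvPolynomial ℕ ℤ) :
    uu v l ^ (p : ℕ) ^ a = uu v l := by
  have h := aeval_hom (iterateFrobenius (KK p) p a) v l
  simp only [iterateFrobenius_def, hv] at h
  rw [uu_apply]
  first | exact h.symm | exact h

theorem Tt.iff {X S Θ N} (h : Data X S Θ N) {p a} {v : ℕ → KK p} (hA : Adm N p a v) {l : MvPolynomial ℕ ℤ} (hl : uu v l ≠ 0)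
    {M : (MvPolynomial ℕ ℤ)[X]} (hS : ∀ t, S p v t → eval₂ (uu v) (uu v l * t) M = 0) {n : ℕ} {s : Fin n → KK p}
    (hs : Function.Injective s) (hs' : ∀ t, eval₂ (uu v) t M = 0 → ∃ i, s i = t) {π : Equiv.Perm (Fin n)}
    (hπ : ∀ i, s i ^ (p : ℕ) ^ a = s (π i)) : X p a v ↔ Tt l S Θ n π p v s := by
  have hlq := uu_frob hA.hv l
  have hu : ∀ u : Fin n → KK p, (∀ i, uu v l * u i = s i) → (X p a v ↔ sub S Θ n π p v u) := by
    intro u hu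
    refine h.sub_iff hA (fun i i' hi => hs (by rw [← hu, ← hu, hi])) (fun i => ?_) (fun t ht => ?_)
    · apply mul_left_cancel₀ hl
      rw [hu, ← hπ, ← hu, mul_pow, hlq]
    · obtain ⟨i, hi⟩ := hs' _ (hS t ht)
      exact ⟨i, mul_left_cancel₀ hl ((hu i).trans hi)⟩
  constructor
  · intro hX
    have : ∀ i, uu v l * ((uu v l)⁻¹ * s i) = s i := fun i => by field_simp
    exact ⟨_, this, (hu _ this).1 hX⟩
  · rintro ⟨u, h1, h2⟩
    exact (hu u h1).2 h2

noncomputable def cnt (X : WPred) (j : ℕ) (p : Nat.Primes) (a : ℕ) (v : ℕ → KK p) : ℕ :=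
  Nat.card {x : KK p // x ^ (p : ℕ) ^ a = x ∧ X p a (Function.update v j x)}

def Est (C : ℝ) (q c : ℕ) (μ : ℚ) (d : ℕ) : Prop := |(c : ℝ) - μ * (q : ℝ) ^ d| ≤ C * (q : ℝ) ^ d / Real.sqrt q

theorem Est.mono {C C' : ℝ} {q c : ℕ} {μ : ℚ} {d : ℕ} (h : Est C q c μ d) (hC : C ≤ C') : Est C' q c μ d := by
  refine le_trans h ?_
  gcongr

def OV (X : WPred) (j : ℕ) (Cs : WPred) : Prop :=
  ∃ (ι : Type) (_ : Finite ι) (Y : ι → WPred) (d : ι → ℕ) (μ : ι → ℚ) (C : ℝ) (N : ℕ), (∀ k, DD (Y k)) ∧ (∀ k, d k ≤ 1) ∧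
    (∀ k, 0 < μ k) ∧ ∀ p a v, Adm N p a v → Cs p a v → (cnt X j p a v = 0 ∨ ∃ k, Y k p a v) ∧
      ∀ k, Y k p a v → cnt X j p a v ≠ 0 ∧ Est C ((p : ℕ) ^ a) (cnt X j p a v) (μ k) (d k)

theorem OV.union {X : WPred} {j : ℕ} {κ : Type} [Finite κ] {Cs : κ → WPred} (hC : ∀ k, DD (Cs k))
    (h : ∀ k, OV X j (Cs k)) : OV X j (fun p a v => ∃ k, Cs k p a v) := by
  have := Fintype.ofFinite κ
  choose ι hι Y d μ C N h1 h2 h3 h4 using h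
  refine ⟨Σ k, ι k, inferInstance, fun k p a v => Cs k.1 p a v ∧ Y k.1 k.2 p a v, fun k => d k.1 k.2, fun k => μ k.1 k.2,
    ∑ k, |C k|, ∑ k, N k, fun k => (hC _).and (h1 _ _), fun k => h2 _ _, fun k => h3 _ _, ?_⟩
  have hN : ∀ k, N k ≤ ∑ k, N k := fun k => Finset.single_le_sum (f := N) (fun _ _ => Nat.zero_le _) (Finset.mem_univ k)
  have hC' : ∀ k, C k ≤ ∑ k, |C k| := fun k => (le_abs_self _).trans
    (Finset.single_le_sum (f := fun k => |C k|) (fun _ _ => abs_nonneg _) (Finset.mem_univ k))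
  rintro p a v hA ⟨k, hk⟩
  constructor
  · rcases (h4 k p a v (hA.mono (hN k)) hk).1 with h | ⟨i, h⟩
    · exact Or.inl h
    · exact Or.inr ⟨⟨k, i⟩, hk, h⟩
  · rintro ⟨k', i⟩ ⟨h5, h6⟩
    have := (h4 k' p a v (hA.mono (hN k')) h5).2 i h6
    exact ⟨this.1, this.2.mono (hC' k')⟩

theorem OV.congr {X : WPred} {j : ℕ} {Cs Cs' : WPred} (h : OV X j Cs) (N : ℕ) (hC : ∀ p a v, Adm N p a v → Cs' p a v → Cs p a v) :
    OV X j Cs' := by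
  obtain ⟨ι, hι, Y, d, μ, C, N', h1, h2, h3, h4⟩ := h
  exact ⟨ι, hι, Y, d, μ, C, max N N', h1, h2, h3, fun p a v hA hc => h4 p a v (hA.mono (le_max_right _ _)) (hC p a v (hA.mono (le_max_left _ _)) hc)⟩

/-- numerical part -/
theorem num1 {g nf c T bad B q : ℕ} {Cst : ℝ} (hg : 1 ≤ g) (hnf : 1 ≤ nf) (hc : 1 ≤ c) (hq : 1 ≤ q) (hC : 0 ≤ Cst)
    (h : |((g * nf : ℕ) : ℝ) * T - c * q| ≤ Cst * Real.sqrt q) (hB : bad ≤ B) :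
    Est (Cst + B) q (T + bad) ((c : ℚ) / ((g : ℚ) * nf)) 1 := by
  unfold Est
  have hq' : (1 : ℝ) ≤ q := by exact_mod_cast hq
  have hs1 : 1 ≤ Real.sqrt q := Real.one_le_sqrt.2 hq'
  have hss : Real.sqrt q * Real.sqrt q = q := Real.mul_self_sqrt (by linarith)
  have hG : (1 : ℝ) ≤ ((g * nf : ℕ) : ℝ) := by exact_mod_cast Nat.mul_pos hg hnf
  have e1 : (Cst + B) * (q : ℝ) ^ 1 / Real.sqrt q = (Cst + B) * Real.sqrt q := by
    rw [pow_one, div_eq_iff (by linarith), mul_assoc, hss]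
  have e2 : (((c : ℚ) / ((g : ℚ) * nf) : ℚ) : ℝ) = (c : ℝ) / ((g * nf : ℕ) : ℝ) := by push_cast; ring
  rw [e1, e2]
  generalize ((g * nf : ℕ) : ℝ) = G at *
  generalize Real.sqrt q = s at *
  have e3 : ((T + bad : ℕ) : ℝ) - c / G * (q : ℝ) ^ 1 = (G * T - c * q) / G + bad := by
    push_cast
    field_simp
    ring
  have hb : (bad : ℝ) ≤ B := by exact_mod_cast hB
  have hb0 : (0 : ℝ) ≤ bad := by positivity
  rw [e3]
  have h1 : |(G * T - c * q) / G| ≤ Cst * s := by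
    rw [abs_div, abs_of_pos (show 0 < G by linarith)]
    refine (div_le_self (abs_nonneg _) hG).trans h
  have h2 : (B : ℝ) ≤ B * s := le_mul_of_one_le_right (by positivity) hs1
  calc |(G * T - c * q) / G + bad| ≤ |(G * T - c * q) / G| + |(bad : ℝ)| := abs_add_le _ _
    _ ≤ Cst * s + B := by rw [abs_of_nonneg hb0]; linarith
    _ ≤ (Cst + B) * s := by linarith

theorem num2 {G c T q : ℕ} {Cst : ℝ} (hc : 1 ≤ c) (hq : 1 ≤ q) (hC : 0 ≤ Cst)
    (h : |(G : ℝ) * T - c * q| ≤ Cst * Real.sqrt q) (hN : Cst ^ 2 < q) : T ≠ 0 := by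
  rintro rfl
  have hq' : (1 : ℝ) ≤ q := by exact_mod_cast hq
  have hc' : (1 : ℝ) ≤ c := by exact_mod_cast hc
  have hs1 : 1 ≤ Real.sqrt q := Real.one_le_sqrt.2 hq'
  have hss : Real.sqrt q * Real.sqrt q = q := Real.mul_self_sqrt (by linarith)
  have h1 : Cst < Real.sqrt q := Real.lt_sqrt_of_sq_lt hN
  rw [Nat.cast_zero, mul_zero, zero_sub, abs_neg, abs_of_nonneg (by positivity)] at h
  have h2 : (q : ℝ) ≤ c * q := le_mul_of_one_le_left (by positivity) hc'
  have h3 : Cst * Real.sqrt q < Real.sqrt q * Real.sqrt q := mul_lt_mul_of_pos_right h1 (by linarith)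
  linarith
end CDM
end

section
namespace CDM
open Polynomial

def CsP (M : (MvPolynomial ℕ ℤ)[X]) (l : MvPolynomial ℕ ℤ) (S : ∀ p, (ℕ → KK p) → KK p → Prop) (j n i₀ : ℕ) : Pred ℕ :=
  fun p v => (∃ x, uu (Function.update v j x) l ≠ 0) ∧
    (∀ x t, uu (Function.update v j x) l ≠ 0 → S p (Function.update v j x) t →
          eval₂ (uu (Function.update v j x)) (uu (Function.update v j x) l * t) M = 0) ∧
    {x | ∃ s, IsW (Hj M j v) n x s}.Infinite ∧ ∃ s, IsW (Hj M j v) n (v (2 * i₀)) s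

theorem cov_cons (M : (MvPolynomial ℕ ℤ)[X]) (l : MvPolynomial ℕ ℤ) {S : ∀ p, (ℕ → KK p) → KK p → Prop} (hS : ConsS S) (j : ℕ) :
    Cons (fun p v => (∃ x, uu (Function.update v j x) l ≠ 0) ∧
    (∀ x t, uu (Function.update v j x) l ≠ 0 → S p (Function.update v j x) t →
          eval₂ (uu (Function.update v j x)) (uu (Function.update v j x) l * t) M = 0)) := by
  refine Cons.and ?_ ?_
  · apply Cons.exK (X := fun p v x => uu (Function.update v j x) l ≠ 0)
    exact Cons.ne (Tm.uuj l j (fun b => Tm.var _) (Tm.var _)) Tm.zero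
  · apply Cons.allK (X := fun p v x => ∀ t, uu (Function.update v j x) l ≠ 0 → S p (Function.update v j x) t →
          eval₂ (uu (Function.update v j x)) (uu (Function.update v j x) l * t) M = 0)
    apply Cons.allK (X := fun p (v : Option ℕ → KK p) t => uu (Function.update (fun a => v (some a)) j (v none)) l ≠ 0 →
      S p (Function.update (fun a => v (some a)) j (v none)) t →
          eval₂ (uu (Function.update (fun a => v (some a)) j (v none))) (uu (Function.update (fun a => v (some a)) j (v none)) l * t) M = 0)
    simp only [← Hj_ev]
    refine Cons.imp ?_ (Cons.imp ?_ ?_)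
    · exact Cons.ne (Tm.uuj l j (fun b => Tm.var _) (Tm.var _)) Tm.zero
    · exact hS.at (g := fun b p (v : Option (Option ℕ) → KK p) => Function.update (fun b => v (some (some b))) j (v (some none)) b)
        (fun b => Tm.update j (g := fun b p (v : Option (Option ℕ) → KK p) => v (some (some b))) (fun b => Tm.var _) (Tm.var _) b) (Tm.var _)
    · exact Cons.eq (Tm.Hj M j (fun b => Tm.var _) (Tm.var _) ((Tm.uuj l j (fun b => Tm.var _) (Tm.var _)).mul (Tm.var _))) Tm.zero

theorem CsP.cons (M : (MvPolynomial ℕ ℤ)[X]) (l : MvPolynomial ℕ ℤ) {S : ∀ p, (ℕ → KK p) → KK p → Prop} (hS : ConsS S) (j n i₀ : ℕ) :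
    Cons (CsP M l S j n i₀) := by
  refine Cons.and ?_ (Cons.and ?_ (Cons.and ?_ ?_))
  · apply Cons.exK (X := fun p v x => uu (Function.update v j x) l ≠ 0)
    exact Cons.ne (Tm.uuj l j (fun b => Tm.var _) (Tm.var _)) Tm.zero
  · apply Cons.allK (X := fun p v x => ∀ t, uu (Function.update v j x) l ≠ 0 → S p (Function.update v j x) t →
          eval₂ (uu (Function.update v j x)) (uu (Function.update v j x) l * t) M = 0)
    apply Cons.allK (X := fun p (v : Option ℕ → KK p) t => uu (Function.update (fun a => v (some a)) j (v none)) l ≠ 0 →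
      S p (Function.update (fun a => v (some a)) j (v none)) t →
          eval₂ (uu (Function.update (fun a => v (some a)) j (v none))) (uu (Function.update (fun a => v (some a)) j (v none)) l * t) M = 0)
    simp only [← Hj_ev]
    refine Cons.imp ?_ (Cons.imp ?_ ?_)
    · exact Cons.ne (Tm.uuj l j (fun b => Tm.var _) (Tm.var _)) Tm.zero
    · exact hS.at (g := fun b p (v : Option (Option ℕ) → KK p) => Function.update (fun b => v (some (some b))) j (v (some none)) b)
        (fun b => Tm.update j (g := fun b p (v : Option (Option ℕ) → KK p) => v (some (some b))) (fun b => Tm.var _) (Tm.var _) b) (Tm.var _)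
    · exact Cons.eq (Tm.Hj M j (fun b => Tm.var _) (Tm.var _) ((Tm.uuj l j (fun b => Tm.var _) (Tm.var _)).mul (Tm.var _))) Tm.zero
  · exact Cons.exInf (X := fun p v x => ∃ s, IsW (Hj M j v) n x s) (W_cons M j n)
  · apply Cons.exFun (X := fun p v s => IsW (Hj M j v) n (v (2 * i₀)) s)
    exact Cons.isW M j (fun b => Tm.var _) (Tm.var _) (fun i => Tm.var _)

noncomputable def gN (M : (MvPolynomial ℕ ℤ)[X]) (j : ℕ) {n : ℕ} (p : Nat.Primes) (v : ℕ → KK p) (x₀ : KK p) (s : Fin n → KK p) : ℕ :=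
  Nat.card {τ : Equiv.Perm (Fin n) // RelE (eb M n) (Hj M j v) n x₀ s x₀ (fun i => s (τ i))}

noncomputable def cN (M : (MvPolynomial ℕ ℤ)[X]) (j : ℕ) {n : ℕ} (T : Equiv.Perm (Fin n) → TT n) (ρ : Equiv.Perm (Fin n))
    (p : Nat.Primes) (v : ℕ → KK p) (x₀ : KK p) (s : Fin n → KK p) : ℕ :=
  Nat.card {t : Equiv.Perm (Fin n) × Equiv.Perm (Fin n) //
    RelE (eb M n) (Hj M j v) n x₀ (fun i => s (ρ (t.2 i))) x₀ (fun i => s (t.2 (t.1 i))) ∧ Tgen M j (T t.1) p v x₀ (fun i => s (t.2 i))}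

theorem gN_cons (M : (MvPolynomial ℕ ℤ)[X]) (j n i₀ c : ℕ) : ConsV (fun p v (s : Fin n → KK p) => gN M j p v (v (2 * i₀)) s = c) := by
  refine Cons.count (fun τ => ?_) c
  exact Cons.relE _ M j (fun b => Tm.var _) (Tm.var _) (Tm.var _) (fun i => Tm.var _) (fun i => Tm.var _)

theorem cN_cons (M : (MvPolynomial ℕ ℤ)[X]) (j n i₀ c : ℕ) {T : Equiv.Perm (Fin n) → TT n} (hT : ∀ π, ConsV (T π)) (ρ) :
    ConsV (fun p v (s : Fin n → KK p) => cN M j T ρ p v (v (2 * i₀)) s = c) := by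
  refine Cons.count (fun t => Cons.and ?_ ?_) c
  · exact Cons.relE _ M j (fun b => Tm.var _) (Tm.var _) (Tm.var _) (fun i => Tm.var _) (fun i => Tm.var _)
  · exact Cons.tgen M j (hT _) (fun b => Tm.var _) (Tm.var _) (fun i => Tm.var _)

theorem card_filter_eq {ι : Type} [Fintype ι] (P : ι → Prop) [DecidablePred P] : (Finset.univ.filter P).card = Nat.card {i // P i} := by
  rw [Nat.card_eq_fintype_card, Fintype.card_subtype]

theorem natcard_finset {ι : Type} (s : Finset ι) : Nat.card {x // x ∈ s} = s.card := by simp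

theorem case_est {X S Θ N} (h : Data X S Θ N) {j : ℕ} (hj : Odd j) {M : (MvPolynomial ℕ ℤ)[X]} (hM : M.Monic)
    (l : MvPolynomial ℕ ℤ) (n i₀ : ℕ) : ∃ (Cst : ℝ) (B : ℕ), 0 ≤ Cst ∧ ∀ p a v, Adm N p a v → CsP M l S j n i₀ p v →
      ∀ (s : Fin n → KK p) (ρ : Equiv.Perm (Fin n)), IsW (Hj M j v) n (v (2 * i₀)) s → (∀ i, s i ^ (p : ℕ) ^ a = s (ρ i)) →
      1 ≤ gN M j p v (v (2 * i₀)) s ∧ ∃ T : ℕ,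
        cnt X j p a v = T + Nat.card {x : KK p // x ^ (p : ℕ) ^ a = x ∧ (CsP M l S j n i₀ p v ∧ ¬ Good M j l (Tt l S Θ n) p v x) ∧
      X p a (Function.update v j x)} ∧ Nat.card {x : KK p // x ^ (p : ℕ) ^ a = x ∧ (CsP M l S j n i₀ p v ∧ ¬ Good M j l (Tt l S Θ n) p v x) ∧
      X p a (Function.update v j x)} ≤ B ∧
      |((gN M j p v (v (2 * i₀)) s * n.factorial : ℕ) : ℝ) * T - (cN M j (Tt l S Θ n) ρ p v (v (2 * i₀)) s : ℕ) * ((p : ℕ) ^ a : ℕ)| ≤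
        Cst * Real.sqrt ((p : ℕ) ^ a : ℕ) ∧ (cN M j (Tt l S Θ n) ρ p v (v (2 * i₀)) s = 0 → T = 0) := by
  classical
  have hT := Tt.cons l h.1.cons h.2.1 n
  obtain ⟨_, B, -, -, hB⟩ := Cons.uniform (X := Good M j l (Tt l S Θ n)) (Good.cons M j l hT)
  obtain ⟨Cst, hC, hch⟩ := cheb n M.natDegree (xd M) B
  refine ⟨Cst, B, hC, ?_⟩
  intro p a v hA hCs s ρ hs hρ
  obtain ⟨c1, c2, c3, c4⟩ := hCs
  have hcof := Good.cofinite hM j l hT c1 c3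
  have hginf : {x | Good M j l (Tt l S Θ n) p v x}.Infinite := fun hf => by
    refine Set.infinite_univ (α := KK p) ((hf.union hcof).subset fun x _ => ?_)
    by_cases hx : Good M j l (Tt l S Θ n) p v x
    · exact Or.inl hx
    · exact Or.inr hx
  have hncard := (hB p v hginf).2
  obtain ⟨hFf, hFc⟩ := FF_card (K := KK p) (p := p) hA.ha
  let F : Finset (KK p) := (Set.toFinite (FF (KK p) p a : Set (KK p))).toFinset
  have hF : ∀ x, x ∈ F ↔ x ^ (p : ℕ) ^ a = x := fun x => by
    simp only [F, Set.Finite.mem_toFinset, SetLike.mem_coe, mem_FF]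
  have hFcard : F.card = (p : ℕ) ^ a := by
    rw [← hFc, ← Set.ncard_eq_toFinset_card (FF (KK p) p a : Set (KK p)) (Set.toFinite _)]; rfl
  let G := F.filter (fun x => Good M j l (Tt l S Θ n) p v x)
  have hbadle : (F.filter (fun x => ¬ Good M j l (Tt l S Θ n) p v x)).card ≤ B := by
    refine le_trans ?_ hncard
    rw [← Set.ncard_coe_finset]
    exact Set.ncard_le_ncard (fun x hx => (by simpa using (Finset.mem_filter.1 (Finset.mem_coe.1 hx)).2)) hcof
  have hGc : (p : ℕ) ^ a ≤ G.card + B := by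
    rw [← hFcard, ← Finset.card_filter_add_card_filter_not (s := F) (fun x => Good M j l (Tt l S Θ n) p v x)]
    exact Nat.add_le_add_left hbadle _
  obtain ⟨l₀, hl₀⟩ := lab_of_infinite (OO (KK p)) _ (Hj_monic hM j v) c3
  have key := hch (KK p) p a hA.ha (Hj M j v) (Hj_monic hM j v) (Hj_natDegree hM j v) (Hj_coeff M j v) (Hj_frob M j v hA.hv)
    c3 (v (2 * i₀)) (hA.hv _) s hs G (fun x hx => ⟨(hF x).1 (Finset.mem_filter.1 hx).1, (Finset.mem_filter.1 hx).2.2.1⟩) hGc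
    (fun x => X p a (Function.update v j x)) (fun t => Tgen M j (Tt l S Θ n t.1) p v (v (2 * i₀)) (fun i => s (t.2 i)))
    (by
      intro x hx s' π τ hs' hr hπ
      have hx1 := (hF x).1 (Finset.mem_filter.1 hx).1
      have hx2 := (Finset.mem_filter.1 hx).2
      have hr' := (relEj hM j hl₀ (hs.comp τ) hs').1 hr
      have e1 := Tgen.congr hM j hl₀ (T := Tt l S Θ n π) (hs.comp τ) hs' hr'
      refine e1.trans ((hx2.2.2 π s' hs').symm.trans ?_)
      refine (Tt.iff h (hA.update hj hx1) hx2.1 (fun t ht => c2 x t hx2.1 ht) hs'.1 (fun t ht => ?_) hπ).symm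
      rw [← Hj_ev] at ht
      exact (hs'.2 t).1 ht)
  obtain ⟨k1, k2, k3⟩ := key
  have eg : (Finset.univ.filter (fun τ : Equiv.Perm (Fin n) => RelE (ebd n M.natDegree (xd M)) (Hj M j v) n (v (2 * i₀)) s (v (2 * i₀)) (s ∘ τ))).card
      = gN M j p v (v (2 * i₀)) s := card_filter_eq _
  have ec : (Finset.univ.filter (fun t : Equiv.Perm (Fin n) × Equiv.Perm (Fin n) =>
      RelE (ebd n M.natDegree (xd M)) (Hj M j v) n (v (2 * i₀)) (fun i => s (t.2 i) ^ (p : ℕ) ^ a) (v (2 * i₀)) (s ∘ ⇑(t.2 * t.1)) ∧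
        Tgen M j (Tt l S Θ n t.1) p v (v (2 * i₀)) (fun i => s (t.2 i)))).card = cN M j (Tt l S Θ n) ρ p v (v (2 * i₀)) s := by
    simp only [hρ]
    exact card_filter_eq _
  rw [eg] at k1 k2
  rw [ec] at k2 k3
  have ebad : Nat.card {x : KK p // x ^ (p : ℕ) ^ a = x ∧ (CsP M l S j n i₀ p v ∧ ¬ Good M j l (Tt l S Θ n) p v x) ∧
      X p a (Function.update v j x)} = ((F.filter (fun x => ¬ Good M j l (Tt l S Θ n) p v x)).filter (fun x => X p a (Function.update v j x))).card := by
    rw [← natcard_finset]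
    refine Nat.card_congr (Equiv.subtypeEquivRight fun x => ?_)
    rw [Finset.mem_filter, Finset.mem_filter, hF]
    have : CsP M l S j n i₀ p v := ⟨c1, c2, c3, c4⟩
    tauto
  refine ⟨k1, (G.filter (fun x => X p a (Function.update v j x))).card, ?_, ?_, ?_, k3⟩
  · rw [ebad, ← Finset.card_union_of_disjoint, cnt, ← natcard_finset]
    · refine Nat.card_congr (Equiv.subtypeEquivRight fun x => ?_)
      rw [Finset.mem_union, Finset.mem_filter, Finset.mem_filter, Finset.mem_filter, Finset.mem_filter, hF]
      tauto
    · rw [Finset.disjoint_left]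
      intro x hx hx'
      exact (Finset.mem_filter.1 (Finset.mem_filter.1 hx').1).2 (Finset.mem_filter.1 (Finset.mem_filter.1 hx).1).2
  · rw [ebad]
    exact (Finset.card_filter_le _ _).trans hbadle
  · convert k2 using 2
end CDM
end

section
namespace CDM
open Polynomial

def Wset (M : (MvPolynomial ℕ ℤ)[X]) (j i₀ : ℕ) : ∀ p, (ℕ → KK p) → KK p → Prop :=
  fun p v t => ev (Hj M j v) (v (2 * i₀)) t = 0

theorem Wset.isSet {M : (MvPolynomial ℕ ℤ)[X]} (hM : M.Monic) (j i₀ : ℕ) : IsSet (Wset M j i₀) := by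
  classical
  refine ⟨?_, fun p v => ?_⟩
  · exact Cons.eq (Tm.Hj M j (fun b => Tm.var _) (Tm.var _) (Tm.var _)) Tm.zero
  · have h : ((Hj M j v).map (evalRingHom (v (2 * i₀)))) ≠ 0 := ((Hj_monic hM j v).map _).ne_zero
    refine (((Hj M j v).map (evalRingHom (v (2 * i₀)))).roots.toFinset.finite_toSet).subset fun t ht => ?_
    simp only [Finset.mem_coe, Multiset.mem_toFinset, mem_roots h]
    exact ht

theorem gN_le (M : (MvPolynomial ℕ ℤ)[X]) (j : ℕ) {n : ℕ} (p : Nat.Primes) (v : ℕ → KK p) (x₀ : KK p) (s : Fin n → KK p) :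
    gN M j p v x₀ s ≤ n.factorial := by
  classical
  unfold gN
  refine (Finite.card_subtype_le _).trans (le_of_eq ?_)
  rw [Nat.card_eq_fintype_card, Fintype.card_perm, Fintype.card_fin]

theorem cN_le (M : (MvPolynomial ℕ ℤ)[X]) (j : ℕ) {n : ℕ} (T : Equiv.Perm (Fin n) → TT n) (ρ : Equiv.Perm (Fin n))
    (p : Nat.Primes) (v : ℕ → KK p) (x₀ : KK p) (s : Fin n → KK p) :
    cN M j T ρ p v x₀ s ≤ n.factorial * n.factorial := by
  classical
  unfold cN
  refine (Finite.card_subtype_le _).trans (le_of_eq ?_)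
  rw [Nat.card_eq_fintype_card, Fintype.card_prod, Fintype.card_perm, Fintype.card_fin]

theorem OV.case {X S Θ N} (h : Data X S Θ N) {j : ℕ} (hj : Odd j) {M : (MvPolynomial ℕ ℤ)[X]} (hM : M.Monic)
    (l : MvPolynomial ℕ ℤ) (n i₀ : ℕ) : OV X j (fun p a v => CsP M l S j n i₀ p v) := by
  obtain ⟨Cst, B, hC, hest⟩ := case_est h hj hM l n i₀
  have hT := fun m => Tt.cons l h.1.cons h.2.1 m
  have hBset : IsSet (fun p v x => CsP M l S j n i₀ p v ∧ ¬ Good M j l (Tt l S Θ n) p v x) := by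
    refine ⟨Cons.and ((CsP.cons M l h.1.cons j n i₀).comap some) (Cons.not (Good.cons M j l (hT n))), fun p v => ?_⟩
    by_cases hc : CsP M l S j n i₀ p v
    · exact (Good.cofinite hM j l (hT n) hc.1 hc.2.2.1).subset fun x hx => hx.2
    · exact Set.finite_empty.subset fun x hx => hc hx.1
  let Y1 : ℕ → ℕ → WPred := fun g0 c0 p a v => ∃ (s : Fin n → KK p) (ρ : Equiv.Perm (Fin n)), Enum (Wset M j i₀ p v) s ∧
      (∀ i, s i ^ (p : ℕ) ^ a = s (ρ i)) ∧ (gN M j p v (v (2 * i₀)) s = g0 ∧ cN M j (Tt l S Θ n) ρ p v (v (2 * i₀)) s = c0)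
  let Y0 : WPred := fun p a v => ∃ (s : Fin n → KK p) (ρ : Equiv.Perm (Fin n)), Enum (Wset M j i₀ p v) s ∧
      (∀ i, s i ^ (p : ℕ) ^ a = s (ρ i)) ∧ cN M j (Tt l S Θ n) ρ p v (v (2 * i₀)) s = 0
  have hY1 : ∀ g0 c0, DD (Y1 g0 c0) := fun g0 c0 =>
    DD.root (Wset.isSet hM j i₀) (P := fun m ρ p v s => gN M j p v (v (2 * i₀)) s = g0 ∧ cN M j (Tt l S Θ m) ρ p v (v (2 * i₀)) s = c0)
      (fun m ρ => Cons.and (gN_cons M j m i₀ g0) (cN_cons M j m i₀ c0 (hT m) ρ)) n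
  have hY0 : DD Y0 := DD.root (Wset.isSet hM j i₀) (P := fun m ρ p v s => cN M j (Tt l S Θ m) ρ p v (v (2 * i₀)) s = 0)
      (fun m ρ => (cN_cons M j m i₀ 0 (hT m) ρ)) n
  let bc : ∀ (p : Nat.Primes), ℕ → (ℕ → KK p) → ℕ := fun p a v =>
    Nat.card {x : KK p // x ^ (p : ℕ) ^ a = x ∧ (CsP M l S j n i₀ p v ∧ ¬ Good M j l (Tt l S Θ n) p v x) ∧
      X p a (Function.update v j x)}
  have hbc : ∀ b, DD (fun p a v => bc p a v = b) := fun b => DD.bad ⟨S, Θ, N, h⟩ hBset hj b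
  have hnf : 1 ≤ n.factorial := Nat.factorial_pos n
  refine ⟨(Fin n.factorial × Fin (n.factorial * n.factorial)) ⊕ Fin B, inferInstance,
    Sum.elim (fun k => Y1 (k.1 + 1) (k.2 + 1)) (fun b p a v => Y0 p a v ∧ bc p a v = b + 1),
    Sum.elim (fun _ => 1) (fun _ => 0),
    Sum.elim (fun k => (((k.2 + 1 : ℕ) : ℚ) / (((k.1 + 1 : ℕ) : ℚ) * (n.factorial : ℕ)))) (fun b => ((b + 1 : ℕ) : ℚ)),
    Cst + B, max N (⌈Cst ^ 2⌉₊ + 1), ?_, ?_, ?_, ?_⟩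
  · rintro (k | b)
    · exact hY1 _ _
    · exact hY0.and (hbc _)
  · rintro (k | b) <;> simp
  · rintro (k | b)
    · simp only [Sum.elim_inl]; positivity
    · simp only [Sum.elim_inr]; positivity
  intro p a v hA hc
  have hq1 : 1 ≤ (p : ℕ) ^ a := Nat.one_le_pow _ _ p.2.pos
  have hqC : Cst ^ 2 < ((p : ℕ) ^ a : ℕ) := by
    have h1 := (le_max_right _ _).trans hA.hN
    have h2 : ⌈Cst ^ 2⌉₊ < (p : ℕ) ^ a := h1
    exact (Nat.le_ceil _).trans_lt (by exact_mod_cast h2)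
  have hA' := hA.mono (le_max_left _ _)
  obtain ⟨s, hs⟩ := hc.2.2.2
  obtain ⟨ρ, hρ⟩ := IsW.exists_frob (Hj_frob M j v hA.hv) hs (hA.hv _)
  constructor
  · obtain ⟨g1, T, e1, e2, e3, e4⟩ := hest p a v hA' hc s ρ hs hρ
    by_cases hc0 : cN M j (Tt l S Θ n) ρ p v (v (2 * i₀)) s = 0
    · have hT0 := e4 hc0
      rw [hT0, zero_add] at e1
      rcases Nat.eq_zero_or_pos (bc p a v) with hb | hb
      · left; exact e1.trans hb
      · right
        refine ⟨.inr ⟨bc p a v - 1, ?_⟩, ⟨s, ρ, hs, hρ, hc0⟩, ?_⟩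
        · have : bc p a v ≤ B := e2
          omega
        · show bc p a v = bc p a v - 1 + 1
          omega
    · right
      have l1 := gN_le M j p v (v (2 * i₀)) s
      have l2 := cN_le M j (Tt l S Θ n) ρ p v (v (2 * i₀)) s
      refine ⟨.inl ⟨⟨gN M j p v (v (2 * i₀)) s - 1, by omega⟩, ⟨cN M j (Tt l S Θ n) ρ p v (v (2 * i₀)) s - 1, by omega⟩⟩,
        s, ρ, hs, hρ, ?_, ?_⟩
      · show _ = _ - 1 + 1
        omega
      · show _ = _ - 1 + 1
        omega
  · rintro (k | b)
    · rintro ⟨s, ρ, hs, hρ, hg, hcN⟩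
      obtain ⟨g1, T, e1, e2, e3, e4⟩ := hest p a v hA' hc s ρ hs hρ
      rw [hg, hcN] at e3
      have t0 : T ≠ 0 := num2 (by omega) hq1 hC e3 hqC
      refine ⟨by omega, ?_⟩
      rw [e1]
      exact num1 (by omega) hnf (by omega) hq1 hC e3 e2
    · rintro ⟨⟨s, ρ, hs, hρ, hcN⟩, hb⟩
      obtain ⟨g1, T, e1, e2, e3, e4⟩ := hest p a v hA' hc s ρ hs hρ
      have t0 := e4 hcN
      have e5 : cnt X j p a v = b + 1 := by rw [e1, t0, zero_add]; exact hb
      refine ⟨by omega, ?_⟩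
      rw [e5]
      simp only [Sum.elim_inr, Est, pow_zero, mul_one]
      rw [Rat.cast_natCast, sub_self, abs_zero]
      positivity

theorem exists_nW {M : (MvPolynomial ℕ ℤ)[X]} (hM : M.Monic) (j : ℕ) (p : Nat.Primes) (v : ℕ → KK p) :
    ∃ n, n ≤ M.natDegree ∧ {x | ∃ s, IsW (Hj M j v) n x s}.Infinite := by
  obtain ⟨n, lb, hn, hlb⟩ := exists_lab (OO (KK p)) (Hj M j v) (Hj_monic hM j v)
  rw [Hj_natDegree hM] at hn
  exact ⟨n, hn, good_infinite _ (Hj_monic hM j v) hlb⟩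

theorem exists_iW {N₁ B p a} {v : ℕ → KK p} (hA : Adm N₁ p a v) {P : KK p → Prop} (f1 : {x | ¬ P x}.Finite)
    (f2 : {x | ¬ P x}.ncard ≤ B) (hB : B < N₁) : ∃ i : Fin N₁, P (v (2 * i)) := by
  by_contra hcon
  push Not at hcon
  have hinj : Function.Injective (fun i : Fin N₁ => v (2 * (i : ℕ))) := fun i i' hi =>
    Fin.ext (hA.hd _ i.2 _ i'.2 hi)
  have h1 : (Set.range (fun i : Fin N₁ => v (2 * (i : ℕ)))).ncard = N₁ := by
    rw [← Set.image_univ, Set.ncard_image_of_injective _ hinj, Set.ncard_univ, Nat.card_eq_fintype_card, Fintype.card_fin]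
  have h2 := Set.ncard_le_ncard (s := Set.range (fun i : Fin N₁ => v (2 * (i : ℕ)))) (t := {x | ¬ P x}) (by
      rintro _ ⟨i, rfl⟩
      exact hcon i) f1
  omega

theorem W_bound (M : (MvPolynomial ℕ ℤ)[X]) (j n : ℕ) : ∃ B : ℕ, ∀ p (v : ℕ → KK p), {x | ∃ s, IsW (Hj M j v) n x s}.Infinite →
      {x | ¬ ∃ s, IsW (Hj M j v) n x s}.Finite ∧ {x | ¬ ∃ s, IsW (Hj M j v) n x s}.ncard ≤ B := by
  obtain ⟨_, B, -, -, hB⟩ := Cons.uniform (X := fun p v x => ∃ s, IsW (Hj M j v) n x s) (W_cons M j n)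
  exact ⟨B, hB⟩

theorem exists_bd (r : ℕ) (f : Fin r → ℕ) : ∃ D, ∀ k, f k < D :=
  ⟨∑ k, f k + 1, fun k => Nat.lt_succ_of_le (Finset.single_le_sum (f := f) (fun _ _ => Nat.zero_le _) (Finset.mem_univ k))⟩

/-- local version: a single member of the cover -/
theorem OV.one {X S Θ N} (h : Data X S Θ N) {j : ℕ} (hj : Odd j) {M : (MvPolynomial ℕ ℤ)[X]} (hM : M.Monic)
    (l : MvPolynomial ℕ ℤ) : OV X j (fun p a v => (∃ x, uu (Function.update v j x) l ≠ 0) ∧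
    (∀ x t, uu (Function.update v j x) l ≠ 0 → S p (Function.update v j x) t →
          eval₂ (uu (Function.update v j x)) (uu (Function.update v j x) l * t) M = 0)) := by
  choose B hB using W_bound M j
  obtain ⟨N₁, hN₁⟩ := exists_bd (M.natDegree + 1) (fun n => B n)
  have hU : OV X j (fun p a v => ∃ n : Fin (M.natDegree + 1), ∃ i : Fin N₁, CsP M l S j n i p v) :=
    OV.union (Cs := fun (n : Fin (M.natDegree + 1)) p a v => ∃ i : Fin N₁, CsP M l S j n i p v)
      (fun n => DD.exF fun i : Fin N₁ => DD.cons (CsP.cons M l h.1.cons j n i))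
      (fun n => OV.union (Cs := fun (i : Fin N₁) p a v => CsP M l S j n i p v)
        (fun i => DD.cons (CsP.cons M l h.1.cons j n i)) (fun i => OV.case h hj hM l n i))
  refine hU.congr N₁ ?_
  intro p a v hA hc
  obtain ⟨n, hn, hinf⟩ := exists_nW hM j p v
  have hnD : n < M.natDegree + 1 := Nat.lt_succ_of_le hn
  obtain ⟨f1, f2⟩ := hB n p v hinf
  obtain ⟨i, hi⟩ := exists_iW hA (P := fun x => ∃ s, IsW (Hj M j v) n x s) f1 f2 (hN₁ ⟨n, hnD⟩)
  exact ⟨⟨n, hnD⟩, i, hc.1, hc.2, hinf, hi⟩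

theorem OV.all {X : WPred} (hX : DD X) {j : ℕ} (hj : Odd j) : OV X j (fun _ _ _ => True) := by
  obtain ⟨S, Θ, N, h⟩ := hX
  obtain ⟨r, M, l, hM, hcov⟩ := cover h.1 j
  have hU := OV.union (X := X) (j := j) (Cs := fun k p a v => (∃ x, uu (Function.update v j x) (l k) ≠ 0) ∧
    (∀ x t, uu (Function.update v j x) (l k) ≠ 0 → S p (Function.update v j x) t →
          eval₂ (uu (Function.update v j x)) (uu (Function.update v j x) (l k) * t) (M k) = 0))
    (fun k => DD.cons (cov_cons (M k) (l k) h.1.cons j)) (fun k => OV.one h hj (hM k) (l k))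
  exact hU.congr 0 fun p a v hA _ => hcov p v

theorem cnt_pos {X : WPred} {j : ℕ} {p : Nat.Primes} {a : ℕ} {v : ℕ → KK p} (ha : 1 ≤ a) :
    cnt X j p a v ≠ 0 ↔ ∃ x, x ^ (p : ℕ) ^ a = x ∧ X p a (Function.update v j x) := by
  obtain ⟨hFf, hFc⟩ := FF_card (K := KK p) (p := p) ha
  have : Finite {x : KK p // x ^ (p : ℕ) ^ a = x ∧ X p a (Function.update v j x)} :=
    Finite.of_injective (β := FF (KK p) p a) (fun x => ⟨x.1, mem_FF.2 x.2.1⟩)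
      (fun x y hxy => by
        have h' := congrArg Subtype.val hxy
        exact Subtype.ext h')
  unfold cnt
  rw [Nat.card_ne_zero]
  constructor
  · rintro ⟨⟨x, hx⟩, -⟩; exact ⟨x, hx⟩
  · rintro ⟨x, hx⟩; exact ⟨⟨⟨x, hx⟩⟩, this⟩

theorem DD.exx {X : WPred} (hX : DD X) {j : ℕ} (hj : Odd j) :
    DD (fun p a v => ∃ x, x ^ (p : ℕ) ^ a = x ∧ X p a (Function.update v j x)) := by
  obtain ⟨ι, hι, Y, d, μ, C, N, h1, h2, h3, h4⟩ := OV.all hX hj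
  refine (DD.exF h1).congr N fun p a v hA => ?_
  rw [← cnt_pos hA.ha]
  constructor
  · rintro ⟨k, hk⟩; exact ((h4 p a v hA trivial).2 k hk).1
  · intro h; exact (h4 p a v hA trivial).1.resolve_left h

/-- disjoint version -/
theorem OV.disj {X : WPred} (hX : DD X) {j : ℕ} (hj : Odd j) :
    ∃ (r : ℕ) (Y : Fin r → WPred) (d : Fin r → ℕ) (μ : Fin r → ℚ) (C : ℝ) (N : ℕ), 0 ≤ C ∧ (∀ k, DD (Y k)) ∧ (∀ k, d k ≤ 1) ∧
    (∀ k, 0 < μ k) ∧ ∀ p a v, Adm N p a v → ((∀ k, ¬ Y k p a v) ∧ cnt X j p a v = 0) ∨ 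
      ∃ k, (∀ k', Y k' p a v ↔ k' = k) ∧ Est C ((p : ℕ) ^ a) (cnt X j p a v) (μ k) (d k) := by
  obtain ⟨ι, hι, Y, d, μ, C, N, h1, h2, h3, h4⟩ := OV.all hX hj
  let e := (Finite.equivFin ι).symm
  refine ⟨Nat.card ι, fun k p a v => Y (e k) p a v ∧ ∀ k' : {k' // k' < k}, ¬ Y (e k') p a v, fun k => d (e k), fun k => μ (e k), |C|, N,
    abs_nonneg _, fun k => (h1 _).and (DD.allF fun k' => (h1 _).not), fun k => h2 _, fun k => h3 _, ?_⟩
  intro p a v hA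
  by_cases hk : ∃ k, Y (e k) p a v
  · right
    classical
    obtain ⟨k, hk1, hk2⟩ := WellFounded.has_min (wellFounded_lt (α := Fin (Nat.card ι))) {k | Y (e k) p a v} hk
    refine ⟨k, fun k' => ⟨?_, ?_⟩, ((h4 p a v hA trivial).2 _ hk1).2.mono (le_abs_self _)⟩
    · rintro ⟨h5, h6⟩
      rcases lt_trichotomy k k' with hlt | heq | hlt
      · exact absurd hk1 (h6 ⟨k, hlt⟩)
      · exact heq.symm
      · exact absurd hlt (hk2 k' h5)
    · rintro rfl
      exact ⟨hk1, fun k'' h => hk2 k''.1 h k''.2⟩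
  · left
    refine ⟨fun k h => hk ⟨k, h.1⟩, (h4 p a v hA trivial).1.resolve_right ?_⟩
    rintro ⟨i, hi⟩
    exact hk ⟨e.symm i, by simpa using hi⟩
end CDM
end

section
namespace CDM

theorem Est.upper {C : ℝ} {q c d : ℕ} {μ : ℚ} (hC : 0 ≤ C) (hq : 1 ≤ q) (h : Est C q c μ d) : (c : ℝ) ≤ (μ + C) * (q : ℝ) ^ d := by
  unfold Est at h
  have hq' : (1 : ℝ) ≤ q := by exact_mod_cast hq
  have hs1 : 1 ≤ Real.sqrt q := Real.one_le_sqrt.2 hq'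
  have h1 : C * (q : ℝ) ^ d / Real.sqrt q ≤ C * (q : ℝ) ^ d := div_le_self (by positivity) hs1
  have h2 := (abs_le.1 h).2
  linarith

theorem Est.add_eq {C1 C2 : ℝ} {q c1 c2 d : ℕ} {μ1 μ2 : ℚ} (h1 : Est C1 q c1 μ1 d) (h2 : Est C2 q c2 μ2 d) :
    Est (C1 + C2) q (c1 + c2) (μ1 + μ2) d := by
  unfold Est at *
  have e : ((c1 + c2 : ℕ) : ℝ) - ((μ1 + μ2 : ℚ) : ℝ) * (q : ℝ) ^ d = (c1 - μ1 * (q : ℝ) ^ d) + (c2 - μ2 * (q : ℝ) ^ d) := by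
    push_cast; ring
  rw [e]
  refine (abs_add_le _ _).trans ((add_le_add h1 h2).trans (le_of_eq ?_))
  ring

theorem Est.add_lt {C1 C2 : ℝ} {q c1 c2 d1 d2 : ℕ} {μ1 μ2 : ℚ} (hC1 : 0 ≤ C1) (hq : 1 ≤ q) (hμ : 0 < μ1) (hd : d1 < d2)
    (h1 : Est C1 q c1 μ1 d1) (h2 : Est C2 q c2 μ2 d2) :
    Est (μ1 + C1 + C2) q (c1 + c2) μ2 d2 := by
  have hu := h1.upper hC1 hq
  unfold Est at *
  have hq' : (1 : ℝ) ≤ q := by exact_mod_cast hq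
  have hs1 : 1 ≤ Real.sqrt q := Real.one_le_sqrt.2 hq'
  have hss : Real.sqrt q * Real.sqrt q = q := Real.mul_self_sqrt (by linarith)
  have hμ' : (0 : ℝ) < μ1 := by exact_mod_cast hμ
  have e : ((c1 + c2 : ℕ) : ℝ) - (μ2 : ℝ) * (q : ℝ) ^ d2 = c1 + (c2 - μ2 * (q : ℝ) ^ d2) := by
    push_cast; ring
  have hp : (q : ℝ) ^ d1 ≤ (q : ℝ) ^ d2 / Real.sqrt q := by
    rw [le_div_iff₀ (by linarith)]
    have hsq : Real.sqrt q ≤ q := by nlinarith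
    calc (q : ℝ) ^ d1 * Real.sqrt q ≤ (q : ℝ) ^ d1 * q := by gcongr
      _ = (q : ℝ) ^ (d1 + 1) := by ring
      _ ≤ _ := pow_le_pow_right₀ hq' hd
  rw [e]
  have h3 : (c1 : ℝ) ≤ (μ1 + C1) * ((q : ℝ) ^ d2 / Real.sqrt q) := hu.trans (by gcongr)
  refine (abs_add_le _ _).trans ?_
  rw [abs_of_nonneg (Nat.cast_nonneg c1)]
  refine (add_le_add h3 h2).trans (le_of_eq ?_)
  ring

theorem Est.mul' {C C1 : ℝ} {q c T d d' : ℕ} {μ μ' : ℚ} (hC : 0 ≤ C) (hC1 : 0 ≤ C1) (hq : 1 ≤ q) (hμ : 0 < μ)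
    (h1 : Est C1 q c μ' d') (h2 : |(T : ℝ) - c * (μ * (q : ℝ) ^ d)| ≤ c * (C * (q : ℝ) ^ d / Real.sqrt q)) :
    Est ((μ' + C1) * C + μ * C1) q T (μ * μ') (d + d') := by
  have hu := h1.upper hC1 hq
  unfold Est at *
  have hq' : (1 : ℝ) ≤ q := by exact_mod_cast hq
  have hs1 : 1 ≤ Real.sqrt q := Real.one_le_sqrt.2 hq'
  have hμ' : (0 : ℝ) < μ := by exact_mod_cast hμ
  have e : (T : ℝ) - ((μ * μ' : ℚ) : ℝ) * (q : ℝ) ^ (d + d') =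
      (T - c * (μ * (q : ℝ) ^ d)) + (μ * (q : ℝ) ^ d) * (c - μ' * (q : ℝ) ^ d') := by
    push_cast; ring
  rw [e]
  refine (abs_add_le _ _).trans ?_
  rw [abs_mul, abs_of_nonneg (a := (μ : ℝ) * (q : ℝ) ^ d) (by positivity)]
  have h3 : (c : ℝ) * (C * (q : ℝ) ^ d / Real.sqrt q) ≤ ((μ' + C1) * (q : ℝ) ^ d') * (C * (q : ℝ) ^ d / Real.sqrt q) := by
    gcongr
  have h4 : (μ * (q : ℝ) ^ d) * |c - μ' * (q : ℝ) ^ d'| ≤ (μ * (q : ℝ) ^ d) * (C1 * (q : ℝ) ^ d' / Real.sqrt q) := by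
    gcongr
  refine (add_le_add (h2.trans h3) h4).trans (le_of_eq ?_)
  ring

abbrev Cnt := ∀ p : Nat.Primes, ℕ → (ℕ → KK p) → ℕ

def QC (f : Cnt) (m : ℕ) : Prop :=
  ∃ (ι : Type) (_ : Finite ι) (d : ι → ℕ) (μ : ι → ℚ) (C : ℝ) (N : ℕ), 0 ≤ C ∧ (∀ i, d i ≤ m) ∧ (∀ i, 0 < μ i) ∧
    ∀ p a v, Adm N p a v → f p a v = 0 ∨ ∃ i, Est C ((p : ℕ) ^ a) (f p a v) (μ i) (d i)

theorem QC.congr {f g : Cnt} {m : ℕ} (hf : QC f m) (N : ℕ) (h : ∀ p a v, Adm N p a v → f p a v = g p a v) : QC g m := by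
  obtain ⟨ι, hι, d, μ, C, N', h0, h1, h2, h3⟩ := hf
  refine ⟨ι, hι, d, μ, C, max N N', h0, h1, h2, fun p a v hA => ?_⟩
  rw [← h p a v (hA.mono (le_max_left _ _))]
  exact h3 p a v (hA.mono (le_max_right _ _))

theorem QC.zero (m : ℕ) : QC (fun _ _ _ => 0) m :=
  ⟨Empty, inferInstance, fun _ => 0, fun _ => 1, 0, 0, le_rfl, fun i => i.elim, fun i => i.elim, fun _ _ _ _ => Or.inl rfl⟩

/-- constants may depend on the index -/
theorem QC.mk' {f : Cnt} {m : ℕ} {ι : Type} [Finite ι] (d : ι → ℕ) (μ : ι → ℚ) (C : ι → ℝ) (N : ℕ) (h1 : ∀ i, d i ≤ m)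
    (h2 : ∀ i, 0 < μ i) (h3 : ∀ p a v, Adm N p a v → f p a v = 0 ∨ ∃ i, Est (C i) ((p : ℕ) ^ a) (f p a v) (μ i) (d i)) : QC f m := by
  have := Fintype.ofFinite ι
  refine ⟨ι, inferInstance, d, μ, ∑ i, |C i|, N, Finset.sum_nonneg fun _ _ => abs_nonneg _, h1, h2, fun p a v hA => ?_⟩
  refine (h3 p a v hA).imp id fun ⟨i, hi⟩ => ⟨i, hi.mono ?_⟩
  exact (le_abs_self _).trans (Finset.single_le_sum (f := fun k => |C k|) (fun _ _ => abs_nonneg _) (Finset.mem_univ i))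

theorem QC.add {f g : Cnt} {m : ℕ} (hf : QC f m) (hg : QC g m) : QC (fun p a v => f p a v + g p a v) m := by
  obtain ⟨ι, hι, d, μ, C, N, h0, h1, h2, h3⟩ := hf
  obtain ⟨ι', hι', d', μ', C', N', h0', h1', h2', h3'⟩ := hg
  refine QC.mk' (ι := (ι ⊕ ι') ⊕ (ι × ι')) (Sum.elim (Sum.elim d d') (fun k => max (d k.1) (d' k.2)))
    (Sum.elim (Sum.elim μ μ') (fun k => if d k.1 = d' k.2 then μ k.1 + μ' k.2 else if d k.1 < d' k.2 then μ' k.2 else μ k.1))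
    (Sum.elim (Sum.elim (fun _ => C) (fun _ => C')) (fun k => if d k.1 = d' k.2 then C + C' else if d k.1 < d' k.2 then μ k.1 + C + C' else μ' k.2 + C' + C))
    (max N N') ?_ ?_ ?_
  · rintro ((i | i) | ⟨i, k⟩)
    · exact h1 i
    · exact h1' i
    · exact max_le (h1 i) (h1' k)
  · rintro ((i | i) | ⟨i, k⟩)
    · exact h2 i
    · exact h2' i
    · simp only [Sum.elim_inr]
      split_ifs
      · exact add_pos (h2 i) (h2' k)
      · exact h2' k
      · exact h2 i
  · intro p a v hA
    have hq1 : 1 ≤ (p : ℕ) ^ a := Nat.one_le_pow _ _ p.2.pos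
    rcases h3 p a v (hA.mono (le_max_left _ _)) with e | ⟨i, hi⟩ <;>
      rcases h3' p a v (hA.mono (le_max_right _ _)) with e' | ⟨k, hk⟩
    · left; omega
    · right; refine ⟨.inl (.inr k), ?_⟩; rw [e, zero_add]; exact hk
    · right; refine ⟨.inl (.inl i), ?_⟩; rw [e', add_zero]; exact hi
    · right
      refine ⟨.inr ⟨i, k⟩, ?_⟩
      simp only [Sum.elim_inr]
      rcases lt_trichotomy (d i) (d' k) with hlt | heq | hlt
      · rw [if_neg hlt.ne, if_neg hlt.ne, if_pos hlt, if_pos hlt, max_eq_right hlt.le]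
        exact hi.add_lt h0 hq1 (h2 i) hlt hk
      · rw [if_pos heq, if_pos heq, heq, max_self]
        rw [heq] at hi
        exact hi.add_eq hk
      · rw [if_neg hlt.ne', if_neg hlt.ne', if_neg (by omega), if_neg (by omega), max_eq_left hlt.le, add_comm (f p a v)]
        exact hk.add_lt h0' hq1 (h2' k) hlt hi

theorem QC.sum {r : ℕ} {f : Fin r → Cnt} {m : ℕ} (hf : ∀ k, QC (f k) m) : QC (fun p a v => ∑ k, f k p a v) m := by
  induction r with
  | zero => exact (QC.zero m).congr 0 fun p a v _ => by simp
  | succ r ih =>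
    exact ((ih (f := fun k => f k.castSucc) fun k => hf _).add (hf (Fin.last r))).congr 0 fun p a v _ => by
      rw [Fin.sum_univ_castSucc]

theorem QC.mul {f T : Cnt} {m d : ℕ} {μ : ℚ} {C : ℝ} {N : ℕ} (hf : QC f m) (hC : 0 ≤ C) (hd : d ≤ 1) (hμ : 0 < μ)
    (h : ∀ p a v, Adm N p a v → |(T p a v : ℝ) - f p a v * (μ * (((p : ℕ) ^ a : ℕ) : ℝ) ^ d)| ≤
      f p a v * (C * (((p : ℕ) ^ a : ℕ) : ℝ) ^ d / Real.sqrt ((p : ℕ) ^ a : ℕ))) : QC T (m + 1) := by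
  obtain ⟨ι, hι, d', μ', C', N', h0, h1, h2, h3⟩ := hf
  refine QC.mk' (fun i => d + d' i) (fun i => μ * μ' i) (fun i => (μ' i + C') * C + μ * C') (max N N')
    (fun i => by have := h1 i; omega) (fun i => mul_pos hμ (h2 i)) ?_
  intro p a v hA
  have hq1 : 1 ≤ (p : ℕ) ^ a := Nat.one_le_pow _ _ p.2.pos
  have h4 := h p a v (hA.mono (le_max_left _ _))
  rcases h3 p a v (hA.mono (le_max_right _ _)) with e | ⟨i, hi⟩
  · left
    rw [e, Nat.cast_zero, zero_mul, zero_mul, sub_zero] at h4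
    exact_mod_cast abs_nonpos_iff.1 h4
  · right
    exact ⟨i, Est.mul' hC h0 hq1 hμ hi h4⟩

def upd {K : Type} : ∀ m : ℕ, (ℕ → K) → (Fin m → K) → ℕ → K
  | 0, v, _ => v
  | m + 1, v, x => Function.update (upd m v (Fin.init x)) (2 * m + 1) (x (Fin.last m))

theorem upd_odd {K : Type} {m : ℕ} (v : ℕ → K) (x : Fin m → K) (i : Fin m) : upd m v x (2 * i + 1) = x i := by
  induction m with
  | zero => exact i.elim0
  | succ m ih =>
    rw [upd]
    refine Fin.lastCases ?_ (fun i => ?_) i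
    · simp
    · rw [Function.update_of_ne (by have := i.2; simp; omega)]
      exact ih (Fin.init x) i

noncomputable def cm (X : WPred) (m : ℕ) : Cnt := fun p a v =>
  Nat.card {x : Fin m → KK p // (∀ i, x i ^ (p : ℕ) ^ a = x i) ∧ X p a (upd m v x)}

theorem Adm.upd {N m p a} {v : ℕ → KK p} (h : Adm N p a v) (x : Fin m → KK p) (hx : ∀ i, x i ^ (p : ℕ) ^ a = x i) :
    Adm N p a (upd m v x) := by
  induction m with
  | zero => exact h
  | succ m ih => exact (ih (Fin.init x) fun i => hx _).update ⟨m, rfl⟩ (hx _)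

theorem finF {p : Nat.Primes} {a : ℕ} (ha : 1 ≤ a) : Finite {x : KK p // x ^ (p : ℕ) ^ a = x} := by
  obtain ⟨hFf, hFc⟩ := FF_card (K := KK p) (p := p) ha
  exact Finite.of_injective (β := FF (KK p) p a) (fun x => ⟨x.1, mem_FF.2 x.2⟩)
      (fun x y hxy => by
        have h' := congrArg Subtype.val hxy
        exact Subtype.ext h')

theorem finFm {p : Nat.Primes} {a : ℕ} (ha : 1 ≤ a) (m : ℕ) : Finite {x : Fin m → KK p // ∀ i, x i ^ (p : ℕ) ^ a = x i} := by
  have := finF (p := p) ha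
  exact Finite.of_injective (β := Fin m → {x : KK p // x ^ (p : ℕ) ^ a = x}) (fun x i => ⟨x.1 i, x.2 i⟩)
      (fun x y hxy => Subtype.ext (funext fun i => by
        have h' := congrArg Subtype.val (congrFun hxy i)
        exact h'))

theorem sum_est {ι : Type} [Fintype ι] (c : ι → ℕ) (A B : ℝ) (h : ∀ i, |(c i : ℝ) - A| ≤ B) :
    |((∑ i, c i : ℕ) : ℝ) - (Fintype.card ι : ℕ) * A| ≤ (Fintype.card ι : ℕ) * B := by
  have e : ((∑ i, c i : ℕ) : ℝ) - (Fintype.card ι : ℕ) * A = ∑ i, ((c i : ℝ) - A) := by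
    rw [Finset.sum_sub_distrib]; simp
  rw [e]
  refine (Finset.abs_sum_le_sum_abs _ _).trans ((Finset.sum_le_sum fun i _ => h i).trans (le_of_eq ?_))
  simp

theorem sum_part {α : Type} {r : ℕ} (P : α → Prop) (Q : Fin r → α → Prop) [Finite {x // P x}] (h : ∀ x, P x → ∃! k, Q k x) :
    ∑ k, Nat.card {x // P x ∧ Q k x} = Nat.card {x // P x} := by
  have : ∀ k, Finite {x // P x ∧ Q k x} := fun k => Finite.of_injective (β := {x // P x}) (fun x => ⟨x.1, x.2.1⟩)
          (fun x y hxy => by have h' := congrArg Subtype.val hxy; exact Subtype.ext h')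
  rw [← Nat.card_sigma]
  refine Nat.card_eq_of_bijective (fun z => ⟨z.2.1, z.2.2.1⟩) ⟨?_, ?_⟩
  · rintro ⟨k, x, hx⟩ ⟨k', x', hx'⟩ hh
    have h1 : x = x' := congrArg Subtype.val hh
    subst h1
    have h2 : k = k' := (h x hx.1).unique hx.2 hx'.2
    subst h2
    rfl
  · rintro ⟨x, hx⟩
    obtain ⟨k, hk, -⟩ := h x hx
    exact ⟨⟨k, x, hx, hk⟩, rfl⟩

theorem QC.main {X : WPred} (hX : DD X) (m : ℕ) : QC (cm X m) m := by
  classical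
  induction m generalizing X with
  | zero =>
    refine QC.mk' (ι := Unit) (fun _ => 0) (fun _ => 1) (fun _ => 0) 0 (fun _ => le_rfl) (fun _ => one_pos) ?_
    intro p a v hA
    have : cm X 0 p a v = 0 ∨ cm X 0 p a v = 1 := by
      have : Subsingleton {x : Fin 0 → KK p // (∀ i, x i ^ (p : ℕ) ^ a = x i) ∧ X p a (CDM.upd 0 v x)} := inferInstance
      have := Finite.card_le_one_iff_subsingleton.2 this
      change cm X 0 p a v ≤ 1 at this
      omega
    refine this.imp id fun h => ⟨(), ?_⟩
    rw [h]; simp [Est]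
  | succ m ih =>
    obtain ⟨r, Y, d, μ, C, N, h0, h1, h2, h3, h4⟩ := OV.disj hX (j := 2 * m + 1) ⟨m, rfl⟩
    let T : Fin r → Cnt := fun k p a v =>
      Nat.card {x : Fin (m + 1) → KK p // ((∀ i, x i ^ (p : ℕ) ^ a = x i) ∧ X p a (CDM.upd (m + 1) v x)) ∧ Y k p a (CDM.upd m v (Fin.init x))}
    have hT : ∀ k, QC (T k) (m + 1) := by
      intro k
      refine QC.mul (ih (h1 k)) h0 (h2 k) (h3 k) (N := N) fun p a v hA => ?_
      have hf1 := finFm (p := p) hA.ha m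
      have hf2 := finF (p := p) hA.ha
      have hf3 : Finite {x : Fin m → KK p // (∀ i, x i ^ (p : ℕ) ^ a = x i) ∧ Y k p a (CDM.upd m v x)} :=
        Finite.of_injective (β := {x : Fin m → KK p // ∀ i, x i ^ (p : ℕ) ^ a = x i}) (fun x => ⟨x.1, x.2.1⟩)
          (fun x y hxy => by have h' := congrArg Subtype.val hxy; exact Subtype.ext h')
      have hf4 : ∀ w : ℕ → KK p, Finite {y : KK p // y ^ (p : ℕ) ^ a = y ∧ X p a (Function.update w (2 * m + 1) y)} := fun w =>
        Finite.of_injective (β := {x : KK p // x ^ (p : ℕ) ^ a = x}) (fun x => ⟨x.1, x.2.1⟩)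
          (fun x y hxy => by have h' := congrArg Subtype.val hxy; exact Subtype.ext h')
      have := Fintype.ofFinite {x : Fin m → KK p // (∀ i, x i ^ (p : ℕ) ^ a = x i) ∧ Y k p a (CDM.upd m v x)}
      have e : T k p a v = ∑ x : {x : Fin m → KK p // (∀ i, x i ^ (p : ℕ) ^ a = x i) ∧ Y k p a (CDM.upd m v x)},
          cnt X (2 * m + 1) p a (CDM.upd m v x.1) := by
        have e1 := fun w => hf4 w
        have := Nat.card_sigma (β := fun x : {x : Fin m → KK p // (∀ i, x i ^ (p : ℕ) ^ a = x i) ∧ Y k p a (CDM.upd m v x)} =>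
          {y : KK p // y ^ (p : ℕ) ^ a = y ∧ X p a (Function.update (CDM.upd m v x.1) (2 * m + 1) y)})
        refine Eq.trans ?_ this
        refine Nat.card_congr ⟨fun x => ⟨⟨Fin.init x.1, fun i => x.2.1.1 _, x.2.2⟩, ⟨x.1 (Fin.last m), x.2.1.1 _, x.2.1.2⟩⟩,
          fun z => ⟨Fin.snoc z.1.1 z.2.1, ⟨fun i => ?_, ?_⟩, ?_⟩, fun x => ?_, fun z => ?_⟩
        · refine Fin.lastCases ?_ (fun i => ?_) i
          · rw [Fin.snoc_last]; exact z.2.2.1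
          · rw [Fin.snoc_castSucc]; exact z.1.2.1 i
        · have := z.2.2.2
          rw [CDM.upd, Fin.init_snoc, Fin.snoc_last]
          exact this
        · rw [Fin.init_snoc]; exact z.1.2.2
        · exact Subtype.ext (Fin.snoc_init_self _)
        · obtain ⟨⟨x, hx⟩, ⟨y, hy⟩⟩ := z
          have key : ∀ (x' : Fin m → KK p) (y' : KK p) (hx' : (∀ i, x' i ^ (p : ℕ) ^ a = x' i) ∧ Y k p a (CDM.upd m v x'))
            (hy' : y' ^ (p : ℕ) ^ a = y' ∧ X p a (Function.update (CDM.upd m v x') (2 * m + 1) y')), x' = x → y' = y →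
            (⟨⟨x', hx'⟩, ⟨y', hy'⟩⟩ : Σ x : {x : Fin m → KK p // (∀ i, x i ^ (p : ℕ) ^ a = x i) ∧ Y k p a (CDM.upd m v x)},
              {y : KK p // y ^ (p : ℕ) ^ a = y ∧ X p a (Function.update (CDM.upd m v x.1) (2 * m + 1) y)}) = ⟨⟨x, hx⟩, ⟨y, hy⟩⟩ := by
            rintro x' y' hx' hy' rfl rfl
            rfl
          exact key _ _ _ _ (Fin.init_snoc (α := fun _ => KK p) y x) (Fin.snoc_last (α := fun _ => KK p) y x)
      have e2 : cm (Y k) m p a v = Fintype.card {x : Fin m → KK p // (∀ i, x i ^ (p : ℕ) ^ a = x i) ∧ Y k p a (CDM.upd m v x)} :=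
        Nat.card_eq_fintype_card
      rw [e, e2]
      apply sum_est
      intro x
      rcases h4 p a _ (hA.upd x.1 x.2.1) with ⟨h5, -⟩ | ⟨k', h5, h6⟩
      · exact absurd x.2.2 (h5 k)
      · have := (h5 k).1 x.2.2
        rw [← this] at h6; exact h6
    refine (QC.sum hT).congr N fun p a v hA => ?_
    have hf1 := finFm (p := p) hA.ha (m + 1)
    have hf3 : Finite {x : Fin (m + 1) → KK p // (∀ i, x i ^ (p : ℕ) ^ a = x i) ∧ X p a (CDM.upd (m + 1) v x)} :=
        Finite.of_injective (β := {x : Fin (m + 1) → KK p // ∀ i, x i ^ (p : ℕ) ^ a = x i}) (fun x => ⟨x.1, x.2.1⟩)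
          (fun x y hxy => by have h' := congrArg Subtype.val hxy; exact Subtype.ext h')
    refine sum_part _ _ ?_
    rintro x ⟨hx1, hx2⟩
    rcases h4 p a (CDM.upd m v (Fin.init x)) (hA.upd _ fun i => hx1 _) with ⟨-, h5⟩ | ⟨k, h5, -⟩
    · exact absurd h5 ((cnt_pos hA.ha).2 ⟨x (Fin.last m), hx1 _, hx2⟩)
    · exact ⟨k, (h5 k).2 rfl, fun k' hk' => (h5 k').1 hk'⟩
end CDM
end

section
open FirstOrder
namespace CDM
section
attribute [local instance] Ring.compatibleRingOfRing

def vF {p : Nat.Primes} {a : ℕ} (v : ℕ → KK p) (hv : ∀ i, v i ^ (p : ℕ) ^ a = v i) : ℕ → FF (KK p) p a :=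
  fun i => ⟨v i, mem_FF.2 (hv i)⟩

def asg {K : Type} (m n : ℕ) (w : ℕ → K) : Fin m ⊕ Fin n → K :=
  Sum.elim (fun i => w (2 * i + 1)) (fun j => w (2 * (m + j) + 1))

theorem term_Tm {m n : ℕ} (t : Language.ring.Term (Fin m ⊕ Fin n)) : ∃ f : Fn ℕ, Tm f ∧ ∀ (p : Nat.Primes) (a : ℕ) (v : ℕ → KK p)
    (hv : ∀ i, v i ^ (p : ℕ) ^ a = v i), ((t.realize (asg m n (vF v hv)) : FF (KK p) p a) : KK p) = f p v := by
  induction t with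
  | var i =>
    rcases i with i | i
    · exact ⟨_, Tm.var (2 * (i : ℕ) + 1), fun p a v hv => rfl⟩
    · exact ⟨_, Tm.var (2 * (m + (i : ℕ)) + 1), fun p a v hv => rfl⟩
  | func f ts ih =>
    choose g hg hg' using ih
    cases f with
    | add => 
      refine ⟨fun p v => g 0 p v + g 1 p v, (hg 0).add (hg 1), fun p a v hv => ?_⟩
      exact congrArg₂ (· + ·) (hg' 0 p a v hv) (hg' 1 p a v hv)
    | mul => 
      refine ⟨fun p v => g 0 p v * g 1 p v, (hg 0).mul (hg 1), fun p a v hv => ?_⟩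
      exact congrArg₂ (· * ·) (hg' 0 p a v hv) (hg' 1 p a v hv)
    | neg => 
      refine ⟨fun p v => - g 0 p v, (hg 0).neg, fun p a v hv => ?_⟩
      exact congrArg (fun x => - x) (hg' 0 p a v hv)
    | zero => exact ⟨fun p v => 0, Tm.zero, fun p a v hv => rfl⟩
    | one => exact ⟨fun p v => 1, Tm.one, fun p a v hv => rfl⟩

def Xf {m n : ℕ} (φ : Language.ring.BoundedFormula (Fin m) n) : WPred := fun p a v =>
  ∀ hv : (∀ i, v i ^ (p : ℕ) ^ a = v i), φ.Realize (M := FF (KK p) p a) (fun i => vF v hv (2 * i + 1)) (fun j => vF v hv (2 * (m + j) + 1))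

theorem Xf_DD {m n : ℕ} (φ : Language.ring.BoundedFormula (Fin m) n) : DD (Xf φ) := by
  induction φ with
  | falsum => 
    exact (DD.cons (Cons.const False)).congr 0 fun p a v hA => ⟨False.elim, fun h => h hA.hv⟩
  | equal t₁ t₂ =>
    obtain ⟨f1, h1, h1'⟩ := term_Tm t₁
    obtain ⟨f2, h2, h2'⟩ := term_Tm t₂
    refine (DD.cons (Cons.eq h1 h2)).congr 0 fun p a v hA => ?_
    rw [← h1' p a v hA.hv, ← h2' p a v hA.hv]
    refine ⟨fun h _ => Subtype.ext h, fun h => congrArg Subtype.val (h hA.hv)⟩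
  | rel R ts => exact R.elim
  | imp φ ψ ih1 ih2 =>
    refine (ih1.imp ih2).congr 0 fun p a v hA => ?_
    exact ⟨fun h hv h' => h (fun _ => h') hv, fun h h' hv => h hv (h' hv)⟩
  | @all n φ ih =>
    refine ((ih.not).exx (j := 2 * (m + n) + 1) ⟨_, rfl⟩).not.congr 0 fun p a v hA => ?_
    have key : ∀ (x : KK p) (hx : x ^ (p : ℕ) ^ a = x), Xf φ p a (Function.update v (2 * (m + n) + 1) x) ↔
        φ.Realize (M := FF (KK p) p a) (fun i => vF v hA.hv (2 * i + 1)) (Fin.snoc (fun j : Fin n => vF v hA.hv (2 * (m + j) + 1)) ⟨x, mem_FF.2 hx⟩) := by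
      intro x hx
      have hA' := hA.update (j := 2 * (m + n) + 1) ⟨_, rfl⟩ hx
      have e1 : (fun i : Fin m => vF _ hA'.hv (2 * i + 1)) = (fun i : Fin m => vF v hA.hv (2 * i + 1)) := by
        funext i
        apply Subtype.ext
        exact Function.update_of_ne (by have := i.2; omega) _ _
      have e2 : (fun j : Fin (n + 1) => vF _ hA'.hv (2 * (m + j) + 1)) =
          (Fin.snoc (fun j : Fin n => vF v hA.hv (2 * (m + j) + 1)) ⟨x, mem_FF.2 hx⟩ : Fin (n + 1) → FF (KK p) p a) := by
        funext j
        refine Fin.lastCases ?_ (fun j => ?_) j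
        · rw [Fin.snoc_last]
          apply Subtype.ext
          exact Function.update_self _ _ _
        · rw [Fin.snoc_castSucc]
          apply Subtype.ext
          exact Function.update_of_ne (by have := j.2; simp; omega) _ _
      rw [← e1, ← e2]
      exact ⟨fun h => h hA'.hv, fun h _ => h⟩
    constructor
    · intro h hv
      rw [Language.BoundedFormula.realize_all]
      rintro ⟨x, hx⟩
      by_contra hc
      exact h ⟨x, mem_FF.1 hx, fun h' => hc ((key x (mem_FF.1 hx)).1 h')⟩
    · rintro h ⟨x, hx, hc⟩
      have := h hA.hv
      rw [Language.BoundedFormula.realize_all] at this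
      exact hc ((key x hx).2 (this ⟨x, mem_FF.2 hx⟩))
end
end CDM
end

namespace CDM
open FirstOrder

theorem count_ringEquiv {m : ℕ} (φ : Language.ring.Formula (Fin m)) {K L : Type} [Field K] [Field L] (e : K ≃+* L) :
    ringFormulaCount φ K = ringFormulaCount φ L := by
  letI := Ring.compatibleRingOfRing K
  letI := Ring.compatibleRingOfRing L
  let g : Language.ring.Equiv K L := Ring.languageEquivEquivRingEquiv.symm e
  unfold ringFormulaCount
  refine Nat.card_congr ((Equiv.arrowCongr (Equiv.refl (Fin m)) g.toEquiv).subtypeEquiv fun x => ?_)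
  exact (Language.StrongHomClass.realize_formula g φ (v := x)).symm

theorem count_FF {m : ℕ} (φ : Language.ring.Formula (Fin m)) (P : Nat.Primes) {a : ℕ} (v : ℕ → KK P)
    (hv : ∀ i, v i ^ (P : ℕ) ^ a = v i) (hu : ∀ x : Fin m → KK P, (∀ i, x i ^ (P : ℕ) ^ a = x i) → ∀ i, upd m v x i ^ (P : ℕ) ^ a = upd m v x i) :
    cm (Xf φ) m P a v = ringFormulaCount φ (FF (KK P) P a) := by
  unfold cm ringFormulaCount
  letI := Ring.compatibleRingOfRing (FF (KK P) P a)
  symm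
  have key : ∀ x : Fin m → FF (KK P) P a, φ.Realize x ↔ Xf φ P a (upd m v (fun i => (x i : KK P))) := by
    intro x
    have hh := hu (fun i => (x i : KK P)) (fun i => mem_FF.1 (x i).2)
    have e1 : (fun i : Fin m => vF _ hh (2 * i + 1)) = x := by
      funext i
      exact Subtype.ext (upd_odd v _ i)
    have e2 : (φ.Realize x ↔ Language.BoundedFormula.Realize (L := Language.ring) φ (fun i : Fin m => vF _ hh (2 * i + 1)) (fun j : Fin 0 => vF _ hh (2 * (m + j) + 1))) := by
      rw [e1]
      unfold Language.Formula.Realize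
      rw [Subsingleton.elim (default : Fin 0 → FF (KK P) P a)]
    exact e2.trans ⟨fun h _ => h, fun h => h hh⟩
  refine Nat.card_congr ⟨fun x => ⟨fun i => (x.1 i : KK P), fun i => mem_FF.1 (x.1 i).2, (key x.1).1 x.2⟩,
    fun x => ⟨fun i => ⟨x.1 i, mem_FF.2 (x.2.1 i)⟩, (key _).2 x.2.2⟩, fun x => rfl, fun x => rfl⟩

theorem exists_adm (N : ℕ) (P : Nat.Primes) {a : ℕ} (ha : 1 ≤ a) (hN : N ≤ (P : ℕ) ^ a) : ∃ v : ℕ → KK P, Adm N P a v := by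
  obtain ⟨hFf, hFc⟩ := FF_card (K := KK P) (p := P) ha
  let e : Fin ((P : ℕ) ^ a) ≃ FF (KK P) P a := (finCongr hFc.symm).trans (Finite.equivFin (FF (KK P) P a)).symm
  let w : ℕ → FF (KK P) P a := fun i => if h : i < N then e ⟨i, h.trans_le hN⟩ else 0
  refine ⟨fun i => (w (i / 2) : KK P), ha, hN, fun i => mem_FF.1 (w (i / 2)).2, fun i hi j hj h => ?_⟩
  have h1 : w i = w j := by
    apply Subtype.ext
    simpa using h
  simp only [w, dif_pos hi, dif_pos hj] at h1
  simpa using e.injective h1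

theorem small {q N m c : ℕ} {C : ℝ} (hC : (N : ℝ) ^ (m + 1) ≤ C) (hq : 1 ≤ q) (hqN : q ≤ N) (hc : c ≤ q ^ m) : Est C q c 1 0 := by
  have hq' : (1 : ℝ) ≤ q := by exact_mod_cast hq
  have hN' : (q : ℝ) ≤ N := by exact_mod_cast hqN
  have hs1 : 1 ≤ Real.sqrt q := Real.one_le_sqrt.2 hq'
  have hss : Real.sqrt q * Real.sqrt q = q := Real.mul_self_sqrt (by linarith)
  have hsq : Real.sqrt q ≤ q := by nlinarith
  have hc' : (c : ℝ) ≤ (q : ℝ) ^ m := by exact_mod_cast hc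
  have hc2 : (c : ℝ) ≤ (N : ℝ) ^ m := hc'.trans (by gcongr)
  have h1 : (1 : ℝ) ≤ (N : ℝ) ^ m := one_le_pow₀ (hq'.trans hN')
  unfold Est
  rw [pow_zero, mul_one, mul_one, Rat.cast_one, le_div_iff₀ (by linarith)]
  have hc0 : (0 : ℝ) ≤ c := Nat.cast_nonneg c
  calc |(c : ℝ) - 1| * Real.sqrt q ≤ (N : ℝ) ^ m * N := by
        apply mul_le_mul _ (hsq.trans hN') (by positivity) (by positivity)
        rw [abs_le]; constructor <;> linarith
    _ = (N : ℝ) ^ (m + 1) := by ring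
    _ ≤ C := hC

theorem final (m : ℕ) (φ : Language.ring.Formula (Fin m)) : ∃ (ι : Type) (_ : Finite ι) (_ : Nonempty ι) (d : ι → ℕ) (μ : ι → ℚ) (C : ℝ),
    0 < C ∧ (∀ i, d i ≤ m) ∧ (∀ i, 0 < μ i) ∧ ∀ (p : ℕ) [Fact p.Prime], ∀ k : ℕ, 1 ≤ k → ringFormulaCount φ (GaloisField p k) = 0 ∨
      ∃ i, Est C (p ^ k) (ringFormulaCount φ (GaloisField p k)) (μ i) (d i) := by
  obtain ⟨ι, hι, d, μ, C, N, h0, h1, h2, h3⟩ := QC.main (Xf_DD φ) m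
  refine ⟨Option ι, inferInstance, inferInstance, fun o => o.elim 0 d, fun o => o.elim 1 μ, C + (N : ℝ) ^ (m + 1) + 1, by positivity, ?_, ?_, ?_⟩
  · rintro (_ | i)
    · exact Nat.zero_le _
    · exact h1 i
  · rintro (_ | i)
    · exact one_pos
    · exact h2 i
  intro p hp k hk
  have hq1 : 1 ≤ p ^ k := Nat.one_le_pow _ _ hp.out.pos
  by_cases hN : N ≤ p ^ k
  · let P : Nat.Primes := ⟨p, hp.out⟩
    obtain ⟨v, hA⟩ := exists_adm N P hk hN
    have e1 := count_FF φ P v hA.hv (fun x hx => (hA.upd x hx).hv)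
    obtain ⟨hFf, hFc⟩ := FF_card (K := KK P) (p := P) hk
    have e2 : ringFormulaCount φ (GaloisField p k) = ringFormulaCount φ (FF (KK P) P k) := by
      haveI := Fintype.ofFinite (GaloisField p k)
      haveI := Fintype.ofFinite (FF (KK P) P k)
      apply count_ringEquiv
      apply FiniteField.ringEquivOfCardEq
      rw [← Nat.card_eq_fintype_card, ← Nat.card_eq_fintype_card, hFc, GaloisField.card p k (by omega)]
    rw [e2, ← e1]
    refine (h3 P k v hA).imp id ?_
    rintro ⟨i, hi⟩
    refine ⟨some i, hi.mono ?_⟩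
    have : (0 : ℝ) ≤ (N : ℝ) ^ (m + 1) := by positivity
    linarith
  · right
    refine ⟨none, small (N := N) (m := m) (by linarith) hq1 (by omega) ?_⟩
    unfold ringFormulaCount
    refine (Finite.card_subtype_le _).trans (le_of_eq ?_)
    rw [Nat.card_fun, GaloisField.card p k (by omega), Nat.card_eq_fintype_card, Fintype.card_fin]
end CDM

/-- The Galois-stratification / non-regular Chebotarev counting estimate: for a formula `φ`
with `m` free variables there are a constant `C > 0`, an `r ≥ 1`, dimensions `d i ≤ m`, and
positive rationals `μ i` such that over every finite prime field extension with `Q = p^k`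
elements, the number `N` of satisfying `m`-tuples is either `0` or satisfies
`|N − μ i · Q^{d i}| ≤ C · Q^{d i} / √Q` for some `i`. -/
theorem definable_count_estimate (m : ℕ) (φ : Language.ring.Formula (Fin m)) :
    ∃ (C : ℝ) (r : ℕ) (d : Fin r → ℕ) (μ : Fin r → ℚ),
      0 < C ∧ 1 ≤ r ∧ (∀ i, d i ≤ m) ∧ (∀ i, 0 < μ i) ∧
      ∀ (p : ℕ) [Fact p.Prime], ∀ k : ℕ, 1 ≤ k →
        ringFormulaCount φ (GaloisField p k) = 0 ∨
        ∃ i : Fin r,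
          |(ringFormulaCount φ (GaloisField p k) : ℝ) - (μ i : ℝ) * ((p : ℝ) ^ k) ^ (d i)| ≤
            C * ((p : ℝ) ^ k) ^ (d i) / Real.sqrt ((p : ℝ) ^ k) := by
  obtain ⟨ι, hι, hne, d, μ, C, h0, h1, h2, h3⟩ := CDM.final m φ
  let e := (Finite.equivFin ι).symm
  refine ⟨C, Nat.card ι, fun i => d (e i), fun i => μ (e i), h0, Nat.card_pos, fun i => h1 _, fun i => h2 _, ?_⟩
  intro p hp k hk
  refine (h3 p k hk).imp id ?_
  rintro ⟨i, hi⟩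
  refine ⟨e.symm i, ?_⟩
  simp only [Equiv.apply_symm_apply]
  unfold CDM.Est at hi
  simpa only [Nat.cast_pow] using hi
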